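/- The subsequential limit function χ from the previous convergence satisfies the dynamic programming principle: for every m₀ ∈ P(𝕋^d) and every t > 0, χ(m₀) = inf over pairs (m,α), with m ∈ C⁰([0,t],P(𝕋^d)), α ∈ L²_m([0,t]×𝕋^d;ℝ^d) and −∂ₜm + Δm + div(mα) = 0 distributionally with m(0) = m₀, of [∫₀^t (∫_{𝕋^d} H*(x,α) dm(s) + F(m(s))) ds + χ(m(t))] + λ t; moreover this infimum is attained. -/

import Mathlib

/- Common framework for "On the long time convergence of potential MFG" (M. Masoero).

We work on the flat torus `𝕋^d`, modeled as `Td d := Fin d → AddCircle 1`.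
Smooth functions on the torus are represented by `ℤ^d`-periodic functions on
`Vd d := Fin d → ℝ`; a function on `Vd d` is transported to the torus through the
canonical (measurable) section `secT : Td d → Vd d`.  Probability measures on the
torus are `PTd d := ProbabilityMeasure (Td d)`, endowed with the 1-Wasserstein
distance `W1` defined through Kantorovich duality.  The Fokker--Planck equations
and their stationary analogues are stated in the sense of distributions, i.e.
against smooth periodic test functions; `σ` is the viscosity parameter
(everywhere `σ = 1` except in the non-convex example). -/

open MeasureTheory Real Set Filter

noncomputable section

abbrev Vd (d : ℕ) : Type := Fin d → ℝ
abbrev Td (d : ℕ) : Type := Fin d → AddCircle (1 : ℝ)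

instance factOneposR : Fact ((0:ℝ) < 1) := ⟨one_pos⟩

/-- The canonical measurable section of the torus, with values in `[0,1)^d`. -/
def secT {d : ℕ} (y : Td d) : Vd d := fun i => ((AddCircle.equivIco 1 0) (y i)).1

/-- The vector of `ℝ^d` associated with an integer vector. -/
def intVec {d : ℕ} (z : Fin d → ℤ) : Vd d := fun i => (z i : ℝ)

/-- Euclidean scalar product on `ℝ^d`. -/
def dotp {d : ℕ} (a b : Vd d) : ℝ := ∑ i, a i * b i

/-- Squared euclidean norm on `ℝ^d`. -/
def sqnorm {d : ℕ} (a : Vd d) : ℝ := ∑ i, (a i)^2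

/-- Spatial gradient. -/
def gradv {d : ℕ} (g : Vd d → ℝ) (x : Vd d) : Vd d := fun i => fderiv ℝ g x (Pi.single i 1)

/-- Second derivative of `g` at `x` in the directions `v, w`. -/
def D2 {d : ℕ} (g : Vd d → ℝ) (x v w : Vd d) : ℝ := fderiv ℝ (fun y => fderiv ℝ g y v) x w

/-- Laplacian. -/
def lapl {d : ℕ} (g : Vd d → ℝ) (x : Vd d) : ℝ := ∑ i, D2 g x (Pi.single i 1) (Pi.single i 1)

/-- Divergence of a vector field. -/
def divv {d : ℕ} (b : Vd d → Vd d) (x : Vd d) : ℝ :=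
  ∑ i, fderiv ℝ (fun y => b y i) x (Pi.single i 1)

/-- Time derivative of a time dependent function. -/
def tderiv {d : ℕ} (u : ℝ → Vd d → ℝ) (t : ℝ) (x : Vd d) : ℝ := deriv (fun s => u s x) t

abbrev PTd (d : ℕ) := ProbabilityMeasure (Td d)

/-- The 1-Wasserstein (Monge--Kantorovich) distance, via Kantorovich duality. -/
def W1 {d : ℕ} (μ ν : PTd d) : ℝ :=
  sSup { r | ∃ φ : Td d → ℝ, LipschitzWith 1 φ ∧
    r = (∫ y, φ y ∂(μ : Measure (Td d))) - ∫ y, φ y ∂(ν : Measure (Td d)) }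

/-- The convex combination `(1-t) μ + t ν`. -/
def lineComb {d : ℕ} (t : ℝ) (μ ν : PTd d) : Measure (Td d) :=
  ENNReal.ofReal (1 - t) • (μ : Measure (Td d)) + ENNReal.ofReal t • (ν : Measure (Td d))

/-- The standing assumptions of the paper: a Hamiltonian `H` (a `ℤ^d`-periodic function of
`(x,p)`), its convex conjugate `Hstar` in the `p` variable, a `C²` coupling function
`Fc` on `P(𝕋^d)` with flat derivative `Fd` (represented by periodic functions on `ℝ^d`),
with the regularity and growth conditions of the paper. -/
structure MFGSetting (d : ℕ) where
  H : Vd d → Vd d → ℝ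
  Hstar : Vd d → Vd d → ℝ
  Fc : PTd d → ℝ
  Fd : Measure (Td d) → Vd d → ℝ
  Cbar : ℝ
  Cbar_pos : 0 < Cbar
  θ : ℝ
  θ_mem : θ ∈ Set.Ioo (0:ℝ) 1
  Cg : ℝ
  Cg_pos : 0 < Cg
  CF : ℝ
  H_smooth : ContDiff ℝ 2 (fun q : Vd d × Vd d => H q.1 q.2)
  H_per : ∀ (x : Vd d) (z : Fin d → ℤ) (p : Vd d), H (x + intVec z) p = H x p
  Dpp_lip : ∃ L : ℝ, 0 ≤ L ∧ ∀ (x p₁ p₂ v w : Vd d),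
    |D2 (fun p => H x p) p₁ v w - D2 (fun p => H x p) p₂ v w| ≤ L * ‖p₁ - p₂‖ * ‖v‖ * ‖w‖
  Dpp_lower : ∀ x p v : Vd d, Cbar⁻¹ * sqnorm v ≤ D2 (fun p' => H x p') p v v
  Dpp_upper : ∀ x p v : Vd d, D2 (fun p' => H x p') p v v ≤ Cbar * sqnorm v
  Dxx_growth : ∀ x p v w : Vd d,
    |D2 (fun x' => H x' p) x v w| ≤ Cg * (1 + ‖p‖) ^ (1 + θ) * ‖v‖ * ‖w‖
  Dxp_growth : ∀ x p v w : Vd d,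
    |fderiv ℝ (fun x' => fderiv ℝ (fun p' => H x' p') p v) x w| ≤ Cg * (1 + ‖p‖) ^ θ * ‖v‖ * ‖w‖
  Hstar_eq : ∀ x q : Vd d, IsLUB (Set.range fun p => dotp q p - H x p) (Hstar x q)
  Fd_per : ∀ (μ : Measure (Td d)) (x : Vd d) (z : Fin d → ℤ), Fd μ (x + intVec z) = Fd μ x
  Fd_smooth : ∀ μ : Measure (Td d), IsProbabilityMeasure μ → ContDiff ℝ 2 (Fd μ)
  Fd_D2_bound : ∀ μ : Measure (Td d), IsProbabilityMeasure μ →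
    ∀ x v w : Vd d, |D2 (Fd μ) x v w| ≤ CF * ‖v‖ * ‖w‖
  flat_deriv : ∀ μ ν : PTd d,
    Fc ν - Fc μ = ∫ t in Set.Icc (0:ℝ) 1,
      ((∫ y, Fd (lineComb t μ ν) (secT y) ∂(ν : Measure (Td d))) -
        ∫ y, Fd (lineComb t μ ν) (secT y) ∂(μ : Measure (Td d)))
  Fd_normalized : ∀ μ : PTd d, (∫ y, Fd (μ : Measure (Td d)) (secT y) ∂(μ : Measure (Td d))) = 0
  Fc_bounded : ∃ M : ℝ, ∀ μ : PTd d, |Fc μ| ≤ M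
  Fd_bounded : ∃ M : ℝ, ∀ (μ : PTd d) (x : Vd d), |Fd (μ : Measure (Td d)) x| ≤ M

/-- Smooth periodic test functions on `[0,∞) × 𝕋^d` (resp. `ℝ × 𝕋^d`). -/
def IsTestFun {d : ℕ} (φ : ℝ → Vd d → ℝ) : Prop :=
  ContDiff ℝ 2 (fun q : ℝ × Vd d => φ q.1 q.2) ∧
  ∀ (t : ℝ) (x : Vd d) (z : Fin d → ℤ), φ t (x + intVec z) = φ t x

/-- The weak (distributional) formulation of the Fokker--Planck equation
`-∂ₜ m + σ Δ m + div(m α) = 0` between times `s₁` and `s₂`. -/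
def FPeq {d : ℕ} (σ : ℝ) (m : ℝ → PTd d) (α : ℝ → Td d → Vd d) (s₁ s₂ : ℝ) : Prop :=
  ∀ φ : ℝ → Vd d → ℝ, IsTestFun φ →
    (∫ y, φ s₂ (secT y) ∂(m s₂ : Measure (Td d))) -
      (∫ y, φ s₁ (secT y) ∂(m s₁ : Measure (Td d))) =
    ∫ s in s₁..s₂, ∫ y, (tderiv φ s (secT y) + σ * lapl (φ s) (secT y)
        - dotp (α s y) (gradv (φ s) (secT y))) ∂(m s : Measure (Td d))

/-- Continuity of a curve of measures with respect to the 1-Wasserstein distance. -/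
def W1ContOn {d : ℕ} (m : ℝ → PTd d) (I : Set ℝ) : Prop :=
  ∀ t ∈ I, ∀ ε > 0, ∃ η > 0, ∀ s ∈ I, |s - t| < η → W1 (m s) (m t) < ε

/-- Continuity of a function on `P(𝕋^d)` with respect to the 1-Wasserstein distance. -/
def W1Continuous {d : ℕ} (χ : PTd d → ℝ) : Prop :=
  ∀ μ : PTd d, ∀ ε > 0, ∃ η > 0, ∀ ν : PTd d, W1 μ ν < η → |χ ν - χ μ| < ε

/-- W1-closed subsets of `P(𝕋^d)`. -/
def IsClosedW1 {d : ℕ} (C : Set (PTd d)) : Prop :=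
  ∀ μ : PTd d, (∀ ε > 0, ∃ ν ∈ C, W1 μ ν < ε) → μ ∈ C

/-- The running cost `∫ H*(x,α(s)) dm(s) + 𝓕(m(s))`. -/
def runCost {d : ℕ} (S : MFGSetting d) (m : ℝ → PTd d) (α : ℝ → Td d → Vd d) (s : ℝ) : ℝ :=
  (∫ y, S.Hstar (secT y) (α s y) ∂(m s : Measure (Td d))) + S.Fc (m s)

/-- Admissible pairs `(m,α)` on `[0,T]` starting from `m₀` (with `α ∈ L²_m`). -/
def AdmOn {d : ℕ} (S : MFGSetting d) (σ : ℝ) (m₀ : PTd d) (T : ℝ)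
    (m : ℝ → PTd d) (α : ℝ → Td d → Vd d) : Prop :=
  m 0 = m₀ ∧ W1ContOn m (Set.Icc 0 T) ∧
  (∀ s₁ s₂ : ℝ, 0 ≤ s₁ → s₁ ≤ s₂ → s₂ ≤ T → FPeq σ m α s₁ s₂) ∧
  Measurable (fun q : ℝ × Td d => α q.1 q.2) ∧
  (∫⁻ s in Set.Ioc (0:ℝ) T, ∫⁻ y, ENNReal.ofReal (sqnorm (α s y)) ∂(m s : Measure (Td d))) < ⊤ ∧
  IntervalIntegrable (runCost S m α) volume 0 T

/-- Admissible pairs `(m,α)` on `[0,T]` starting from `m₀`, with `α` merely in `L¹_m`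
(the class `Π_T` used for problems with prescribed endpoints). -/
def AdmOn1 {d : ℕ} (S : MFGSetting d) (σ : ℝ) (m₀ : PTd d) (T : ℝ)
    (m : ℝ → PTd d) (α : ℝ → Td d → Vd d) : Prop :=
  m 0 = m₀ ∧ W1ContOn m (Set.Icc 0 T) ∧
  (∀ s₁ s₂ : ℝ, 0 ≤ s₁ → s₁ ≤ s₂ → s₂ ≤ T → FPeq σ m α s₁ s₂) ∧
  Measurable (fun q : ℝ × Td d => α q.1 q.2) ∧
  (∫⁻ s in Set.Ioc (0:ℝ) T, ∫⁻ y, ENNReal.ofReal (Real.sqrt (sqnorm (α s y)))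
      ∂(m s : Measure (Td d))) < ⊤ ∧
  IntervalIntegrable (runCost S m α) volume 0 T

/-- The finite horizon cost. -/
def costT {d : ℕ} (S : MFGSetting d) (m : ℝ → PTd d) (α : ℝ → Td d → Vd d) (T : ℝ) : ℝ :=
  ∫ s in (0:ℝ)..T, runCost S m α s

/-- The value `𝒰(T,m₀)` of the finite horizon problem. -/
def Ufun {d : ℕ} (S : MFGSetting d) (σ : ℝ) (T : ℝ) (m₀ : PTd d) : ℝ :=
  sInf { r | ∃ m α, AdmOn S σ m₀ T m α ∧ r = costT S m α T }

/-- Admissible pairs for the infinite horizon `δ`-discounted problem. -/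
def AdmDisc {d : ℕ} (S : MFGSetting d) (σ : ℝ) (δ : ℝ) (m₀ : PTd d)
    (m : ℝ → PTd d) (α : ℝ → Td d → Vd d) : Prop :=
  m 0 = m₀ ∧ W1ContOn m (Set.Ici 0) ∧
  (∀ s₁ s₂ : ℝ, 0 ≤ s₁ → s₁ ≤ s₂ → FPeq σ m α s₁ s₂) ∧
  Measurable (fun q : ℝ × Td d => α q.1 q.2) ∧
  (∫⁻ s in Set.Ioi (0:ℝ), ENNReal.ofReal (Real.exp (-δ * s)) *
      ∫⁻ y, ENNReal.ofReal (sqnorm (α s y)) ∂(m s : Measure (Td d))) < ⊤ ∧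
  Integrable (fun s => Real.exp (-δ * s) * runCost S m α s) (volume.restrict (Set.Ioi 0))

/-- The discounted cost. -/
def costDisc {d : ℕ} (S : MFGSetting d) (δ : ℝ) (m : ℝ → PTd d) (α : ℝ → Td d → Vd d) : ℝ :=
  ∫ s in Set.Ioi (0:ℝ), Real.exp (-δ * s) * runCost S m α s

/-- The value `𝒱_δ(m₀)` of the discounted problem. -/
def Vfun {d : ℕ} (S : MFGSetting d) (σ : ℝ) (δ : ℝ) (m₀ : PTd d) : ℝ :=
  sInf { r | ∃ m α, AdmDisc S σ δ m₀ m α ∧ r = costDisc S δ m α }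

/-- `D_p H (x, p)`. -/
def DpH {d : ℕ} (S : MFGSetting d) (x p : Vd d) : Vd d :=
  fun i => fderiv ℝ (fun p' => S.H x p') p (Pi.single i 1)

/-- `C^{1,2}` regularity on `I × 𝕋^d` of a (periodic) time-dependent function. -/
def Creg12 {d : ℕ} (u : ℝ → Vd d → ℝ) (I : Set ℝ) : Prop :=
  ContinuousOn (fun q : ℝ × Vd d => u q.1 q.2) (I ×ˢ Set.univ) ∧
  (∀ x : Vd d, ∀ t ∈ I, DifferentiableAt ℝ (fun s => u s x) t) ∧
  (∀ t ∈ I, ContDiff ℝ 2 (u t)) ∧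
  (∀ t ∈ I, ∀ (x : Vd d) (z : Fin d → ℤ), u t (x + intVec z) = u t x)

/-- `(u,m)` is a classical solution of the `δ`-discounted MFG system on `[0,∞) × 𝕋^d`:
`-∂ₜ u - Δ u + δ u + H(x,Du) = F(x,m)` and `-∂ₜ m + Δ m + div(m D_pH(x,Du)) = 0`. -/
def SolvesDiscMFG {d : ℕ} (S : MFGSetting d) (δ : ℝ) (u : ℝ → Vd d → ℝ) (m : ℝ → PTd d) : Prop :=
  Creg12 u (Set.Ici 0) ∧
  (∀ t ∈ Set.Ici (0:ℝ), ∀ x : Vd d,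
    - tderiv u t x - lapl (u t) x + δ * u t x + S.H x (gradv (u t) x)
      = S.Fd (m t : Measure (Td d)) x) ∧
  W1ContOn m (Set.Ici 0) ∧
  (∀ s₁ s₂ : ℝ, 0 ≤ s₁ → s₁ ≤ s₂ →
    FPeq 1 m (fun s y => DpH S (secT y) (gradv (u s) (secT y))) s₁ s₂)

/-- Admissible pairs for the stationary (ergodic) problem:
`σ Δ m + div(m α) = 0` in the sense of distributions and `α ∈ L²_m`. -/
def StatAdm {d : ℕ} (σ : ℝ) (m : PTd d) (α : Td d → Vd d) : Prop :=
  Measurable α ∧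
  (∫⁻ y, ENNReal.ofReal (sqnorm (α y)) ∂(m : Measure (Td d))) < ⊤ ∧
  ∀ g : Vd d → ℝ, ContDiff ℝ 2 g → (∀ (x : Vd d) (z : Fin d → ℤ), g (x + intVec z) = g x) →
    (∫ y, (σ * lapl g (secT y) - dotp (α y) (gradv g (secT y))) ∂(m : Measure (Td d))) = 0

/-- `ergInf S σ = -λ̄`, the value of the stationary minimization problem. -/
def ergInf {d : ℕ} (S : MFGSetting d) (σ : ℝ) : ℝ :=
  sInf { r | ∃ m α, StatAdm σ m α ∧
    r = (∫ y, S.Hstar (secT y) (α y) ∂(m : Measure (Td d))) + S.Fc m }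

/-- The set of values over which the dynamic programming principle for a corrector
`χ` takes its infimum. -/
def DPPval {d : ℕ} (S : MFGSetting d) (σ : ℝ) (χ : PTd d → ℝ) (lam t : ℝ) (m₀ : PTd d) :
    Set ℝ :=
  { r | ∃ m α, AdmOn S σ m₀ t m α ∧
      r = (∫ s in (0:ℝ)..t, runCost S m α s) + χ (m t) + lam * t }

/-- `χ` is a corrector function: it is continuous and satisfies the dynamic
programming principle with the critical value `λ`. -/
def IsCorrector {d : ℕ} (S : MFGSetting d) (σ : ℝ) (lam : ℝ) (χ : PTd d → ℝ) : Prop :=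
  W1Continuous χ ∧ ∀ (m₀ : PTd d) (t : ℝ), 0 < t → χ m₀ = sInf (DPPval S σ χ lam t m₀)

/-- `(m,α)` is a calibrated curve (defined on all of `ℝ`). -/
def IsCalibrated {d : ℕ} (S : MFGSetting d) (σ : ℝ) (lam : ℝ)
    (m : ℝ → PTd d) (α : ℝ → Td d → Vd d) : Prop :=
  W1ContOn m Set.univ ∧
  (∀ s₁ s₂ : ℝ, s₁ ≤ s₂ → FPeq σ m α s₁ s₂) ∧
  Measurable (fun q : ℝ × Td d => α q.1 q.2) ∧
  (∀ t₁ t₂ : ℝ, (∫⁻ s in Set.Ioc t₁ t₂,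
      ∫⁻ y, ENNReal.ofReal (sqnorm (α s y)) ∂(m s : Measure (Td d))) < ⊤) ∧
  (∀ t₁ t₂ : ℝ, IntervalIntegrable (runCost S m α) volume t₁ t₂) ∧
  ∃ χ : PTd d → ℝ, IsCorrector S σ lam χ ∧ ∀ t₁ t₂ : ℝ, t₁ < t₂ →
    χ (m t₁) = lam * (t₂ - t₁) + (∫ s in t₁..t₂, runCost S m α s) + χ (m t₂)

/-- The projected Mather set. -/
def MatherSet {d : ℕ} (S : MFGSetting d) (σ : ℝ) (lam : ℝ) : Set (PTd d) :=
  { μ | ∃ m α, IsCalibrated S σ lam m α ∧ m 0 = μ }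

/-- Invariant subsets of the projected Mather set. -/
def IsInvariantMFG {d : ℕ} (S : MFGSetting d) (σ : ℝ) (lam : ℝ) (C : Set (PTd d)) : Prop :=
  ∀ μ ∈ C, ∃ m α, IsCalibrated S σ lam m α ∧ m 0 = μ ∧ ∀ t : ℝ, m t ∈ C

/-- Minimal invariant subsets of the projected Mather set. -/
def IsMinimalInvariant {d : ℕ} (S : MFGSetting d) (σ : ℝ) (lam : ℝ) (N : Set (PTd d)) : Prop :=
  N.Nonempty ∧ N ⊆ MatherSet S σ lam ∧ IsClosedW1 N ∧ IsInvariantMFG S σ lam N ∧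
  ∀ C : Set (PTd d), C ⊆ N → C.Nonempty → IsClosedW1 C → IsInvariantMFG S σ lam C → C = N

/-- `δ 𝒱_δ → -λ` uniformly as `δ → 0⁺`. -/
def IsLimitValueV {d : ℕ} (S : MFGSetting d) (σ : ℝ) (lam : ℝ) : Prop :=
  ∀ ε > 0, ∃ δ₀ > 0, ∀ δ : ℝ, 0 < δ → δ ≤ δ₀ → ∀ μ : PTd d,
    |δ * Vfun S σ δ μ - (-lam)| < ε

/-- `𝒰(T,·)/T → -λ` uniformly as `T → ∞`. -/
def IsLimitValueU {d : ℕ} (S : MFGSetting d) (σ : ℝ) (lam : ℝ) : Prop :=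
  ∀ ε > 0, ∃ T₀ : ℝ, ∀ T : ℝ, T₀ ≤ T → ∀ μ : PTd d,
    |Ufun S σ T μ / T - (-lam)| < ε

/-- A function `Φ` on `P(𝕋^d)` is `C¹` with flat derivative `dΦ` (normalized so that
`∫ dΦ(m,·) dm = 0`, periodic in the space variable and jointly continuous). -/
def IsC1Flat {d : ℕ} (Φ : PTd d → ℝ) (dΦ : Measure (Td d) → Vd d → ℝ) : Prop :=
  (∀ (μ : Measure (Td d)) (x : Vd d) (z : Fin d → ℤ), dΦ μ (x + intVec z) = dΦ μ x) ∧
  (∀ μ ν : PTd d,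
    Φ ν - Φ μ = ∫ t in Set.Icc (0:ℝ) 1,
      ((∫ y, dΦ (lineComb t μ ν) (secT y) ∂(ν : Measure (Td d))) -
        ∫ y, dΦ (lineComb t μ ν) (secT y) ∂(μ : Measure (Td d)))) ∧
  (∀ μ : PTd d, (∫ y, dΦ (μ : Measure (Td d)) (secT y) ∂(μ : Measure (Td d))) = 0) ∧
  (∀ ε > 0, ∀ (μ : PTd d) (x : Vd d), ∃ η > 0, ∀ (ν : PTd d) (x' : Vd d),
    W1 μ ν < η → ‖x' - x‖ < η → |dΦ (ν : Measure (Td d)) x' - dΦ (μ : Measure (Td d)) x| < ε)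


open Topology ProbabilityTheory



section basics
variable {d : ℕ}

/-- projection to the torus -/
def piT (x : Vd d) : Td d := fun i => (x i : AddCircle (1:ℝ))

lemma piT_secT (y : Td d) : piT (secT y) = y := by
  funext i
  simp only [piT, secT]
  exact (AddCircle.equivIco 1 0).symm_apply_apply (y i)

lemma piT_openQuot : IsOpenQuotientMap (piT : Vd d → Td d) := by
  have : (piT : Vd d → Td d) = Pi.map (fun _ => (QuotientAddGroup.mk : ℝ → AddCircle (1:ℝ))) := rfl
  rw [this]
  exact IsOpenQuotientMap.piMap (fun _ => QuotientAddGroup.isOpenQuotientMap_mk)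

lemma secT_piT (x : Vd d) : ∃ z : Fin d → ℤ, secT (piT x) = x + intVec z := by
  have h : ∀ i, ∃ z : ℤ, secT (piT x) i = x i + z := by
    intro i
    have h1 : ((secT (piT x) i : ℝ) : AddCircle (1:ℝ)) = (x i : AddCircle (1:ℝ)) :=
      congrFun (piT_secT (piT x)) i
    have h2 : ((secT (piT x) i - x i : ℝ) : AddCircle (1:ℝ)) = 0 := by
      rw [AddCircle.coe_sub, h1, sub_self]
    rw [AddCircle.coe_eq_zero_iff] at h2
    obtain ⟨n, hn⟩ := h2
    refine ⟨n, ?_⟩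
    simp at hn
    linarith
  choose z hz using h
  exact ⟨z, funext hz⟩

lemma measurable_secT : Measurable (secT : Td d → Vd d) := by
  refine measurable_pi_lambda _ fun i => ?_
  have : Measurable (fun a : AddCircle (1:ℝ) => ((AddCircle.equivIco 1 0) a).1) :=
    measurable_subtype_coe.comp (AddCircle.measurableEquivIco 1 0).measurable
  exact this.comp (measurable_pi_apply i)

lemma lift_piT {g : Vd d → ℝ} (hg : ∀ x (z : Fin d → ℤ), g (x + intVec z) = g x) (x : Vd d) :
    g (secT (piT x)) = g x := by
  obtain ⟨z, hz⟩ := secT_piT x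
  rw [hz, hg]

lemma cont_lift {X : Type*} [TopologicalSpace X] {f : X → Vd d → ℝ}
    (hf : Continuous fun q : X × Vd d => f q.1 q.2)
    (hp : ∀ t x (z : Fin d → ℤ), f t (x + intVec z) = f t x) :
    Continuous fun q : X × Td d => f q.1 (secT q.2) := by
  have h1 : IsOpenQuotientMap (Prod.map (id : X → X) (piT : Vd d → Td d)) :=
    IsOpenQuotientMap.prodMap IsOpenQuotientMap.id piT_openQuot
  rw [h1.isQuotientMap.continuous_iff]
  convert hf using 2 with q
  exact lift_piT (hp q.1) q.2

lemma cont_lift' {f : Vd d → ℝ} (hf : Continuous f)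
    (hp : ∀ x (z : Fin d → ℤ), f (x + intVec z) = f x) :
    Continuous fun y : Td d => f (secT y) := by
  rw [piT_openQuot.isQuotientMap.continuous_iff]
  exact hf.congr fun q => (lift_piT hp q).symm

lemma td_integrable {μ : Measure (Td d)} [IsFiniteMeasure μ] {f : Td d → ℝ} (hf : Continuous f) :
    Integrable f μ := by
  obtain ⟨C, hC⟩ := isCompact_univ.exists_bound_of_continuousOn hf.continuousOn
  exact Integrable.of_bound hf.aestronglyMeasurable C (ae_of_all _ fun x => hC x (mem_univ _))

lemma weak_tendsto_cont {ι : Type*} {F : Filter ι} {μs : ι → PTd d} {μ : PTd d}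
    (h : Tendsto μs F (𝓝 μ)) {f : Td d → ℝ} (hf : Continuous f) :
    Tendsto (fun i => ∫ y, f y ∂(μs i : Measure (Td d))) F (𝓝 (∫ y, f y ∂(μ : Measure (Td d)))) := by
  rw [ProbabilityMeasure.tendsto_iff_forall_integral_tendsto] at h
  exact h (BoundedContinuousFunction.mkOfCompact ⟨f, hf⟩)

lemma lip_diff_le {φ : Td d → ℝ} (hφ : LipschitzWith 1 φ) (μ ν : PTd d) :
    (∫ y, φ y ∂(μ : Measure (Td d))) - ∫ y, φ y ∂(ν : Measure (Td d)) ≤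
      2 * Metric.diam (univ : Set (Td d)) := by
  have hb : ∀ y, |φ y - φ 0| ≤ Metric.diam (univ : Set (Td d)) := by
    intro y
    have := hφ.dist_le_mul y 0
    rw [Real.dist_eq] at this
    refine this.trans ?_
    simp only [NNReal.coe_one, one_mul]
    exact Metric.dist_le_diam_of_mem isCompact_univ.isBounded (mem_univ _) (mem_univ _)
  have key : ∀ μ : PTd d, |(∫ y, φ y ∂(μ : Measure (Td d))) - φ 0| ≤
      Metric.diam (univ : Set (Td d)) := by
    intro μ
    have : (∫ y, φ y ∂(μ : Measure (Td d))) - φ 0 = ∫ y, (φ y - φ 0) ∂(μ : Measure (Td d)) := by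
      rw [integral_sub (td_integrable hφ.continuous) (integrable_const _)]; simp
    rw [this]
    have := norm_integral_le_of_norm_le_const (μ := (μ : Measure (Td d)))
      (f := fun y => φ y - φ 0) (ae_of_all _ hb)
    simpa using this
  have h1 := abs_le.1 (key μ)
  have h2 := abs_le.1 (key ν)
  linarith [h1.2, h2.1]

lemma le_W1 {φ : Td d → ℝ} (hφ : LipschitzWith 1 φ) (μ ν : PTd d) :
    (∫ y, φ y ∂(μ : Measure (Td d))) - ∫ y, φ y ∂(ν : Measure (Td d)) ≤ W1 μ ν := by
  refine le_csSup ⟨2 * Metric.diam (univ : Set (Td d)), ?_⟩ ⟨φ, hφ, rfl⟩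
  rintro r ⟨φ, hφ, rfl⟩
  exact lip_diff_le hφ μ ν

lemma abs_le_W1 {φ : Td d → ℝ} (hφ : LipschitzWith 1 φ) (μ ν : PTd d) :
    |(∫ y, φ y ∂(μ : Measure (Td d))) - ∫ y, φ y ∂(ν : Measure (Td d))| ≤ W1 μ ν := by
  refine abs_le.2 ⟨?_, le_W1 hφ μ ν⟩
  have := le_W1 (φ := fun y => - φ y) hφ.neg μ ν
  rw [integral_neg, integral_neg] at this
  linarith

lemma abs_le_W1_mul {φ : Td d → ℝ} {L : ℝ} (hL : 0 < L) (hφ : ∀ x y, |φ x - φ y| ≤ L * dist x y)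
    (μ ν : PTd d) :
    |(∫ y, φ y ∂(μ : Measure (Td d))) - ∫ y, φ y ∂(ν : Measure (Td d))| ≤ L * W1 μ ν := by
  have h1 : LipschitzWith 1 (fun y => L⁻¹ * φ y) := by
    refine LipschitzWith.of_dist_le_mul fun x y => ?_
    rw [Real.dist_eq, ← mul_sub, abs_mul, abs_of_pos (inv_pos.2 hL)]
    simp only [NNReal.coe_one, one_mul]
    rw [inv_mul_le_iff₀ hL]
    exact hφ x y
  have := abs_le_W1 h1 μ ν
  rw [integral_const_mul, integral_const_mul, ← mul_sub, abs_mul, abs_of_pos (inv_pos.2 hL),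
    inv_mul_le_iff₀ hL] at this
  exact this

lemma W1_nonneg (μ ν : PTd d) : 0 ≤ W1 μ ν := by
  refine Real.sSup_nonneg' ⟨0, ⟨fun _ => 0, LipschitzWith.const' 0, by simp⟩, le_refl _⟩

lemma tendsto_of_W1 {ι : Type*} {F : Filter ι} [F.IsCountablyGenerated] {μs : ι → PTd d} {μ : PTd d}
    (h : Tendsto (fun i => W1 (μs i) μ) F (𝓝 0)) : Tendsto μs F (𝓝 μ) := by
  rw [tendsto_iff_forall_lipschitz_integral_tendsto]
  rintro f - ⟨L, hL⟩
  rw [tendsto_iff_norm_sub_tendsto_zero]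
  have h0 : (0:ℝ) < L + 1 := by positivity
  refine squeeze_zero (fun _ => norm_nonneg _) (fun i => abs_le_W1_mul h0 ?_ (μs i) μ)
    (by simpa using h.const_mul ((L:ℝ)+1))
  intro x y
  have := hL.dist_le_mul x y
  rw [Real.dist_eq] at this
  nlinarith [dist_nonneg (x := x) (y := y)]

lemma lipSet_net (ε : ℝ) (hε : 0 < ε) : ∃ t : Set (BoundedContinuousFunction (Td d) ℝ), t.Finite ∧
    ∀ φ : Td d → ℝ, LipschitzWith 1 φ → φ 0 = 0 → ∃ g ∈ t, ∀ y, |φ y - g y| < ε := by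
  set D := Metric.diam (univ : Set (Td d))
  let A : Set (BoundedContinuousFunction (Td d) ℝ) := {f | LipschitzWith 1 f ∧ f 0 = 0}
  have hA : IsCompact (closure A) := by
    refine BoundedContinuousFunction.arzela_ascoli (Metric.closedBall (0:ℝ) D)
      (isCompact_closedBall _ _) A ?_ ?_
    · rintro f x ⟨h1, h2⟩
      have := h1.dist_le_mul x 0
      rw [h2] at this
      simp only [NNReal.coe_one, one_mul] at this
      exact this.trans (Metric.dist_le_diam_of_mem isCompact_univ.isBounded (mem_univ _) (mem_univ _))
    · intro x
      exact (LipschitzWith.uniformEquicontinuous (fun f : A => ((f:BoundedContinuousFunction (Td d) ℝ) : Td d → ℝ)) 1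
        (fun f => f.2.1)).equicontinuous x
  obtain ⟨t, -, htf, ht⟩ := Metric.totallyBounded_iff.1 hA.totallyBounded ε hε |>.imp (fun t h => (⟨trivial, h⟩ : True ∧ _))
  refine ⟨t, htf, fun φ h1 h2 => ?_⟩
  let f : BoundedContinuousFunction (Td d) ℝ := BoundedContinuousFunction.mkOfCompact ⟨φ, h1.continuous⟩
  have hf : f ∈ A := ⟨h1, h2⟩
  have := ht (subset_closure hf)
  simp only [mem_iUnion] at this
  obtain ⟨g, hg, hfg⟩ := this
  refine ⟨g, hg, fun y => ?_⟩
  have := (BoundedContinuousFunction.dist_coe_le_dist (f := f) (g := g) y).trans_lt hfg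
  exact this

lemma W1_tendsto {ι : Type*} {F : Filter ι} {μs : ι → PTd d} {μ : PTd d}
    (h : Tendsto μs F (𝓝 μ)) : Tendsto (fun i => W1 (μs i) μ) F (𝓝 0) := by
  rw [Metric.tendsto_nhds]
  intro ε hε
  obtain ⟨t, htf, ht⟩ := lipSet_net (d := d) (ε/4) (by positivity)
  have : ∀ᶠ i in F, ∀ g ∈ t, |(∫ y, g y ∂(μs i : Measure (Td d))) -
      ∫ y, g y ∂(μ : Measure (Td d))| < ε/4 := by
    rw [eventually_all_finite htf]
    intro g _
    have := weak_tendsto_cont h g.continuous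
    exact (Metric.tendsto_nhds.1 this) (ε/4) (by positivity)
  filter_upwards [this] with i hi
  rw [Real.dist_eq, sub_zero, abs_of_nonneg (W1_nonneg _ _)]
  have : W1 (μs i) μ ≤ 3 * (ε/4) := by
    refine csSup_le ⟨0, fun _ => 0, LipschitzWith.const' 0, by simp⟩ ?_
    rintro r ⟨φ, hφ, rfl⟩
    obtain ⟨g, hg, hφg⟩ := ht (fun y => φ y - φ 0) (by
      have := hφ.sub (LipschitzWith.const' (K := 0) (φ 0))
      simpa using this) (by simp)
    have key : ∀ ν : PTd d, |(∫ y, φ y ∂(ν : Measure (Td d))) - φ 0 - ∫ y, g y ∂(ν : Measure (Td d))| ≤ ε/4 := by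
      intro ν
      have : (∫ y, φ y ∂(ν : Measure (Td d))) - φ 0 - ∫ y, g y ∂(ν : Measure (Td d))
        = ∫ y, (φ y - φ 0 - g y) ∂(ν : Measure (Td d)) := by
        rw [integral_sub (f := fun y => φ y - φ 0) ((td_integrable hφ.continuous).sub (integrable_const _))
          (td_integrable g.continuous),
          integral_sub (td_integrable hφ.continuous) (integrable_const _)]; simp
      rw [this]
      have := norm_integral_le_of_norm_le_const (μ := (ν : Measure (Td d)))
        (f := fun y => φ y - φ 0 - g y) (ae_of_all _ (fun y => (hφg y).le))
      simpa using this
    have h1 := abs_le.1 (key (μs i))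
    have h2 := abs_le.1 (key μ)
    have h3 := abs_lt.1 (hi g hg)
    linarith [h1.1, h1.2, h2.1, h2.2, h3.1, h3.2]
  linarith

lemma W1ContOn_iff {m : ℝ → PTd d} {I : Set ℝ} : W1ContOn m I ↔ ContinuousOn m I := by
  have key : ∀ t ∈ I, (ContinuousWithinAt m I t ↔ ∀ ε > 0, ∃ η > 0, ∀ s ∈ I, |s - t| < η → W1 (m s) (m t) < ε) := by
    intro t _
    have h1 : ContinuousWithinAt m I t ↔ Tendsto (fun s => W1 (m s) (m t)) (𝓝[I] t) (𝓝 0) :=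
      ⟨fun h => W1_tendsto h, fun h => tendsto_of_W1 h⟩
    rw [h1, Metric.tendsto_nhdsWithin_nhds]
    refine forall₂_congr fun ε _ => exists_congr fun η => and_congr_right fun _ => ?_
    refine forall₂_congr fun s _ => ?_
    rw [Real.dist_eq, Real.dist_eq, sub_zero, abs_of_nonneg (W1_nonneg _ _)]
  exact forall₂_congr fun t ht => (key t ht).symm

lemma measurable_coe_PTd {X : Type*} [TopologicalSpace X] [MeasurableSpace X] [OpensMeasurableSpace X]
    {m : X → PTd d} (hm : Continuous m) : Measurable (fun s => (m s : Measure (Td d))) := by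
  refine Measurable.measure_of_isPiSystem_of_isProbabilityMeasure (S := {s | IsOpen s})
    (BorelSpace.measurable_eq (α := Td d)) isPiSystem_isOpen ?_
  intro U hU
  have : LowerSemicontinuous (fun s => (m s : Measure (Td d)) U) := by
    intro s c hc
    have h1 := ProbabilityMeasure.le_liminf_measure_open_of_tendsto (hm.tendsto s) hU
    exact eventually_lt_of_lt_liminf (hc.trans_le h1)
  exact this.measurable

end basics


section setting
variable {d : ℕ}

lemma sqnorm_nonneg (a : Vd d) : 0 ≤ sqnorm a := Finset.sum_nonneg fun _ _ => sq_nonneg _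

lemma measurable_sqnorm : Measurable (sqnorm : Vd d → ℝ) := by
  unfold sqnorm; fun_prop

lemma continuous_dotp : Continuous (fun q : Vd d × Vd d => dotp q.1 q.2) := by
  unfold dotp; fun_prop

lemma sq_le_sqnorm (a : Vd d) (i : Fin d) : (a i)^2 ≤ sqnorm a :=
  Finset.single_le_sum (f := fun i => (a i)^2) (fun _ _ => sq_nonneg _) (Finset.mem_univ i)

lemma vec_decomp (v : Vd d) : v = ∑ i, v i • (Pi.single i (1:ℝ) : Vd d) := by
  funext j
  simp [Finset.sum_apply, Pi.single_apply]

lemma clm_apply_decomp (L : Vd d →L[ℝ] ℝ) (v : Vd d) : L v = ∑ i, v i * L (Pi.single i 1) := by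
  conv_lhs => rw [vec_decomp v]
  rw [map_sum]
  simp

lemma intVec_single (i : Fin d) : intVec (Pi.single i (1:ℤ)) = (Pi.single i (1:ℝ) : Vd d) := by
  funext j
  by_cases h : j = i
  · subst h; simp [intVec]
  · simp [intVec, h]

lemma per_bounded {f : Vd d → ℝ} (hf : Continuous f)
    (hp : ∀ x (z : Fin d → ℤ), f (x + intVec z) = f x) : ∃ B : ℝ, 0 ≤ B ∧ ∀ x, |f x| ≤ B := by
  obtain ⟨C, hC⟩ := isCompact_univ.exists_bound_of_continuousOn (cont_lift' hf hp).continuousOn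
  refine ⟨max C 0, le_max_right _ _, fun x => ?_⟩
  rw [← lift_piT hp x]
  exact (hC _ (mem_univ _)).trans (le_max_left _ _)

lemma per_grad_bound {g : Vd d → ℝ} (hg : ContDiff ℝ 2 g)
    (hp : ∀ x (z : Fin d → ℤ), g (x + intVec z) = g x) {C : ℝ}
    (hC : ∀ x v w : Vd d, |D2 g x v w| ≤ C * ‖v‖ * ‖w‖) (x : Vd d) (i : Fin d) :
    |fderiv ℝ g x (Pi.single i 1)| ≤ C := by
  set e : Vd d := Pi.single i 1 with he
  have hen : ‖e‖ = 1 := by rw [he, Pi.norm_single]; simp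
  have hline : ∀ t : ℝ, HasDerivAt (fun t : ℝ => x + t • e) e t := by
    intro t
    simpa using ((hasDerivAt_id t).smul_const e).const_add x
  have h1 : ∀ t : ℝ, HasDerivAt (fun t : ℝ => g (x + t • e)) (fderiv ℝ g (x + t • e) e) t := by
    intro t
    exact ((hg.differentiable (by norm_num)) (x + t • e)).hasFDerivAt.comp_hasDerivAt t (hline t)
  have hd : Differentiable ℝ (fun y => fderiv ℝ g y e) := by
    have : ContDiff ℝ 1 (fun y => fderiv ℝ g y) := hg.fderiv_right (by norm_num)
    exact (this.clm_apply contDiff_const).differentiable (by norm_num)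
  have h2 : ∀ t : ℝ, HasDerivAt (fun t : ℝ => fderiv ℝ g (x + t • e) e) (D2 g (x + t • e) e e) t := by
    intro t
    exact (hd (x + t • e)).hasFDerivAt.comp_hasDerivAt t (hline t)
  obtain ⟨c, hc, hc0⟩ := exists_hasDerivAt_eq_zero (f := fun t : ℝ => g (x + t • e))
    (f' := fun t => fderiv ℝ g (x + t • e) e) (zero_lt_one)
    (fun t _ => (h1 t).continuousAt.continuousWithinAt) (by
      have := hp x (Pi.single i 1)
      rw [intVec_single] at this
      simp [this, he]) (fun t _ => h1 t)
  have h3 := Convex.norm_image_sub_le_of_norm_hasDerivWithin_le (s := univ)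
    (f := fun t : ℝ => fderiv ℝ g (x + t • e) e) (x := c) (y := 0) (C := C)
    (fun t _ => (h2 t).hasDerivWithinAt) (fun t _ => by
      have := hC (x + t • e) e e
      rw [hen] at this
      simpa using this) convex_univ (mem_univ _) (mem_univ _)
  simp only [hc0, zero_smul, add_zero, sub_zero, zero_sub, norm_neg, Real.norm_eq_abs] at h3
  have hC0 : 0 ≤ C := by
    have := (abs_nonneg _).trans (hC x e e)
    rw [hen] at this; linarith
  rw [abs_of_pos hc.1] at h3
  nlinarith [hc.2]

lemma exists_lift_dist (y y' : Td d) : ∃ z : Fin d → ℤ,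
    ‖secT y - (secT y' + intVec z)‖ ≤ dist y y' := by
  refine ⟨fun i => round (secT y i - secT y' i), ?_⟩
  rw [pi_norm_le_iff_of_nonneg dist_nonneg]
  intro i
  have h1 : y i = (secT y i : AddCircle (1:ℝ)) := (congrFun (piT_secT y) i).symm
  have h2 : y' i = (secT y' i : AddCircle (1:ℝ)) := (congrFun (piT_secT y') i).symm
  refine le_trans ?_ (dist_le_pi_dist y y' i)
  rw [dist_eq_norm, h1, h2, ← AddCircle.coe_sub, AddCircle.norm_eq]
  simp [intVec, sub_sub]

lemma per_lip {g : Vd d → ℝ} (hg : ContDiff ℝ 2 g)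
    (hp : ∀ x (z : Fin d → ℤ), g (x + intVec z) = g x) {C : ℝ}
    (hC : ∀ x v w : Vd d, |D2 g x v w| ≤ C * ‖v‖ * ‖w‖) (y y' : Td d) :
    |g (secT y) - g (secT y')| ≤ (d * |C|) * dist y y' := by
  obtain ⟨z, hz⟩ := exists_lift_dist y y'
  rw [← hp (secT y') z]
  have hb : ∀ x, ‖fderiv ℝ g x‖ ≤ d * |C| := by
    intro x
    refine ContinuousLinearMap.opNorm_le_bound _ (by positivity) fun v => ?_
    rw [clm_apply_decomp]
    refine (norm_sum_le _ _).trans ?_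
    have : ∀ i ∈ Finset.univ, ‖v i * (fderiv ℝ g x) (Pi.single i 1)‖ ≤ |C| * ‖v‖ := by
      intro i _
      rw [norm_mul, mul_comm]
      exact mul_le_mul ((per_grad_bound hg hp hC x i).trans (le_abs_self C)) (norm_le_pi_norm v i) (norm_nonneg _)
        (abs_nonneg _)
    refine (Finset.sum_le_sum this).trans ?_
    simp [mul_assoc]
  have := Convex.norm_image_sub_le_of_norm_fderiv_le (𝕜 := ℝ) (s := univ) (f := g)
    (fun x _ => (hg.differentiable (by norm_num)) x) (fun x _ => hb x) convex_univ
    (mem_univ (secT y' + intVec z)) (mem_univ (secT y))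
  refine this.trans ?_
  gcongr

lemma Fc_lip (S : MFGSetting d) (μ ν : PTd d) :
    |S.Fc ν - S.Fc μ| ≤ (d * |S.CF| + 1) * W1 ν μ := by
  rw [S.flat_deriv μ ν]
  have h := norm_setIntegral_le_of_norm_le_const (μ := volume) (s := Set.Icc (0:ℝ) 1)
    (f := fun t => ((∫ y, S.Fd (lineComb t μ ν) (secT y) ∂(ν : Measure (Td d))) -
        ∫ y, S.Fd (lineComb t μ ν) (secT y) ∂(μ : Measure (Td d))))
    (C := (d * |S.CF| + 1) * W1 ν μ) (by simp) ?_
  · simpa using h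
  · intro t ht
    have hprob : IsProbabilityMeasure (lineComb t μ ν) := by
      constructor
      simp only [lineComb, Measure.coe_add, Measure.coe_smul, Pi.add_apply, Pi.smul_apply,
        measure_univ, smul_eq_mul, mul_one]
      rw [← ENNReal.ofReal_add (by linarith [ht.2]) ht.1]
      simp
    refine abs_le_W1_mul (by positivity) ?_ _ _
    intro y y'
    refine (per_lip (S.Fd_smooth _ hprob) (S.Fd_per _) (S.Fd_D2_bound _ hprob) y y').trans ?_
    gcongr
    linarith

lemma Fc_continuous (S : MFGSetting d) : Continuous S.Fc := by
  rw [continuous_iff_continuousAt]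
  intro μ
  rw [ContinuousAt, tendsto_iff_norm_sub_tendsto_zero]
  refine squeeze_zero (fun _ => norm_nonneg _) (fun ν => Fc_lip S μ ν) ?_
  have := (W1_tendsto (tendsto_id (x := 𝓝 μ))).const_mul (d * |S.CF| + 1)
  simpa using this

lemma H_cont (S : MFGSetting d) : Continuous (fun q : Vd d × Vd d => S.H q.1 q.2) :=
  S.H_smooth.continuous

lemma taylor_lower {g g' g'' : ℝ → ℝ} (h1 : ∀ t, HasDerivAt g (g' t) t)
    (h2 : ∀ t, HasDerivAt g' (g'' t) t) {a : ℝ} (ha : ∀ t, a ≤ g'' t) :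
    g 0 + g' 0 + a / 2 ≤ g 1 := by
  have hd1 : ∀ t, HasDerivAt (fun t => g' t - a * t) (g'' t - a) t := by
    intro t
    have := (h2 t).sub ((hasDerivAt_id t).const_mul a)
    rw [mul_one] at this
    exact this
  have m1 : Monotone (fun t => g' t - a * t) := monotone_of_hasDerivAt_nonneg hd1 (fun t => by
    simp; exact ha t)
  have hd2 : ∀ t, HasDerivAt (fun t => g t - g' 0 * t - a / 2 * t ^ 2) (g' t - g' 0 - a * t) t := by
    intro t
    have := ((h1 t).sub ((hasDerivAt_id t).const_mul (g' 0))).sub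
      (((hasDerivAt_id t).pow 2).const_mul (a/2))
    have e : g' t - g' 0 * 1 - a / 2 * ((2:ℕ) * id t ^ (2 - 1) * 1) = g' t - g' 0 - a * t := by
      simp; ring
    rw [e] at this
    exact this
  have m2 : MonotoneOn (fun t => g t - g' 0 * t - a / 2 * t ^ 2) (Ici 0) := by
    refine monotoneOn_of_deriv_nonneg (convex_Ici 0)
      (fun t _ => (hd2 t).continuousAt.continuousWithinAt)
      (fun t _ => (hd2 t).differentiableAt.differentiableWithinAt) ?_
    intro t ht
    rw [interior_Ici] at ht
    rw [(hd2 t).deriv]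
    have := m1 (le_of_lt ht)
    simp at this
    linarith
  have := m2 (mem_Ici.2 (le_refl (0:ℝ))) (mem_Ici.2 zero_le_one) zero_le_one
  simp at this
  linarith

lemma H_taylor (S : MFGSetting d) (x p : Vd d) :
    S.H x 0 + fderiv ℝ (fun p' => S.H x p') 0 p + S.Cbar⁻¹ * sqnorm p / 2 ≤ S.H x p ∧
    S.H x p ≤ S.H x 0 + fderiv ℝ (fun p' => S.H x p') 0 p + S.Cbar * sqnorm p / 2 := by
  have hs : ContDiff ℝ 2 (fun p' => S.H x p') :=
    S.H_smooth.comp (contDiff_const.prodMk contDiff_id)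
  have hline : ∀ t : ℝ, HasDerivAt (fun t : ℝ => t • p) p t := by
    intro t
    simpa using ((hasDerivAt_id t).smul_const p)
  have h1 : ∀ t : ℝ, HasDerivAt (fun t : ℝ => S.H x (t • p))
      (fderiv ℝ (fun p' => S.H x p') (t • p) p) t := by
    intro t
    exact ((hs.differentiable (by norm_num)) (t • p)).hasFDerivAt.comp_hasDerivAt t (hline t)
  have hd : Differentiable ℝ (fun y => fderiv ℝ (fun p' => S.H x p') y p) := by
    have : ContDiff ℝ 1 (fun y => fderiv ℝ (fun p' => S.H x p') y) := hs.fderiv_right (by norm_num)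
    exact (this.clm_apply contDiff_const).differentiable (by norm_num)
  have h2 : ∀ t : ℝ, HasDerivAt (fun t : ℝ => fderiv ℝ (fun p' => S.H x p') (t • p) p)
      (D2 (fun p' => S.H x p') (t • p) p p) t := by
    intro t
    exact (hd (t • p)).hasFDerivAt.comp_hasDerivAt t (hline t)
  constructor
  · simpa using taylor_lower h1 h2 (fun t => S.Dpp_lower x (t • p) p)
  · have := taylor_lower (fun t => (h1 t).neg) (fun t => (h2 t).neg)
      (fun t => neg_le_neg (S.Dpp_upper x (t • p) p))
    simp at this
    linarith

lemma H_zero_bound (S : MFGSetting d) : ∃ B : ℝ, 0 ≤ B ∧ ∀ x, |S.H x 0| ≤ B :=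
  per_bounded (f := fun x => S.H x 0) ((H_cont S).comp (by fun_prop : Continuous fun x : Vd d => (x, (0 : Vd d)))) (fun x z => S.H_per x z 0)

lemma H_grad_bound (S : MFGSetting d) : ∃ B : ℝ, 0 ≤ B ∧ ∀ x p,
    |fderiv ℝ (fun p' => S.H x p') 0 p| ≤ B * ∑ i, |p i| := by
  have key : ∀ i : Fin d, ∃ B : ℝ, 0 ≤ B ∧ ∀ x,
      |fderiv ℝ (fun p' => S.H x p') 0 (Pi.single i 1)| ≤ B := by
    intro i
    refine per_bounded ?_ ?_
    · have : ContDiff ℝ 1 (fun x => fderiv ℝ (fun p' => S.H x p') 0) :=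
        ContDiff.fderiv (n := 1) (m := 2) (f := fun x p' => S.H x p') (g := fun _ => 0) S.H_smooth contDiff_const (by norm_num)
      exact (this.clm_apply contDiff_const).continuous
    · intro x z
      simp only [S.H_per]
  choose B hB0 hB using key
  refine ⟨∑ i, B i, Finset.sum_nonneg fun i _ => hB0 i, fun x p => ?_⟩
  rw [clm_apply_decomp, Finset.mul_sum]
  refine (Finset.abs_sum_le_sum_abs _ _).trans (Finset.sum_le_sum fun i _ => ?_)
  rw [abs_mul, mul_comm]
  gcongr
  exact (hB i x).trans (Finset.single_le_sum (f := B) (fun i _ => hB0 i) (Finset.mem_univ i))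

lemma H_quad (S : MFGSetting d) : ∃ A b B : ℝ, 0 ≤ A ∧ 0 < b ∧ 0 < B ∧ ∀ x p,
    b * sqnorm p - A ≤ S.H x p ∧ S.H x p ≤ B * sqnorm p + A := by
  obtain ⟨B0, hB0, h0⟩ := H_zero_bound S
  obtain ⟨B1, hB1, h1⟩ := H_grad_bound S
  have hc := inv_pos.2 S.Cbar_pos
  set c := S.Cbar⁻¹ with hcdef
  have key : ∀ p : Vd d, B1 * ∑ i, |p i| ≤ c / 4 * sqnorm p + d * (B1^2 / c) := by
    intro p
    rw [Finset.mul_sum, sqnorm, Finset.mul_sum]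
    have : (d:ℝ) * (B1^2/c) = ∑ i : Fin d, B1^2/c := by simp
    rw [this, ← Finset.sum_add_distrib]
    refine Finset.sum_le_sum fun i _ => ?_
    have h3 : c / 4 * p i ^ 2 + B1^2/c - B1 * |p i| = (c / 2 * |p i| - B1)^2 / c := by
      rw [← sq_abs (p i)]
      field_simp
      ring
    have : 0 ≤ (c / 2 * |p i| - B1)^2 / c := by positivity
    linarith
  refine ⟨B0 + d * (B1^2/c), c/4, S.Cbar/2 + c/4, by positivity, by positivity,
    by have := S.Cbar_pos; positivity, fun x p => ?_⟩
  obtain ⟨t1, t2⟩ := H_taylor S x p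
  have a1 := abs_le.1 (h0 x)
  have a2 := abs_le.1 (h1 x p)
  have a3 := key p
  constructor
  · linarith [a1.1, a2.1]
  · linarith [a1.2, a2.2]

lemma dotp_le_sq (q p : Vd d) {b : ℝ} (hb : 0 < b) : dotp q p ≤ b * sqnorm p + (4*b)⁻¹ * sqnorm q := by
  rw [dotp, sqnorm, sqnorm, Finset.mul_sum, Finset.mul_sum, ← Finset.sum_add_distrib]
  refine Finset.sum_le_sum fun i _ => ?_
  have : b * p i ^ 2 + (4*b)⁻¹ * q i ^ 2 - q i * p i = (2 * b * p i - q i)^2 / (4*b) := by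
    field_simp
    ring
  have h2 : 0 ≤ (2 * b * p i - q i)^2 / (4*b) := by positivity
  linarith

lemma Hstar_quad (S : MFGSetting d) : ∃ A b B : ℝ, 0 ≤ A ∧ 0 < b ∧ 0 < B ∧ ∀ x q,
    b * sqnorm q - A ≤ S.Hstar x q ∧ S.Hstar x q ≤ B * sqnorm q + A := by
  obtain ⟨A, b, B, hA, hb, hB, h⟩ := H_quad S
  refine ⟨A, (4*B)⁻¹, (4*b)⁻¹, hA, by positivity, by positivity, fun x q => ⟨?_, ?_⟩⟩
  · have h1 := (S.Hstar_eq x q).1 ⟨(2*B)⁻¹ • q, rfl⟩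
    have h2 := (h x ((2*B)⁻¹ • q)).2
    have h3 : dotp q ((2*B)⁻¹ • q) = (2*B)⁻¹ * sqnorm q := by
      simp only [dotp, sqnorm, Finset.mul_sum, Pi.smul_apply, smul_eq_mul]
      exact Finset.sum_congr rfl fun i _ => by ring
    have h4 : sqnorm ((2*B)⁻¹ • q) = ((2*B)⁻¹)^2 * sqnorm q := by
      simp only [sqnorm, Finset.mul_sum, Pi.smul_apply, smul_eq_mul]
      exact Finset.sum_congr rfl fun i _ => by ring
    simp only at h1
    rw [h3] at h1
    rw [h4] at h2
    have h5 : (2*B)⁻¹ * sqnorm q - B * (((2*B)⁻¹)^2 * sqnorm q) = (4*B)⁻¹ * sqnorm q := by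
      field_simp
      ring
    linarith
  · refine (S.Hstar_eq x q).2 ?_
    rintro _ ⟨p, rfl⟩
    have h1 := (h x p).1
    have h2 := dotp_le_sq q p hb
    simp only
    linarith

lemma le_Hstar (S : MFGSetting d) (x q p : Vd d) : dotp q p - S.H x p ≤ S.Hstar x q :=
  (S.Hstar_eq x q).1 ⟨p, rfl⟩

/-- approximate maximizers in the Legendre transform -/
def selP (S : MFGSetting d) : ℕ → Vd d → Vd d → Vd d
  | 0, _, _ => 0
  | N+1, x, q => if dotp q (selP S N x q) - S.H x (selP S N x q) <
      dotp q (TopologicalSpace.denseSeq (Vd d) N) - S.H x (TopologicalSpace.denseSeq (Vd d) N) then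
      TopologicalSpace.denseSeq (Vd d) N else selP S N x q

lemma measurable_valP (S : MFGSetting d) {X : Type*} [MeasurableSpace X] {x q p : X → Vd d}
    (hx : Measurable x) (hq : Measurable q) (hp : Measurable p) :
    Measurable (fun z => dotp (q z) (p z) - S.H (x z) (p z)) :=
  ((continuous_dotp (d := d)).measurable.comp (hq.prodMk hp)).sub
    ((H_cont S).measurable.comp (hx.prodMk hp))

lemma selP_measurable (S : MFGSetting d) (N : ℕ) :
    Measurable (fun z : Vd d × Vd d => selP S N z.1 z.2) := by
  induction N with
  | zero => exact measurable_const
  | succ N ih =>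
    simp only [selP]
    refine Measurable.ite ?_ measurable_const ih
    exact measurableSet_lt (measurable_valP S measurable_fst measurable_snd ih)
      (measurable_valP S measurable_fst measurable_snd measurable_const)

lemma selP_bdd (S : MFGSetting d) (N : ℕ) : ∃ R, ∀ x q, ‖selP S N x q‖ ≤ R := by
  induction N with
  | zero => exact ⟨0, fun x q => by simp [selP]⟩
  | succ N ih =>
    obtain ⟨R, hR⟩ := ih
    refine ⟨max R ‖TopologicalSpace.denseSeq (Vd d) N‖, fun x q => ?_⟩
    simp only [selP]
    split_ifs
    · exact le_max_right _ _
    · exact (hR x q).trans (le_max_left _ _)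

lemma selP_mono (S : MFGSetting d) (x q : Vd d) :
    Monotone (fun N => dotp q (selP S N x q) - S.H x (selP S N x q)) := by
  refine monotone_nat_of_le_succ fun N => ?_
  simp only [selP]
  split_ifs with h
  · exact h.le
  · exact le_refl _

lemma selP_ge (S : MFGSetting d) (x q : Vd d) (N : ℕ) :
    dotp q (TopologicalSpace.denseSeq (Vd d) N) - S.H x (TopologicalSpace.denseSeq (Vd d) N) ≤
    dotp q (selP S (N+1) x q) - S.H x (selP S (N+1) x q) := by
  simp only [selP]
  split_ifs with h
  · exact le_refl _
  · exact not_lt.1 h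

lemma selP_lower (S : MFGSetting d) (x q : Vd d) (N : ℕ) :
    - S.H x 0 ≤ dotp q (selP S N x q) - S.H x (selP S N x q) := by
  have := selP_mono S x q (Nat.zero_le N)
  simpa [selP, dotp] using this

lemma selP_tendsto (S : MFGSetting d) (x q : Vd d) :
    Tendsto (fun N => dotp q (selP S N x q) - S.H x (selP S N x q)) atTop (𝓝 (S.Hstar x q)) := by
  refine tendsto_atTop_isLUB (selP_mono S x q) ⟨?_, ?_⟩
  · rintro _ ⟨N, rfl⟩
    exact le_Hstar S x q _
  · intro u hu
    refine (S.Hstar_eq x q).2 ?_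
    rintro _ ⟨p, rfl⟩
    have hc : Continuous (fun p : Vd d => dotp q p - S.H x p) :=
      ((continuous_dotp (d := d)).comp (by fun_prop : Continuous fun p : Vd d => (q, p))).sub
        ((H_cont S).comp (by fun_prop : Continuous fun p : Vd d => (x, p)))
    have hcl : IsClosed {p : Vd d | dotp q p - S.H x p ≤ u} := isClosed_le hc continuous_const
    have : closure (range (TopologicalSpace.denseSeq (Vd d))) ⊆ {p : Vd d | dotp q p - S.H x p ≤ u} := by
      refine closure_minimal ?_ hcl
      rintro _ ⟨N, rfl⟩
      exact (selP_ge S x q N).trans (hu ⟨N+1, rfl⟩)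
    exact this ((TopologicalSpace.denseRange_denseSeq (Vd d)) p)

lemma Hstar_measurable (S : MFGSetting d) : Measurable (fun z : Vd d × Vd d => S.Hstar z.1 z.2) :=
  measurable_of_tendsto_metrizable
    (fun N => measurable_valP S measurable_fst measurable_snd (selP_measurable S N))
    (tendsto_pi_nhds.2 fun z => selP_tendsto S z.1 z.2)

end setting


section testfun
variable {d : ℕ}

lemma gradv_contDiff {φ : ℝ → Vd d → ℝ} (h : IsTestFun φ) (v : Vd d) :
    ContDiff ℝ 1 (fun q : ℝ × Vd d => fderiv ℝ (φ q.1) q.2 v) := by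
  have h1 : ContDiff ℝ 1 (fun q : ℝ × Vd d => fderiv ℝ (φ q.1) q.2) :=
    ContDiff.fderiv (n := 1) (m := 2) (f := fun (q : ℝ × Vd d) y => φ q.1 y) (g := fun q => q.2)
      (h.1.comp (g := fun q : ℝ × Vd d => φ q.1 q.2) (f := fun q : (ℝ × Vd d) × Vd d => (q.1.1, q.2))
        (by fun_prop)) contDiff_snd (by norm_num)
  exact h1.clm_apply contDiff_const

lemma D2_cont {φ : ℝ → Vd d → ℝ} (h : IsTestFun φ) (v w : Vd d) :
    Continuous (fun q : ℝ × Vd d => D2 (φ q.1) q.2 v w) := by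
  have h1 : ContDiff ℝ 0 (fun q : ℝ × Vd d => fderiv ℝ (fun y => fderiv ℝ (φ q.1) y v) q.2) :=
    ContDiff.fderiv (n := 0) (m := 1) (f := fun (q : ℝ × Vd d) y => fderiv ℝ (φ q.1) y v)
      (g := fun q => q.2)
      ((gradv_contDiff h v).comp (g := fun q : ℝ × Vd d => fderiv ℝ (φ q.1) q.2 v)
        (f := fun q : (ℝ × Vd d) × Vd d => (q.1.1, q.2))
        (by fun_prop)) contDiff_snd (by norm_num)
  exact (h1.clm_apply contDiff_const).continuous

lemma tderiv_cont {φ : ℝ → Vd d → ℝ} (h : IsTestFun φ) :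
    Continuous (fun q : ℝ × Vd d => tderiv φ q.1 q.2) := by
  have h1 : ContDiff ℝ 1 (fun q : ℝ × Vd d => fderiv ℝ (fun s => φ s q.2) q.1) :=
    ContDiff.fderiv (n := 1) (m := 2) (f := fun (q : ℝ × Vd d) s => φ s q.2) (g := fun q => q.1)
      (h.1.comp (g := fun q : ℝ × Vd d => φ q.1 q.2) (f := fun q : (ℝ × Vd d) × ℝ => (q.2, q.1.2))
        (by fun_prop)) contDiff_fst (by norm_num)
  exact (h1.clm_apply (contDiff_const (c := (1:ℝ)))).continuous

lemma fderiv_per {g : Vd d → ℝ} (hp : ∀ x (z : Fin d → ℤ), g (x + intVec z) = g x)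
    (x : Vd d) (z : Fin d → ℤ) : fderiv ℝ g (x + intVec z) = fderiv ℝ g x := by
  rw [← fderiv_comp_add_right]
  simp only [hp]

lemma D2_per {g : Vd d → ℝ} (hp : ∀ x (z : Fin d → ℤ), g (x + intVec z) = g x)
    (x v w : Vd d) (z : Fin d → ℤ) : D2 g (x + intVec z) v w = D2 g x v w := by
  unfold D2
  rw [fderiv_per (g := fun y => fderiv ℝ g y v) (fun x z => by rw [fderiv_per hp])]

/-- the local part of the FP operator -/
def fpa (σ : ℝ) (φ : ℝ → Vd d → ℝ) (q : ℝ × Td d) : ℝ :=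
  tderiv φ q.1 (secT q.2) + σ * lapl (φ q.1) (secT q.2)

lemma fpa_cont {φ : ℝ → Vd d → ℝ} (h : IsTestFun φ) (σ : ℝ) : Continuous (fpa σ φ) := by
  refine cont_lift (f := fun s x => tderiv φ s x + σ * lapl (φ s) x) ?_ ?_
  · unfold lapl
    have := tderiv_cont h
    have h2 := fun i : Fin d => D2_cont h (Pi.single i 1) (Pi.single i 1)
    fun_prop
  · intro t x z
    simp only [tderiv, lapl, h.2, D2_per (h.2 t)]

lemma gradv_cont_lift {φ : ℝ → Vd d → ℝ} (h : IsTestFun φ) (i : Fin d) :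
    Continuous (fun q : ℝ × Td d => gradv (φ q.1) (secT q.2) i) := by
  refine cont_lift (f := fun s x => gradv (φ s) x i) ?_ ?_
  · exact (gradv_contDiff h (Pi.single i 1)).continuous
  · intro t x z
    simp only [gradv, fderiv_per (h.2 t)]

lemma test_cont_lift {φ : ℝ → Vd d → ℝ} (h : IsTestFun φ) :
    Continuous (fun q : ℝ × Td d => φ q.1 (secT q.2)) :=
  cont_lift h.1.continuous h.2

lemma test_shift {φ : ℝ → Vd d → ℝ} (h : IsTestFun φ) (τ : ℝ) : IsTestFun (fun s => φ (s + τ)) :=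
  ⟨h.1.comp (g := fun q : ℝ × Vd d => φ q.1 q.2) (f := fun q : ℝ × Vd d => (q.1 + τ, q.2))
    (by fun_prop), fun t x z => h.2 (t+τ) x z⟩

end testfun

section spacetime
variable {d : ℕ}

/-- kernel associated to a continuous curve -/
def kerM (m : ℝ → PTd d) (hm : Continuous m) : Kernel ℝ (Td d) :=
  ⟨fun s => (m s : Measure (Td d)), measurable_coe_PTd hm⟩

instance (m : ℝ → PTd d) (hm : Continuous m) : IsMarkovKernel (kerM m hm) :=
  ⟨fun s => by change IsProbabilityMeasure (m s : Measure (Td d)); infer_instance⟩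

/-- space time measure on `(0,T] × 𝕋^d` -/
def stMeas (m : ℝ → PTd d) (hm : Continuous m) (T : ℝ) : Measure (ℝ × Td d) :=
  (volume.restrict (Ioc 0 T)) ⊗ₘ (kerM m hm)

instance stMeas_fin (m : ℝ → PTd d) (hm : Continuous m) (T : ℝ) : IsFiniteMeasure (stMeas m hm T) := by
  unfold stMeas
  have : IsFiniteMeasure (volume.restrict (Ioc 0 T)) := ⟨by simp⟩
  infer_instance

variable {m : ℝ → PTd d} (hm : Continuous m) {T : ℝ}

lemma stMeas_lintegral {f : ℝ × Td d → ENNReal} (hf : Measurable f) :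
    ∫⁻ q, f q ∂(stMeas m hm T) = ∫⁻ s in Ioc 0 T, ∫⁻ y, f (s, y) ∂(m s : Measure (Td d)) :=
  Measure.lintegral_compProd hf

lemma stMeas_integral (hT : 0 ≤ T) {f : ℝ × Td d → ℝ} (hf : Integrable f (stMeas m hm T)) :
    ∫ q, f q ∂(stMeas m hm T) = ∫ s in (0:ℝ)..T, ∫ y, f (s, y) ∂(m s : Measure (Td d)) := by
  rw [intervalIntegral.integral_of_le hT]
  exact Measure.integral_compProd hf

lemma stMeas_intervalIntegrable (hT : 0 ≤ T) {f : ℝ × Td d → ℝ} (hf : Integrable f (stMeas m hm T)) :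
    IntervalIntegrable (fun s => ∫ y, f (s, y) ∂(m s : Measure (Td d))) volume 0 T := by
  rw [intervalIntegrable_iff_integrableOn_Ioc_of_le hT]
  unfold stMeas at hf
  rw [Measure.compProd] at hf
  have := hf.integral_compProd
  simp only [Kernel.prodMkLeft_apply, Kernel.const_apply] at this
  exact this

lemma stMeas_bdd_integrable {f : ℝ × Td d → ℝ} (hf : Measurable f) {C : ℝ}
    (hC : ∀ s ∈ Ioc 0 T, ∀ y, |f (s, y)| ≤ C) : Integrable f (stMeas m hm T) := by
  refine Integrable.of_bound hf.aestronglyMeasurable C ?_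
  have hmeas : MeasurableSet {q : ℝ × Td d | ‖f q‖ ≤ C} := measurableSet_le hf.norm measurable_const
  rw [ae_iff]
  have h2 : MeasurableSet {q : ℝ × Td d | ¬ ‖f q‖ ≤ C} := hmeas.compl
  rw [stMeas, Measure.compProd_apply h2]
  refine (lintegral_congr_ae ?_).trans (lintegral_zero)
  filter_upwards [ae_restrict_mem measurableSet_Ioc] with s hs
  convert measure_empty
  · ext y
    simp only [mem_preimage, mem_ofPred_eq, mem_empty_iff_false, iff_false, not_not]
    exact hC s hs y
  · infer_instance

lemma stMeas_ae {P : ℝ × Td d → Prop} (hP : MeasurableSet {q | P q})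
    (h : ∀ s ∈ Ioc 0 T, ∀ y, P (s, y)) : ∀ᵐ q ∂(stMeas m hm T), P q := by
  rw [ae_iff]
  have h2 : MeasurableSet {q : ℝ × Td d | ¬ P q} := hP.compl
  rw [stMeas, Measure.compProd_apply h2]
  refine (lintegral_congr_ae ?_).trans (lintegral_zero)
  filter_upwards [ae_restrict_mem measurableSet_Ioc] with s hs
  convert measure_empty
  · ext y
    simp only [mem_preimage, mem_ofPred_eq, mem_empty_iff_false, iff_false, not_not]
    exact h s hs y
  · infer_instance

lemma cont_bdd_on (hf : Continuous (f : ℝ × Td d → ℝ)) (T : ℝ) :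
    ∃ C, 0 ≤ C ∧ ∀ s ∈ Icc 0 T, ∀ y, |f (s, y)| ≤ C := by
  obtain ⟨C, hC⟩ := (isCompact_Icc (a := (0:ℝ)) (b := T)).prod (isCompact_univ (X := Td d))
    |>.exists_bound_of_continuousOn hf.continuousOn
  exact ⟨max C 0, le_max_right _ _, fun s hs y => (hC (s, y) ⟨hs, mem_univ _⟩).trans (le_max_left _ _)⟩

/-- finite energy -/
def L2on (m : ℝ → PTd d) (α : ℝ → Td d → Vd d) (T : ℝ) : Prop :=
  (∫⁻ s in Set.Ioc (0:ℝ) T, ∫⁻ y, ENNReal.ofReal (sqnorm (α s y)) ∂(m s : Measure (Td d))) < ⊤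

variable {α : ℝ → Td d → Vd d}

lemma sqnorm_integrable (hα : Measurable (fun q : ℝ × Td d => α q.1 q.2)) (h : L2on m α T) :
    Integrable (fun q : ℝ × Td d => sqnorm (α q.1 q.2)) (stMeas m hm T) := by
  have hmeas : Measurable (fun q : ℝ × Td d => sqnorm (α q.1 q.2)) := measurable_sqnorm.comp hα
  refine ⟨hmeas.aestronglyMeasurable, ?_⟩
  rw [hasFiniteIntegral_iff_ofReal (ae_of_all _ fun q => sqnorm_nonneg _),
    stMeas_lintegral hm (hmeas.ennreal_ofReal)]
  exact h

lemma comp_memLp (hα : Measurable (fun q : ℝ × Td d => α q.1 q.2)) (h : L2on m α T) (i : Fin d) :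
    MemLp (fun q : ℝ × Td d => α q.1 q.2 i) 2 (stMeas m hm T) := by
  have hmeas : Measurable (fun q : ℝ × Td d => α q.1 q.2 i) := (measurable_pi_apply i).comp hα
  rw [memLp_two_iff_integrable_sq hmeas.aestronglyMeasurable]
  refine (sqnorm_integrable hm hα h).mono' (hmeas.pow_const 2).aestronglyMeasurable
    (ae_of_all _ fun q => ?_)
  rw [Real.norm_eq_abs, abs_of_nonneg (sq_nonneg _)]
  exact sq_le_sqnorm _ i

lemma comp_integrable (hα : Measurable (fun q : ℝ × Td d => α q.1 q.2)) (h : L2on m α T) (i : Fin d) :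
    Integrable (fun q : ℝ × Td d => α q.1 q.2 i) (stMeas m hm T) :=
  (comp_memLp hm hα h i).integrable (by norm_num)

lemma comp_mul_integrable (hα : Measurable (fun q : ℝ × Td d => α q.1 q.2)) (h : L2on m α T)
    (i : Fin d) {f : ℝ × Td d → ℝ} (hf : Measurable f) {C : ℝ}
    (hC : ∀ s ∈ Ioc 0 T, ∀ y, |f (s, y)| ≤ C) :
    Integrable (fun q : ℝ × Td d => α q.1 q.2 i * f q) (stMeas m hm T) :=
  (comp_integrable hm hα h i).mul_bdd (c := C) hf.aestronglyMeasurable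
    (stMeas_ae hm (measurableSet_le hf.norm measurable_const) hC)

lemma Hstar_integrable (S : MFGSetting d) (hα : Measurable (fun q : ℝ × Td d => α q.1 q.2))
    (h : L2on m α T) :
    Integrable (fun q : ℝ × Td d => S.Hstar (secT q.2) (α q.1 q.2)) (stMeas m hm T) := by
  obtain ⟨A, b, B, hA, hb, hB, hq⟩ := Hstar_quad S
  have hmeas : Measurable (fun q : ℝ × Td d => S.Hstar (secT q.2) (α q.1 q.2)) :=
    (Hstar_measurable S).comp ((measurable_secT.comp measurable_snd).prodMk hα)
  refine (((sqnorm_integrable hm hα h).const_mul (B)).add (integrable_const A)).mono'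
    hmeas.aestronglyMeasurable (ae_of_all _ fun q => ?_)
  obtain ⟨h1, h2⟩ := hq (secT q.2) (α q.1 q.2)
  have h3 := sqnorm_nonneg (α q.1 q.2)
  simp only [Pi.add_apply]
  rw [Real.norm_eq_abs, abs_le]
  constructor
  · nlinarith [mul_nonneg hb.le h3, mul_nonneg hB.le h3]
  · exact h2

lemma Fc_cont_comp (S : MFGSetting d) (hm : Continuous m) : Continuous fun s => S.Fc (m s) :=
  (Fc_continuous S).comp hm

lemma weight_Hstar_integrable (S : MFGSetting d) (hα : Measurable (fun q : ℝ × Td d => α q.1 q.2))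
    (h : L2on m α T) (δ : ℝ) :
    Integrable (fun q : ℝ × Td d => Real.exp (-δ * q.1) * S.Hstar (secT q.2) (α q.1 q.2))
      (stMeas m hm T) := by
  have hc : Continuous (fun q : ℝ × Td d => Real.exp (-δ * q.1)) := by fun_prop
  obtain ⟨C, _, hC⟩ := cont_bdd_on hc T
  exact (Hstar_integrable hm S hα h).bdd_mul (c := C) hc.measurable.aestronglyMeasurable
    (stMeas_ae hm (measurableSet_le hc.measurable.norm measurable_const)
      (fun s hs y => hC s (Ioc_subset_Icc_self hs) y))

lemma runCost_weight_eq (S : MFGSetting d) (δ s : ℝ) : Real.exp (-δ * s) * runCost S m α s =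
    (∫ y, Real.exp (-δ * s) * S.Hstar (secT y) (α s y) ∂(m s : Measure (Td d)))
      + Real.exp (-δ * s) * S.Fc (m s) := by
  rw [runCost, mul_add, integral_const_mul]

lemma runCost_weight_intervalIntegrable (hm : Continuous m) (S : MFGSetting d) (hT : 0 ≤ T)
    (hα : Measurable (fun q : ℝ × Td d => α q.1 q.2)) (h : L2on m α T) (δ : ℝ) :
    IntervalIntegrable (fun s => Real.exp (-δ * s) * runCost S m α s) volume 0 T := by
  simp_rw [runCost_weight_eq]
  refine (stMeas_intervalIntegrable hm hT (weight_Hstar_integrable hm S hα h δ)).add ?_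
  have := Fc_cont_comp S hm
  exact (by fun_prop : Continuous fun s => Real.exp (-δ * s) * S.Fc (m s)).intervalIntegrable _ _

/-- discounted cost on a finite horizon -/
def Jd (S : MFGSetting d) (δ : ℝ) (m : ℝ → PTd d) (α : ℝ → Td d → Vd d) (T : ℝ) : ℝ :=
  ∫ s in (0:ℝ)..T, Real.exp (-δ * s) * runCost S m α s

lemma Jd_eq (S : MFGSetting d) (hT : 0 ≤ T)
    (hα : Measurable (fun q : ℝ × Td d => α q.1 q.2)) (h : L2on m α T) (δ : ℝ) :
    Jd S δ m α T = (∫ q, Real.exp (-δ * q.1) * S.Hstar (secT q.2) (α q.1 q.2) ∂(stMeas m hm T)) +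
      ∫ s in (0:ℝ)..T, Real.exp (-δ * s) * S.Fc (m s) := by
  unfold Jd
  simp_rw [runCost_weight_eq]
  have := Fc_cont_comp S hm
  rw [intervalIntegral.integral_add (stMeas_intervalIntegrable hm hT (weight_Hstar_integrable hm S hα h δ))
    ((by fun_prop : Continuous fun s => Real.exp (-δ * s) * S.Fc (m s)).intervalIntegrable _ _),
    stMeas_integral hm hT (weight_Hstar_integrable hm S hα h δ)]

/-- full FP integrand -/
def fpI (σ : ℝ) (α : ℝ → Td d → Vd d) (φ : ℝ → Vd d → ℝ) (q : ℝ × Td d) : ℝ :=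
  tderiv φ q.1 (secT q.2) + σ * lapl (φ q.1) (secT q.2)
    - dotp (α q.1 q.2) (gradv (φ q.1) (secT q.2))

lemma fpI_eq (σ : ℝ) (α : ℝ → Td d → Vd d) (φ : ℝ → Vd d → ℝ) (q : ℝ × Td d) :
    fpI σ α φ q = fpa σ φ q - ∑ i, α q.1 q.2 i * gradv (φ q.1) (secT q.2) i := rfl

lemma fpI_integrable {φ : ℝ → Vd d → ℝ} (hφ : IsTestFun φ) (σ : ℝ)
    (hα : Measurable (fun q : ℝ × Td d => α q.1 q.2)) (h : L2on m α T) :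
    Integrable (fpI σ α φ) (stMeas m hm T) := by
  have h1 : Integrable (fpa σ φ) (stMeas m hm T) := by
    obtain ⟨C, _, hC⟩ := cont_bdd_on (fpa_cont hφ σ) T
    exact stMeas_bdd_integrable hm (fpa_cont hφ σ).measurable (C := C)
      (fun s hs y => hC s (Ioc_subset_Icc_self hs) y)
  refine h1.sub (integrable_finsetSum _ fun i _ => ?_)
  obtain ⟨C, _, hC⟩ := cont_bdd_on (gradv_cont_lift hφ i) T
  exact comp_mul_integrable hm hα h i (gradv_cont_lift hφ i).measurable (C := C)
      (fun s hs y => hC s (Ioc_subset_Icc_self hs) y)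

lemma fpI_intervalIntegrable (hm : Continuous m) (hT : 0 ≤ T) {φ : ℝ → Vd d → ℝ} (hφ : IsTestFun φ) (σ : ℝ)
    (hα : Measurable (fun q : ℝ × Td d => α q.1 q.2)) (h : L2on m α T) :
    IntervalIntegrable (fun s => ∫ y, fpI σ α φ (s, y) ∂(m s : Measure (Td d))) volume 0 T :=
  stMeas_intervalIntegrable hm hT (fpI_integrable hm hφ σ hα h)

end spacetime


section compactness
variable {d : ℕ}

lemma piT_cont : Continuous (piT : Vd d → Td d) := piT_openQuot.continuous

lemma piT_per (x : Vd d) (z : Fin d → ℤ) : piT (x + intVec z) = piT x := by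
  funext i
  simp only [piT, intVec, Pi.add_apply, AddCircle.coe_add]
  have : ((z i : ℝ) : AddCircle (1:ℝ)) = 0 := by
    rw [AddCircle.coe_eq_zero_iff]
    exact ⟨z i, by simp⟩
  rw [this, add_zero]

/-- smooth functions on the torus -/
def smoothAlg (d : ℕ) : Subalgebra ℝ C(Td d, ℝ) where
  carrier := {f | ContDiff ℝ 2 (fun x : Vd d => f (piT x))}
  mul_mem' := fun {a b} ha hb => by
    have ha' : ContDiff ℝ 2 (fun x : Vd d => a (piT x)) := ha
    have hb' : ContDiff ℝ 2 (fun x : Vd d => b (piT x)) := hb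
    exact ha'.mul hb'
  add_mem' := fun {a b} ha hb => by
    have ha' : ContDiff ℝ 2 (fun x : Vd d => a (piT x)) := ha
    have hb' : ContDiff ℝ 2 (fun x : Vd d => b (piT x)) := hb
    exact ha'.add hb'
  algebraMap_mem' := fun r => by
    change ContDiff ℝ 2 (fun x : Vd d => r)
    exact contDiff_const

/-- lift of periodic functions to continuous maps on the torus -/
lemma smooth_of_per {g : Vd d → ℝ} (hg : ContDiff ℝ 2 g)
    (hp : ∀ x (z : Fin d → ℤ), g (x + intVec z) = g x) :
    (⟨fun y => g (secT y), cont_lift' hg.continuous hp⟩ : C(Td d, ℝ)) ∈ smoothAlg d := by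
  change ContDiff ℝ 2 (fun x : Vd d => g (secT (piT x)))
  simp only [lift_piT hp]
  exact hg

lemma smoothAlg_sep : (smoothAlg d).SeparatesPoints := by
  intro y y' hne
  obtain ⟨i, hi⟩ : ∃ i, y i ≠ y' i := by
    by_contra h
    push Not at h
    exact hne (funext h)
  by_contra hcon
  have hall : ∀ f ∈ smoothAlg d, f y = f y' := by
    intro f hf
    by_contra h
    exact hcon ⟨f, ⟨f, hf, rfl⟩, h⟩
  have hcos := hall _ (smooth_of_per (g := fun x : Vd d => Real.cos (2 * π * x i)) (by fun_prop) (by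
    intro x z
    simp only [intVec, Pi.add_apply]
    rw [mul_add, mul_comm (2*π) (z i : ℝ), Real.cos_add_int_mul_two_pi]))
  have hsin := hall _ (smooth_of_per (g := fun x : Vd d => Real.sin (2 * π * x i)) (by fun_prop) (by
    intro x z
    simp only [intVec, Pi.add_apply]
    rw [mul_add, mul_comm (2*π) (z i : ℝ), Real.sin_add_int_mul_two_pi]))
  simp only [ContinuousMap.coe_mk] at hcos hsin
  have hang : ((2 * π * secT y i : ℝ) : Real.Angle) = ((2 * π * secT y' i : ℝ) : Real.Angle) :=
    Real.Angle.cos_sin_inj hcos hsin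
  rw [Real.Angle.angle_eq_iff_two_pi_dvd_sub] at hang
  obtain ⟨k, hk⟩ := hang
  have hk' : secT y i - secT y' i = k := by
    have hpi := Real.pi_pos
    have : 2 * π * (secT y i - secT y' i - k) = 0 := by linarith
    rcases mul_eq_zero.1 this with h | h
    · linarith
    · linarith
  apply hi
  rw [← congrFun (piT_secT y) i, ← congrFun (piT_secT y') i]
  simp only [piT]
  rw [← sub_eq_zero, ← AddCircle.coe_sub, AddCircle.coe_eq_zero_iff]
  exact ⟨k, by simp [hk']⟩

lemma smooth_approx (f : C(Td d, ℝ)) {ε : ℝ} (hε : 0 < ε) :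
    ∃ g ∈ smoothAlg d, ∀ y, |g y - f y| < ε := by
  obtain ⟨g, hg⟩ := ContinuousMap.exists_mem_subalgebra_near_continuousMap_of_separatesPoints
    (smoothAlg d) smoothAlg_sep f ε hε
  refine ⟨g, g.2, fun y => ?_⟩
  exact ((ContinuousMap.norm_coe_le_norm ((g : C(Td d, ℝ)) - f) y)).trans_lt hg

lemma integral_close {f g : Td d → ℝ} (hf : Continuous f) (hg : Continuous g) {ε : ℝ}
    (h : ∀ y, |g y - f y| < ε) (ν : PTd d) :
    |(∫ y, g y ∂(ν : Measure (Td d))) - ∫ y, f y ∂(ν : Measure (Td d))| ≤ ε := by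
  rw [← integral_sub (td_integrable hg) (td_integrable hf)]
  have := norm_integral_le_of_norm_le_const (μ := (ν : Measure (Td d)))
        (f := fun y => g y - f y) (ae_of_all _ (fun y => (h y).le))
  simpa using this

lemma tendsto_of_smooth {ι : Type*} {F : Filter ι} {μs : ι → PTd d} {μ : PTd d}
    (h : ∀ f ∈ smoothAlg d, Tendsto (fun i => ∫ y, f y ∂(μs i : Measure (Td d))) F
      (𝓝 (∫ y, f y ∂(μ : Measure (Td d))))) : Tendsto μs F (𝓝 μ) := by
  rw [ProbabilityMeasure.tendsto_iff_forall_integral_tendsto]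
  intro f
  rw [Metric.tendsto_nhds]
  intro ε hε
  obtain ⟨g, hg, hgf⟩ := smooth_approx (f : C(Td d, ℝ)) (ε := ε/4) (by positivity)
  have := (Metric.tendsto_nhds.1 (h g hg)) (ε/4) (by positivity)
  filter_upwards [this] with i hi
  rw [Real.dist_eq] at hi ⊢
  have h1 := abs_le.1 (integral_close f.continuous g.continuous hgf (μs i))
  have h2 := abs_le.1 (integral_close f.continuous g.continuous hgf μ)
  have h3 := abs_lt.1 hi
  rw [abs_lt]
  constructor <;> linarith [h1.1, h1.2, h2.1, h2.2, h3.1, h3.2]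

lemma diag_subseq {X : Type*} [TopologicalSpace X] [CompactSpace X] [FirstCountableTopology X]
    (m : ℕ → ℚ → X) : ∃ (x : ℚ → X) (ns : ℕ → ℕ), StrictMono ns ∧
      ∀ q, Tendsto (fun k => m (ns k) q) atTop (𝓝 (x q)) := by
  obtain ⟨x, ns, hns, hx⟩ := CompactSpace.tendsto_subseq m
  exact ⟨x, ns, hns, fun q => (tendsto_pi_nhds.1 hx) q⟩

theorem curves_subseq (m : ℕ → ℝ → PTd d)
    (heq : ∀ f ∈ smoothAlg d, ∀ ε > 0, ∃ η > 0, ∀ n s r, |s - r| ≤ η →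
      |(∫ y, f y ∂(m n s : Measure (Td d))) - ∫ y, f y ∂(m n r : Measure (Td d))| ≤ ε) :
    ∃ (ns : ℕ → ℕ) (μ : ℝ → PTd d), StrictMono ns ∧ Continuous μ ∧
      ∀ s, Tendsto (fun k => m (ns k) s) atTop (𝓝 (μ s)) := by
  obtain ⟨x, ns, hns, hq⟩ := diag_subseq (fun n (q : ℚ) => m n (q : ℝ))
  have key : ∀ s : ℝ, ∃ μ : PTd d, Tendsto (fun k => m (ns k) s) atTop (𝓝 μ) := by
    intro s
    obtain ⟨μ, ψ, hψ, hμ⟩ := CompactSpace.tendsto_subseq (fun k => m (ns k) s)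
    refine ⟨μ, tendsto_of_smooth fun f hf => ?_⟩
    refine tendsto_nhds_of_cauchySeq_of_subseq ?_ hψ.tendsto_atTop
      (weak_tendsto_cont hμ f.continuous)
    rw [Metric.cauchySeq_iff]
    intro ε hε
    obtain ⟨η, hη, hh⟩ := heq f hf (ε/4) (by positivity)
    obtain ⟨q, hq1, hq2⟩ := exists_rat_btwn (show s < s + η by linarith)
    have hc := (weak_tendsto_cont (hq q) f.continuous).cauchySeq
    rw [Metric.cauchySeq_iff] at hc
    obtain ⟨N, hN⟩ := hc (ε/4) (by positivity)
    refine ⟨N, fun a ha b hb => ?_⟩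
    have hsq : |s - q| ≤ η := by rw [abs_le]; constructor <;> linarith
    have h1 := abs_le.1 (hh (ns a) s q hsq)
    have h2 := abs_le.1 (hh (ns b) s q hsq)
    have h3 := hN a ha b hb
    rw [Real.dist_eq] at h3 ⊢
    have h3 := abs_lt.1 h3
    rw [abs_lt]
    constructor <;> linarith [h1.1, h1.2, h2.1, h2.2, h3.1, h3.2]
  choose μ hμ using key
  refine ⟨ns, μ, hns, ?_, hμ⟩
  rw [continuous_iff_continuousAt]
  intro s
  refine tendsto_of_smooth fun f hf => ?_
  rw [Metric.tendsto_nhds]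
  intro ε hε
  obtain ⟨η, hη, hh⟩ := heq f hf (ε/2) (by positivity)
  filter_upwards [Metric.closedBall_mem_nhds s hη] with r hr
  rw [Metric.mem_closedBall, Real.dist_eq] at hr
  have ht := ((weak_tendsto_cont (hμ r) f.continuous).sub (weak_tendsto_cont (hμ s) f.continuous)).abs
  have := le_of_tendsto ht (Eventually.of_forall fun k => hh (ns k) r s hr)
  rw [Real.dist_eq]
  linarith

end compactness

section energy
variable {d : ℕ} {m : ℝ → PTd d} (hm : Continuous m) {T : ℝ} {α : ℝ → Td d → Vd d}

/-- indicator weight -/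
def indw (s₁ s₂ : ℝ) (q : ℝ × Td d) : ℝ := (Ioc s₁ s₂).indicator 1 q.1

lemma indw_meas (s₁ s₂ : ℝ) : Measurable (indw (d := d) s₁ s₂) :=
  (measurable_one.indicator measurableSet_Ioc).comp measurable_fst

lemma indw_nonneg (s₁ s₂ : ℝ) (q : ℝ × Td d) : 0 ≤ indw s₁ s₂ q :=
  indicator_nonneg (fun _ _ => zero_le_one) _

lemma indw_le (s₁ s₂ : ℝ) (q : ℝ × Td d) : indw s₁ s₂ q ≤ 1 :=
  indicator_le_self' (fun _ _ => zero_le_one) _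

lemma indw_abs (s₁ s₂ : ℝ) (q : ℝ × Td d) : |indw s₁ s₂ q| ≤ 1 := by
  rw [abs_of_nonneg (indw_nonneg _ _ _)]; exact indw_le _ _ _

lemma indw_mul_integrable {μ : Measure (ℝ × Td d)} {f : ℝ × Td d → ℝ} (hf : Integrable f μ) (s₁ s₂ : ℝ) :
    Integrable (fun q => indw s₁ s₂ q * f q) μ :=
  hf.bdd_mul (c := 1) (indw_meas s₁ s₂).aestronglyMeasurable (ae_of_all _ (indw_abs s₁ s₂))

lemma stMeas_integral_sub {f : ℝ × Td d → ℝ} (hf : Integrable f (stMeas m hm T)) {s₁ s₂ : ℝ}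
    (h1 : 0 ≤ s₁) (h12 : s₁ ≤ s₂) (h2 : s₂ ≤ T) :
    ∫ s in s₁..s₂, ∫ y, f (s, y) ∂(m s : Measure (Td d)) =
      ∫ q, indw s₁ s₂ q * f q ∂(stMeas m hm T) := by
  rw [stMeas_integral hm (by linarith) (indw_mul_integrable hf s₁ s₂),
    intervalIntegral.integral_of_le h12, intervalIntegral.integral_of_le (by linarith)]
  have : ∀ s, ∫ y, indw s₁ s₂ (s, y) * f (s, y) ∂(m s : Measure (Td d)) =
      (Ioc s₁ s₂).indicator (fun s => ∫ y, f (s, y) ∂(m s : Measure (Td d))) s := by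
    intro s
    by_cases hs : s ∈ Ioc s₁ s₂
    · simp [indw, hs]
    · simp [indw, hs]
  simp_rw [this]
  rw [setIntegral_indicator measurableSet_Ioc, inter_eq_self_of_subset_right]
  exact Ioc_subset_Ioc h1 h2

lemma FP_equi {f : C(Td d, ℝ)} (hf : f ∈ smoothAlg d) (T K σ : ℝ) {ε : ℝ} (hε : 0 < ε) : ∃ η > 0,
    ∀ (m : ℝ → PTd d) (hm : Continuous m) (α : ℝ → Td d → Vd d),
      Measurable (fun q : ℝ × Td d => α q.1 q.2) → L2on m α T →
      (∫ q, sqnorm (α q.1 q.2) ∂(stMeas m hm T)) ≤ K →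
      (∀ s₁ s₂ : ℝ, 0 ≤ s₁ → s₁ ≤ s₂ → s₂ ≤ T → FPeq σ m α s₁ s₂) →
      ∀ s₁ s₂ : ℝ, 0 ≤ s₁ → s₁ ≤ s₂ → s₂ ≤ T → s₂ - s₁ ≤ η →
      |(∫ y, f y ∂(m s₂ : Measure (Td d))) - ∫ y, f y ∂(m s₁ : Measure (Td d))| ≤ ε := by
  let φ : ℝ → Vd d → ℝ := fun _ x => f (piT x)
  have hφ : IsTestFun φ := by
    refine ⟨?_, fun t x z => by simp only [φ, piT_per]⟩
    have hf' : ContDiff ℝ 2 (fun x : Vd d => f (piT x)) := hf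
    exact hf'.comp contDiff_snd
  obtain ⟨Ca, hCa0, hCa⟩ := cont_bdd_on (fpa_cont hφ σ) T
  have hb := fun i : Fin d => cont_bdd_on (gradv_cont_lift hφ i) T
  choose Cb hCb0 hCb using hb
  set lam : ℝ := ε / (2 * (|K| + 1)) with hlam
  have hlam0 : 0 < lam := by positivity
  set C : ℝ := Ca + ∑ i, (4*lam)⁻¹ * (Cb i)^2 with hC
  have hC0 : 0 ≤ C := by
    have : 0 ≤ ∑ i, (4*lam)⁻¹ * (Cb i)^2 := Finset.sum_nonneg fun i _ => by positivity
    linarith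
  refine ⟨ε / (2 * (C + 1)), by positivity, ?_⟩
  intro m hm α hα hL hK hFP s₁ s₂ h1 h12 h2 hη
  have e := hFP s₁ s₂ h1 h12 h2 φ hφ
  simp only [φ, piT_secT] at e
  have hint := fpI_integrable hm hφ σ hα hL
  rw [e]
  change |∫ s in s₁..s₂, ∫ y, fpI σ α φ (s, y) ∂(m s : Measure (Td d))| ≤ ε
  rw [stMeas_integral_sub hm hint h1 h12 h2]
  have hT : 0 ≤ T := by linarith
  have hbound : ∀ᵐ q ∂(stMeas m hm T), ‖indw s₁ s₂ q * fpI σ α φ q‖ ≤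
      C * indw s₁ s₂ q + lam * sqnorm (α q.1 q.2) := by
    have hae : ∀ᵐ q ∂(stMeas m hm T), |fpa σ φ q| ≤ Ca ∧ ∀ i, |gradv (φ q.1) (secT q.2) i| ≤ Cb i := by
      refine stMeas_ae hm ?_ ?_
      · refine MeasurableSet.inter (measurableSet_le (fpa_cont hφ σ).measurable.norm measurable_const) ?_
        have : {q : ℝ × Td d | ∀ i, |gradv (φ q.1) (secT q.2) i| ≤ Cb i} =
          ⋂ i, {q : ℝ × Td d | |gradv (φ q.1) (secT q.2) i| ≤ Cb i} := by ext; simp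
        change MeasurableSet {q : ℝ × Td d | ∀ i, |gradv (φ q.1) (secT q.2) i| ≤ Cb i}
        rw [this]
        exact MeasurableSet.iInter fun i => measurableSet_le (gradv_cont_lift hφ i).measurable.norm measurable_const
      · intro s hs y
        exact ⟨hCa s (Ioc_subset_Icc_self hs) y, fun i => hCb i s (Ioc_subset_Icc_self hs) y⟩
    filter_upwards [hae] with q hq
    rw [norm_mul, Real.norm_eq_abs, Real.norm_eq_abs, abs_of_nonneg (indw_nonneg _ _ _)]
    have hfp : |fpI σ α φ q| ≤ C + lam * sqnorm (α q.1 q.2) := by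
      rw [fpI_eq]
      refine (abs_sub _ _).trans ?_
      have : |∑ i, α q.1 q.2 i * gradv (φ q.1) (secT q.2) i| ≤
          ∑ i, ((4*lam)⁻¹ * (Cb i)^2 + lam * (α q.1 q.2 i)^2) := by
        refine (Finset.abs_sum_le_sum_abs _ _).trans (Finset.sum_le_sum fun i _ => ?_)
        rw [abs_mul]
        have h5 : |α q.1 q.2 i| * |gradv (φ q.1) (secT q.2) i| ≤ |α q.1 q.2 i| * Cb i := by
          gcongr; exact hq.2 i
        have h6 : (4*lam)⁻¹ * (Cb i)^2 + lam * (α q.1 q.2 i)^2 - |α q.1 q.2 i| * Cb i =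
            (2 * lam * |α q.1 q.2 i| - Cb i)^2 / (4*lam) := by
          rw [← sq_abs (α q.1 q.2 i)]
          field_simp
          ring
        have h7 : 0 ≤ (2 * lam * |α q.1 q.2 i| - Cb i)^2 / (4*lam) := by positivity
        linarith
      rw [Finset.sum_add_distrib, ← Finset.mul_sum (f := fun i => (α q.1 q.2 i)^2)] at this
      have := hq.1
      simp only [hC, sqnorm]
      linarith
    calc indw s₁ s₂ q * |fpI σ α φ q| ≤ indw s₁ s₂ q * (C + lam * sqnorm (α q.1 q.2)) := by
          gcongr; exact indw_nonneg _ _ _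
      _ ≤ C * indw s₁ s₂ q + lam * sqnorm (α q.1 q.2) := by
          have := mul_nonneg hlam0.le (sqnorm_nonneg (α q.1 q.2))
          nlinarith [indw_le s₁ s₂ q]
  have hindint : Integrable (fun q => indw (d := d) s₁ s₂ q) (stMeas m hm T) := by
    simpa using indw_mul_integrable (integrable_const (1:ℝ)) s₁ s₂
  have hsq := sqnorm_integrable hm hα hL
  have hle := norm_integral_le_of_norm_le ((hindint.const_mul C).add (hsq.const_mul lam)) hbound
  simp only [Pi.add_apply] at hle
  rw [integral_add (hindint.const_mul C) (hsq.const_mul lam), integral_const_mul, integral_const_mul] at hle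
  have hind : ∫ q, indw s₁ s₂ q ∂(stMeas m hm T) = s₂ - s₁ := by
    have := stMeas_integral_sub hm (integrable_const (1:ℝ) (μ := stMeas m hm T)) h1 h12 h2
    simp only [mul_one] at this
    rw [← this]
    simp
  rw [hind] at hle
  refine hle.trans ?_
  have a1 : C * (s₂ - s₁) ≤ ε / 2 := by
    have : C * (s₂ - s₁) ≤ (C+1) * (ε / (2 * (C + 1))) := by
      apply mul_le_mul (by linarith) hη (by linarith) (by linarith)
    have e2 : (C+1) * (ε / (2 * (C + 1))) = ε / 2 := by field_simp
    linarith
  have a2 : lam * (∫ q, sqnorm (α q.1 q.2) ∂(stMeas m hm T)) ≤ ε / 2 := by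
    have : lam * (∫ q, sqnorm (α q.1 q.2) ∂(stMeas m hm T)) ≤ lam * (|K| + 1) := by
      gcongr
      linarith [le_abs_self K]
    have e2 : lam * (|K| + 1) = ε / 2 := by rw [hlam]; field_simp
    linarith
  linarith

end energy


section weaklim

lemma ultra_lim (U : Ultrafilter ℕ) {u : ℕ → ℝ} {C : ℝ} (h : ∀ n, |u n| ≤ C) :
    ∃ l, Tendsto u U (𝓝 l) := by
  obtain ⟨x, -, hx⟩ := (isCompact_Icc (a := -C) (b := C)).ultrafilter_le_nhds' (U.map u) (by
    rw [Ultrafilter.mem_map]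
    filter_upwards with n
    exact abs_le.1 (h n))
  exact ⟨x, hx⟩

lemma abstract_rep {A E : Type*} [AddCommGroup A] [Module ℝ A] [NormedAddCommGroup E]
    [InnerProductSpace ℝ E] [CompleteSpace E] (J : A →ₗ[ℝ] E) (W : A →ₗ[ℝ] ℝ) (C : ℝ)
    (h : ∀ a, |W a| ≤ C * ‖J a‖) : ∃ e : E, ∀ a, W a = inner ℝ e (J a) := by
  have hW : W ∈ LinearMap.range (J.dualMap) := by
    rw [LinearMap.range_dualMap_eq_dualAnnihilator_ker, Submodule.mem_dualAnnihilator]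
    intro a ha
    rw [LinearMap.mem_ker] at ha
    have := h a
    rw [ha, norm_zero, mul_zero] at this
    exact abs_nonpos_iff.1 this
  obtain ⟨g, hg⟩ := hW
  have hg' : ∀ a, g (J a) = W a := fun a => by rw [← hg]; rfl
  let p : Submodule ℝ E := LinearMap.range J
  let f : StrongDual ℝ p := (g.domRestrict p).mkContinuous C (by
    rintro ⟨_, a, rfl⟩
    have := h a
    simp only [LinearMap.domRestrict_apply, Real.norm_eq_abs, Submodule.coe_norm]
    rw [hg']
    exact this)
  obtain ⟨F, hF, -⟩ := exists_extension_norm_eq p f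
  refine ⟨(InnerProductSpace.toDual ℝ E).symm F, fun a => ?_⟩
  rw [InnerProductSpace.toDual_symm_apply]
  have := hF ⟨J a, a, rfl⟩
  simp only at this
  rw [this, ← hg']
  rfl

lemma cs_integral {X : Type*} [MeasurableSpace X] {μ : Measure X} {f g : X → ℝ}
    (hf : Integrable (fun x => f x ^ 2) μ) (hg : Integrable (fun x => g x ^ 2) μ)
    (hfg : Integrable (fun x => f x * g x) μ) :
    (∫ x, f x * g x ∂μ) ^ 2 ≤ (∫ x, f x ^ 2 ∂μ) * ∫ x, g x ^ 2 ∂μ := by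
  have := discrim_le_zero (a := ∫ x, g x ^ 2 ∂μ) (b := 2 * ∫ x, f x * g x ∂μ) (c := ∫ x, f x ^ 2 ∂μ) (by
    intro t
    have e : (∫ x, g x ^ 2 ∂μ) * (t * t) + (2 * ∫ x, f x * g x ∂μ) * t + ∫ x, f x ^ 2 ∂μ =
        ∫ x, (f x + t * g x)^2 ∂μ := by
      have e1 : ∀ x, (f x + t * g x)^2 = (t*t) * g x ^ 2 + (2*t) * (f x * g x) + f x ^ 2 := fun x => by ring
      simp_rw [e1]
      have hgf : Integrable (fun x => (t*t) * g x ^ 2 + (2*t) * (f x * g x)) μ :=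
        (hg.const_mul _).add (hfg.const_mul _)
      rw [integral_add hgf hf,
        integral_add (hg.const_mul _) (hfg.const_mul _), integral_const_mul, integral_const_mul]
      ring
    rw [e]
    exact integral_nonneg fun x => sq_nonneg _)
  rw [discrim] at this
  nlinarith

variable {d : ℕ}

/-- space-time functions which are measurable, bounded, and continuous in space -/
def clsA (d : ℕ) (T : ℝ) : Submodule ℝ (ℝ × Td d → ℝ) where
  carrier := {ψ | Measurable ψ ∧ (∃ C, ∀ s ∈ Ioc 0 T, ∀ y, |ψ (s, y)| ≤ C) ∧
    ∀ s, Continuous fun y => ψ (s, y)}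
  add_mem' := by
    rintro a b ⟨h1, ⟨C, h2⟩, h3⟩ ⟨k1, ⟨D, k2⟩, k3⟩
    exact ⟨h1.add k1, ⟨C + D, fun s hs y => (abs_add_le _ _).trans (add_le_add (h2 s hs y) (k2 s hs y))⟩,
      fun s => (h3 s).add (k3 s)⟩
  zero_mem' := ⟨measurable_const, ⟨0, fun s _ y => by simp⟩, fun s => continuous_const⟩
  smul_mem' := by
    rintro c a ⟨h1, ⟨C, h2⟩, h3⟩
    exact ⟨h1.const_smul c, ⟨|c| * C, fun s hs y => by
      simp only [Pi.smul_apply, smul_eq_mul, abs_mul]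
      exact mul_le_mul_of_nonneg_left (h2 s hs y) (abs_nonneg _)⟩, fun s => (h3 s).const_smul c⟩

lemma mem_clsA {T : ℝ} {ψ : ℝ × Td d → ℝ} : ψ ∈ clsA d T ↔
    Measurable ψ ∧ (∃ C, ∀ s ∈ Ioc 0 T, ∀ y, |ψ (s, y)| ≤ C) ∧
    ∀ s, Continuous fun y => ψ (s, y) := Iff.rfl

lemma clsA_mul {T : ℝ} {a b : ℝ × Td d → ℝ} (ha : a ∈ clsA d T) (hb : b ∈ clsA d T) :
    (fun q => a q * b q) ∈ clsA d T := by
  obtain ⟨h1, ⟨C, h2⟩, h3⟩ := ha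
  obtain ⟨k1, ⟨D, k2⟩, k3⟩ := hb
  refine ⟨h1.mul k1, ⟨C * D, fun s hs y => ?_⟩, fun s => (h3 s).mul (k3 s)⟩
  rw [abs_mul]
  exact mul_le_mul (h2 s hs y) (k2 s hs y) (abs_nonneg _) ((abs_nonneg _).trans (h2 s hs y))

lemma clsA_cont {T : ℝ} {f : ℝ × Td d → ℝ} (hf : Continuous f) : f ∈ clsA d T := by
  obtain ⟨C, -, hC⟩ := cont_bdd_on hf T
  exact ⟨hf.measurable, ⟨C, fun s hs y => hC s (Ioc_subset_Icc_self hs) y⟩, fun s => by fun_prop⟩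

lemma clsA_indw {T : ℝ} (s₁ s₂ : ℝ) : (indw (d := d) s₁ s₂) ∈ clsA d T :=
  ⟨indw_meas _ _, ⟨1, fun s _ y => indw_abs _ _ _⟩, fun s => by simp only [indw]; exact continuous_const⟩

lemma clsA_integrable {m : ℝ → PTd d} (hm : Continuous m) {T : ℝ} {a : ℝ × Td d → ℝ}
    (ha : a ∈ clsA d T) : Integrable a (stMeas m hm T) := by
  obtain ⟨h1, ⟨C, h2⟩, -⟩ := ha
  exact stMeas_bdd_integrable hm h1 h2

lemma clsA_memLp {m : ℝ → PTd d} (hm : Continuous m) {T : ℝ} {a : ℝ × Td d → ℝ}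
    (ha : a ∈ clsA d T) : MemLp a 2 (stMeas m hm T) := by
  rw [memLp_two_iff_integrable_sq ha.1.aestronglyMeasurable]
  simp_rw [sq]
  exact clsA_integrable hm (clsA_mul ha ha)

lemma clsA_tendsto {mk : ℕ → ℝ → PTd d} (hmk : ∀ k, Continuous (mk k)) {μ : ℝ → PTd d}
    (hμ : Continuous μ) {T : ℝ} (hT : 0 ≤ T)
    (hlim : ∀ s, Tendsto (fun k => mk k s) atTop (𝓝 (μ s))) {a : ℝ × Td d → ℝ}
    (ha : a ∈ clsA d T) : Tendsto (fun k => ∫ q, a q ∂(stMeas (mk k) (hmk k) T)) atTop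
      (𝓝 (∫ q, a q ∂(stMeas μ hμ T))) := by
  rw [stMeas_integral hμ hT (clsA_integrable hμ ha)]
  simp_rw [fun k => stMeas_integral (hmk k) hT (clsA_integrable (hmk k) ha)]
  obtain ⟨h1, ⟨C, h2⟩, h3⟩ := id ha
  refine intervalIntegral.tendsto_integral_filter_of_dominated_convergence (fun _ => C) ?_ ?_ ?_ ?_
  · refine Eventually.of_forall fun k => ?_
    have := stMeas_intervalIntegrable (hmk k) hT (clsA_integrable (hmk k) ha)
    exact this.aestronglyMeasurable_restrict_uIoc
  · refine Eventually.of_forall fun k => ae_of_all _ fun s hs => ?_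
    rw [uIoc_of_le hT] at hs
    have := norm_integral_le_of_norm_le_const (μ := (mk k s : Measure (Td d)))
        (f := fun y => a (s, y)) (ae_of_all _ (fun y => h2 s hs y))
    simpa using this
  · simp
  · exact ae_of_all _ fun s _ => weak_tendsto_cont (hlim s) (h3 s)

theorem weak_limit {mk : ℕ → ℝ → PTd d} (hmk : ∀ k, Continuous (mk k)) {μ : ℝ → PTd d}
    (hμ : Continuous μ) {T : ℝ} (hT : 0 ≤ T)
    (hlim : ∀ s, Tendsto (fun k => mk k s) atTop (𝓝 (μ s))) (a : ℕ → ℝ × Td d → ℝ)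
    (ha : ∀ k, MemLp (a k) 2 (stMeas (mk k) (hmk k) T)) {K : ℝ}
    (hK : ∀ k, ∫ q, (a k q)^2 ∂(stMeas (mk k) (hmk k) T) ≤ K) :
    ∃ b : ℝ × Td d → ℝ, Measurable b ∧ MemLp b 2 (stMeas μ hμ T) ∧ ∀ ψ ∈ clsA d T,
      Tendsto (fun k => ∫ q, a k q * ψ q ∂(stMeas (mk k) (hmk k) T)) (hyperfilter ℕ)
        (𝓝 (∫ q, b q * ψ q ∂(stMeas μ hμ T))) := by
  have hint : ∀ k, ∀ ψ ∈ clsA d T, Integrable (fun q => a k q * ψ q) (stMeas (mk k) (hmk k) T) :=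
    fun k ψ hψ => (ha k).integrable_mul (clsA_memLp (hmk k) hψ)
  have hcs : ∀ ψ ∈ clsA d T, ∀ k, (∫ q, a k q * ψ q ∂(stMeas (mk k) (hmk k) T))^2 ≤
      K * ∫ q, (ψ q)^2 ∂(stMeas (mk k) (hmk k) T) := by
    intro ψ hψ k
    refine (cs_integral (ha k).integrable_sq (clsA_memLp (hmk k) hψ).integrable_sq (hint k ψ hψ)).trans ?_
    exact mul_le_mul_of_nonneg_right (hK k) (integral_nonneg fun q => sq_nonneg _)
  have hK0 : 0 ≤ K := (integral_nonneg fun q => sq_nonneg _).trans (hK 0)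
  have hsq : ∀ ψ ∈ clsA d T, Tendsto (fun k => ∫ q, (ψ q)^2 ∂(stMeas (mk k) (hmk k) T)) atTop
      (𝓝 (∫ q, (ψ q)^2 ∂(stMeas μ hμ T))) := by
    intro ψ hψ
    have := clsA_tendsto hmk hμ hT hlim (clsA_mul hψ hψ)
    simpa only [sq] using this
  have hex : ∀ ψ : clsA d T, ∃ l, Tendsto (fun k => ∫ q, a k q * ψ.1 q ∂(stMeas (mk k) (hmk k) T))
      (hyperfilter ℕ) (𝓝 l) := by
    rintro ⟨ψ, hψ⟩
    obtain ⟨C, hC⟩ := (hsq ψ hψ).bddAbove_range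
    refine ultra_lim _ (C := Real.sqrt (K * C)) fun k => ?_
    rw [← Real.sqrt_sq_eq_abs]
    apply Real.sqrt_le_sqrt
    exact (hcs ψ hψ k).trans (mul_le_mul_of_nonneg_left (hC ⟨k, rfl⟩) hK0)
  choose w hw using hex
  let W : clsA d T →ₗ[ℝ] ℝ :=
    { toFun := w
      map_add' := fun x y => by
        refine tendsto_nhds_unique (hw (x+y)) (((hw x).add (hw y)).congr fun k => ?_)
        rw [← integral_add (hint k _ x.2) (hint k _ y.2)]
        refine integral_congr_ae (ae_of_all _ fun q => ?_)
        simp only [Submodule.coe_add, Pi.add_apply, mul_add]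
      map_smul' := fun c x => by
        refine tendsto_nhds_unique (hw (c • x)) (((hw x).const_mul c).congr fun k => ?_)
        rw [← integral_const_mul]
        refine integral_congr_ae (ae_of_all _ fun q => ?_)
        simp only [Submodule.coe_smul, Pi.smul_apply, smul_eq_mul]
        ring }
  let J : clsA d T →ₗ[ℝ] Lp ℝ 2 (stMeas μ hμ T) :=
    { toFun := fun ψ => (clsA_memLp hμ ψ.2).toLp ψ.1
      map_add' := fun x y => MemLp.toLp_add _ _
      map_smul' := fun c x => MemLp.toLp_const_smul c _ }
  have hin : ∀ (e : Lp ℝ 2 (stMeas μ hμ T)) (ψ : clsA d T), inner ℝ e (J ψ) =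
      ∫ q, e q * ψ.1 q ∂(stMeas μ hμ T) := by
    intro e ψ
    rw [L2.inner_def]
    refine integral_congr_ae ?_
    filter_upwards [(clsA_memLp hμ ψ.2).coeFn_toLp] with q hq
    change inner ℝ (e q) (((clsA_memLp hμ ψ.2).toLp ψ.1) q) = _
    rw [hq]
    simp [mul_comm]
  have hbound : ∀ ψ, |W ψ| ≤ Real.sqrt K * ‖J ψ‖ := by
    intro ψ
    have h1 : (w ψ)^2 ≤ K * ∫ q, (ψ.1 q)^2 ∂(stMeas μ hμ T) :=
      le_of_tendsto_of_tendsto ((hw ψ).pow 2)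
        (((hsq ψ.1 ψ.2).mono_left Nat.hyperfilter_le_atTop).const_mul K)
        (Eventually.of_forall fun k => hcs ψ.1 ψ.2 k)
    have h2 : ‖J ψ‖^2 = ∫ q, (ψ.1 q)^2 ∂(stMeas μ hμ T) := by
      rw [← real_inner_self_eq_norm_sq, hin]
      refine integral_congr_ae ?_
      filter_upwards [(clsA_memLp hμ ψ.2).coeFn_toLp] with q hq
      change (((clsA_memLp hμ ψ.2).toLp ψ.1) q) * _ = _
      rw [hq, sq]
    rw [← h2] at h1
    refine abs_le_of_sq_le_sq ?_ (by positivity)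
    rw [mul_pow, Real.sq_sqrt hK0]
    exact h1
  obtain ⟨e, he⟩ := abstract_rep J W _ hbound
  refine ⟨e, (Lp.stronglyMeasurable e).measurable, Lp.memLp e, fun ψ hψ => ?_⟩
  have := hw ⟨ψ, hψ⟩
  have e2 := he ⟨ψ, hψ⟩
  rw [hin] at e2
  rw [← e2]
  exact this

end weaklim


section lsc
variable {d : ℕ}

lemma H_lift_cont (S : MFGSetting d) : Continuous (fun z : Vd d × Td d => S.H (secT z.2) z.1) := by
  refine cont_lift (f := fun p x => S.H x p) ?_ (fun p x z => S.H_per x z p)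
  exact (H_cont S).comp (continuous_snd.prodMk continuous_fst)

lemma H_bdd (S : MFGSetting d) (R : ℝ) : ∃ C, ∀ (y : Td d) (p : Vd d), ‖p‖ ≤ R → |S.H (secT y) p| ≤ C := by
  obtain ⟨C, hC⟩ := ((isCompact_closedBall (0 : Vd d) R).prod (isCompact_univ (X := Td d)))
    |>.exists_bound_of_continuousOn (H_lift_cont S).continuousOn
  exact ⟨C, fun y p hp => hC (p, y) ⟨by simpa using hp, mem_univ _⟩⟩

lemma clsA_vec_bdd {T : ℝ} {P : ℝ × Td d → Vd d} (hP : ∀ i, (fun q => P q i) ∈ clsA d T) :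
    ∃ R, 0 ≤ R ∧ ∀ s ∈ Ioc 0 T, ∀ y, ‖P (s, y)‖ ≤ R := by
  choose C hC using fun i => (hP i).2.1
  refine ⟨∑ i, |C i|, Finset.sum_nonneg fun i _ => abs_nonneg _, fun s hs y => ?_⟩
  rw [pi_norm_le_iff_of_nonneg (Finset.sum_nonneg fun i _ => abs_nonneg _)]
  intro i
  refine (hC i s hs y).trans ((le_abs_self _).trans ?_)
  exact Finset.single_le_sum (f := fun i => |C i|) (fun i _ => abs_nonneg _) (Finset.mem_univ i)

lemma clsA_H (S : MFGSetting d) {T : ℝ} {P : ℝ × Td d → Vd d} (hP : ∀ i, (fun q => P q i) ∈ clsA d T) :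
    (fun q => S.H (secT q.2) (P q)) ∈ clsA d T := by
  refine ⟨?_, ?_, fun s => ?_⟩
  · have h1 : Measurable P := measurable_pi_lambda _ fun i => (hP i).1
    exact (H_cont S).measurable.comp ((measurable_secT.comp measurable_snd).prodMk h1)
  · obtain ⟨R, -, hR⟩ := clsA_vec_bdd hP
    obtain ⟨C, hC⟩ := H_bdd S R
    exact ⟨C, fun s hs y => hC y _ (hR s hs y)⟩
  · have h1 : Continuous fun y => P (s, y) := continuous_pi fun i => (hP i).2.2 s
    exact (H_lift_cont S).comp (h1.prodMk continuous_id)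

lemma clsA_exp {T : ℝ} (δ : ℝ) : (fun q : ℝ × Td d => Real.exp (-δ * q.1)) ∈ clsA d T :=
  clsA_cont (by fun_prop)

lemma val_split (S : MFGSetting d) {m : ℝ → PTd d} (hm : Continuous m) {T : ℝ} {α : ℝ → Td d → Vd d}
    (hα : Measurable (fun q : ℝ × Td d => α q.1 q.2)) (h : L2on m α T) (δ : ℝ)
    {P : ℝ × Td d → Vd d} (hP : ∀ i, (fun q => P q i) ∈ clsA d T) :
    Integrable (fun q => Real.exp (-δ * q.1) * (dotp (α q.1 q.2) (P q) - S.H (secT q.2) (P q)))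
      (stMeas m hm T) ∧
    ∫ q, Real.exp (-δ * q.1) * (dotp (α q.1 q.2) (P q) - S.H (secT q.2) (P q)) ∂(stMeas m hm T) =
    (∑ i, ∫ q, α q.1 q.2 i * (Real.exp (-δ * q.1) * P q i) ∂(stMeas m hm T)) -
      ∫ q, Real.exp (-δ * q.1) * S.H (secT q.2) (P q) ∂(stMeas m hm T) := by
  have hi : ∀ i, Integrable (fun q : ℝ × Td d => α q.1 q.2 i * (Real.exp (-δ * q.1) * P q i)) (stMeas m hm T) := by
    intro i
    obtain ⟨h1, ⟨C, hC⟩, -⟩ := clsA_mul (clsA_exp δ) (hP i)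
    exact comp_mul_integrable hm hα h i h1 hC
  have hH := clsA_integrable hm (clsA_mul (clsA_exp δ) (clsA_H S hP))
  have e : (fun q : ℝ × Td d => Real.exp (-δ * q.1) * (dotp (α q.1 q.2) (P q) - S.H (secT q.2) (P q))) =
      fun q => (∑ i, α q.1 q.2 i * (Real.exp (-δ * q.1) * P q i)) - Real.exp (-δ * q.1) * S.H (secT q.2) (P q) := by
    funext q
    rw [mul_sub, dotp, Finset.mul_sum]
    congr 1
    exact Finset.sum_congr rfl fun i _ => by ring
  have hs := integrable_finsetSum Finset.univ (fun i _ => hi i)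
  rw [e]
  refine ⟨hs.sub hH, ?_⟩
  rw [integral_sub hs hH, integral_finsetSum _ (fun i _ => hi i)]

/-- coordinatewise truncation -/
def clipV (R : ℝ) (p : Vd d) : Vd d := fun i => max (-R) (min R (p i))

lemma clipV_cont (R : ℝ) : Continuous (clipV (d := d) R) := by
  unfold clipV; fun_prop

lemma clipV_norm {R : ℝ} (hR : 0 ≤ R) (p : Vd d) : ‖clipV R p‖ ≤ R := by
  rw [pi_norm_le_iff_of_nonneg hR]
  intro i
  rw [Real.norm_eq_abs, abs_le]
  exact ⟨le_max_left _ _, max_le (by linarith) (min_le_left _ _)⟩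

lemma clipV_self {R : ℝ} {p : Vd d} (h : ‖p‖ ≤ R) : clipV R p = p := by
  funext i
  have := abs_le.1 ((norm_le_pi_norm p i).trans h)
  simp only [clipV]
  rw [min_eq_right this.2, max_eq_right this.1]

lemma approx_cont {M : Measure (ℝ × Td d)} [IsFiniteMeasure M] {P : ℝ × Td d → Vd d} (hP : Measurable P)
    {R : ℝ} (hR : 0 ≤ R) (hb : ∀ q, ‖P q‖ ≤ R) : ∃ Q : ℕ → ℝ × Td d → Vd d, (∀ j, Continuous (Q j)) ∧
      (∀ j q, ‖Q j q‖ ≤ R) ∧ ∀ᵐ q ∂M, Tendsto (fun j => Q j q) atTop (𝓝 (P q)) := by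
  have hmem : MemLp P 1 M := MemLp.of_bound hP.aestronglyMeasurable R (ae_of_all _ hb)
  have hg : ∀ j : ℕ, ∃ g : BoundedContinuousFunction (ℝ × Td d) (Vd d),
      eLpNorm (P - (g : ℝ × Td d → Vd d)) 1 M ≤ ENNReal.ofReal (1/((j:ℝ)+1)) ∧ MemLp g 1 M := fun j =>
    hmem.exists_boundedContinuous_eLpNorm_sub_le (by norm_num) (by
      rw [Ne, ENNReal.ofReal_eq_zero, not_le]; positivity)
  choose g hg1 hg2 using hg
  have ht : TendstoInMeasure M (fun j => (g j : ℝ × Td d → Vd d)) atTop P := by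
    refine tendstoInMeasure_of_tendsto_eLpNorm (p := 1) (by norm_num)
      (fun j => (hg2 j).aestronglyMeasurable) hmem.aestronglyMeasurable ?_
    have h0 : Tendsto (fun j : ℕ => ENNReal.ofReal (1/((j:ℝ)+1))) atTop (𝓝 0) := by
      have := ENNReal.tendsto_ofReal (tendsto_one_div_add_atTop_nhds_zero_nat (𝕜 := ℝ))
      simpa using this
    refine tendsto_of_tendsto_of_tendsto_of_le_of_le tendsto_const_nhds h0 (fun _ => zero_le) (fun j => ?_)
    have := hg1 j
    rw [eLpNorm_sub_comm] at this
    exact this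
  obtain ⟨ns, -, hns⟩ := ht.exists_seq_tendsto_ae
  refine ⟨fun j q => clipV R (g (ns j) q), fun j => (clipV_cont R).comp (g (ns j)).continuous,
    fun j q => clipV_norm hR _, ?_⟩
  filter_upwards [hns] with q hq
  have := ((clipV_cont R).tendsto (P q)).comp hq
  rw [clipV_self (hb q)] at this
  exact this

theorem lsc_core (S : MFGSetting d) {mk : ℕ → ℝ → PTd d} (hmk : ∀ k, Continuous (mk k)) {μ : ℝ → PTd d}
    (hμ : Continuous μ) {T : ℝ} (hT : 0 ≤ T)
    (hlim : ∀ s, Tendsto (fun k => mk k s) atTop (𝓝 (μ s)))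
    {αk : ℕ → ℝ → Td d → Vd d} (hαk : ∀ k, Measurable (fun q : ℝ × Td d => αk k q.1 q.2))
    (hLk : ∀ k, L2on (mk k) (αk k) T) {α : ℝ → Td d → Vd d}
    (hα : Measurable (fun q : ℝ × Td d => α q.1 q.2)) (hL : L2on μ α T)
    (hw : ∀ i, ∀ ψ ∈ clsA d T,
      Tendsto (fun k => ∫ q, αk k q.1 q.2 i * ψ q ∂(stMeas (mk k) (hmk k) T)) (hyperfilter ℕ)
        (𝓝 (∫ q, α q.1 q.2 i * ψ q ∂(stMeas μ hμ T)))) (δ c : ℝ)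
    (hc : ∀ᶠ k in atTop, Jd S δ (mk k) (αk k) T ≤ c) : Jd S δ μ α T ≤ c := by
  set M := stMeas μ hμ T with hM
  set F0 : ℝ := ∫ s in (0:ℝ)..T, Real.exp (-δ * s) * S.Fc (μ s) with hF0
  have hF : Tendsto (fun k => ∫ s in (0:ℝ)..T, Real.exp (-δ * s) * S.Fc (mk k s)) atTop (𝓝 F0) := by
    obtain ⟨B, hB⟩ := S.Fc_bounded
    refine intervalIntegral.tendsto_integral_filter_of_dominated_convergence
      (fun s => Real.exp (-δ * s) * B) ?_ ?_ ?_ ?_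
    · refine Eventually.of_forall fun k => ?_
      have := Fc_cont_comp S (hmk k)
      exact (by fun_prop : Continuous fun s => Real.exp (-δ * s) * S.Fc (mk k s)).aestronglyMeasurable
    · refine Eventually.of_forall fun k => ae_of_all _ fun s hs => ?_
      rw [norm_mul, Real.norm_eq_abs, Real.norm_eq_abs, abs_of_pos (Real.exp_pos _)]
      exact mul_le_mul_of_nonneg_left (hB _) (Real.exp_pos _).le
    · exact (by fun_prop : Continuous fun s => Real.exp (-δ * s) * B).intervalIntegrable _ _
    · exact ae_of_all _ fun s _ => (((Fc_continuous S).tendsto _).comp (hlim s)).const_mul _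
  -- step 1
  have step1 : ∀ P : ℝ × Td d → Vd d, (∀ i, (fun q => P q i) ∈ clsA d T) →
      (∫ q, Real.exp (-δ * q.1) * (dotp (α q.1 q.2) (P q) - S.H (secT q.2) (P q)) ∂M) + F0 ≤ c := by
    intro P hP
    have hlimit : Tendsto (fun k => (∫ q, Real.exp (-δ * q.1) * (dotp (αk k q.1 q.2) (P q)
        - S.H (secT q.2) (P q)) ∂(stMeas (mk k) (hmk k) T)) +
        ∫ s in (0:ℝ)..T, Real.exp (-δ * s) * S.Fc (mk k s)) (hyperfilter ℕ)
        (𝓝 ((∫ q, Real.exp (-δ * q.1) * (dotp (α q.1 q.2) (P q) - S.H (secT q.2) (P q)) ∂M) + F0)) := by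
      refine Tendsto.add ?_ (hF.mono_left Nat.hyperfilter_le_atTop)
      rw [hM, (val_split S hμ hα hL δ hP).2]
      simp_rw [fun k => (val_split S (hmk k) (hαk k) (hLk k) δ hP).2]
      refine Tendsto.sub (tendsto_finsetSum _ fun i _ => hw i _ (clsA_mul (clsA_exp δ) (hP i))) ?_
      exact (clsA_tendsto hmk hμ hT hlim (clsA_mul (clsA_exp δ) (clsA_H S hP))).mono_left
        Nat.hyperfilter_le_atTop
    refine le_of_tendsto hlimit ?_
    filter_upwards [Nat.hyperfilter_le_atTop hc] with k hk
    refine le_trans ?_ hk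
    rw [Jd_eq (hmk k) S hT (hαk k) (hLk k)]
    refine add_le_add_left (integral_mono (val_split S (hmk k) (hαk k) (hLk k) δ hP).1
      (weight_Hstar_integrable (hmk k) S (hαk k) (hLk k) δ) fun q => ?_) _
    exact mul_le_mul_of_nonneg_left (le_Hstar S _ _ _) (Real.exp_pos _).le
  have hexpm : Measurable (fun q : ℝ × Td d => Real.exp (-δ * q.1)) := by fun_prop
  obtain ⟨E, hE0, hE⟩ := cont_bdd_on (by fun_prop : Continuous (fun q : ℝ × Td d => Real.exp (-δ * q.1))) T
  have hEae : ∀ᵐ q ∂M, |Real.exp (-δ * q.1)| ≤ E :=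
    stMeas_ae hμ (measurableSet_le hexpm.norm measurable_const) fun s hs y => hE s (Ioc_subset_Icc_self hs) y
  have hab : Integrable (fun q : ℝ × Td d => ∑ i, |α q.1 q.2 i|) M :=
    integrable_finsetSum _ fun i _ => (comp_integrable hμ hα hL i).abs
  -- step 2
  have step2 : ∀ P : ℝ × Td d → Vd d, Measurable P → ∀ R : ℝ, 0 ≤ R → (∀ q, ‖P q‖ ≤ R) →
      (∫ q, Real.exp (-δ * q.1) * (dotp (α q.1 q.2) (P q) - S.H (secT q.2) (P q)) ∂M) + F0 ≤ c := by
    intro P hP R hR0 hR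
    obtain ⟨Q, hQc, hQR, hQ⟩ := approx_cont (M := M) hP hR0 hR
    obtain ⟨C, hC⟩ := H_bdd S R
    have hten : Tendsto (fun j => ∫ q, Real.exp (-δ * q.1) * (dotp (α q.1 q.2) (Q j q) - S.H (secT q.2) (Q j q)) ∂M)
        atTop (𝓝 (∫ q, Real.exp (-δ * q.1) * (dotp (α q.1 q.2) (P q) - S.H (secT q.2) (P q)) ∂M)) := by
      refine tendsto_integral_of_dominated_convergence
        (fun q => E * ((∑ i, |α q.1 q.2 i|) * R + C)) ?_ ?_ ?_ ?_
      · intro j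
        exact (hexpm.mul (measurable_valP S (measurable_secT.comp measurable_snd) hα
          (hQc j).measurable)).aestronglyMeasurable
      · exact ((hab.mul_const R).add (integrable_const C)).const_mul E
      · intro j
        filter_upwards [hEae] with q hq
        rw [norm_mul]
        refine mul_le_mul hq ?_ (norm_nonneg _) hE0
        refine (norm_sub_le _ _).trans (add_le_add ?_ (hC _ _ (hQR j q)))
        rw [dotp, Finset.sum_mul]
        refine (norm_sum_le _ _).trans (Finset.sum_le_sum fun i _ => ?_)
        rw [norm_mul]
        exact mul_le_mul_of_nonneg_left ((norm_le_pi_norm _ i).trans (hQR j q)) (norm_nonneg _)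
      · filter_upwards [hQ] with q hq
        refine Tendsto.const_mul _ (Tendsto.sub ?_ ?_)
        · exact ((continuous_dotp.comp (Continuous.prodMk_right (α q.1 q.2))).tendsto (P q)).comp hq
        · exact (((H_cont S).comp (Continuous.prodMk_right (secT q.2))).tendsto (P q)).comp hq
    refine le_of_tendsto (hten.add_const F0) (Eventually.of_forall fun j => step1 _ fun i => ?_)
    exact clsA_cont ((continuous_apply i).comp (hQc j))
  -- step 3
  rw [Jd_eq hμ S hT hα hL]
  have hten : Tendsto (fun N => ∫ q, Real.exp (-δ * q.1) * (dotp (α q.1 q.2) (selP S N (secT q.2) (α q.1 q.2))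
      - S.H (secT q.2) (selP S N (secT q.2) (α q.1 q.2))) ∂M)
      atTop (𝓝 (∫ q, Real.exp (-δ * q.1) * S.Hstar (secT q.2) (α q.1 q.2) ∂M)) := by
    obtain ⟨C, hC⟩ := H_bdd S 0
    refine tendsto_integral_of_dominated_convergence
      (fun q => E * (|S.Hstar (secT q.2) (α q.1 q.2)| + C)) ?_ ?_ ?_ ?_
    · intro N
      exact (hexpm.mul (measurable_valP S (measurable_secT.comp measurable_snd) hα
        ((selP_measurable S N).comp ((measurable_secT.comp measurable_snd).prodMk hα)))).aestronglyMeasurable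
    · exact (((Hstar_integrable hμ S hα hL).abs).add (integrable_const C)).const_mul E
    · intro N
      filter_upwards [hEae] with q hq
      rw [norm_mul]
      refine mul_le_mul hq ?_ (norm_nonneg _) hE0
      have h1 := selP_lower S (secT q.2) (α q.1 q.2) N
      have h2 := le_Hstar S (secT q.2) (α q.1 q.2) (selP S N (secT q.2) (α q.1 q.2))
      have h3 := abs_le.1 (hC q.2 0 (by simp))
      have h4 := le_abs_self (S.Hstar (secT q.2) (α q.1 q.2))
      have h5 := abs_nonneg (S.Hstar (secT q.2) (α q.1 q.2))
      rw [Real.norm_eq_abs, abs_le]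
      constructor <;> linarith [h3.1, h3.2]
    · exact ae_of_all _ fun q => (selP_tendsto S _ _).const_mul _
  refine le_of_tendsto (hten.add_const F0) (Eventually.of_forall fun N => ?_)
  obtain ⟨R, hR⟩ := selP_bdd S N
  exact step2 _ ((selP_measurable S N).comp ((measurable_secT.comp measurable_snd).prodMk hα)) |R| (abs_nonneg _)
    (fun q => (hR _ _).trans (le_abs_self _))

end lsc


section compact2
variable {d : ℕ}

lemma AdmOn_of (S : MFGSetting d) {m : ℝ → PTd d} (hm : Continuous m) {T : ℝ} (hT : 0 ≤ T)
    {m₀ : PTd d} (h0 : m 0 = m₀) {α : ℝ → Td d → Vd d}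
    (hFP : ∀ s₁ s₂ : ℝ, 0 ≤ s₁ → s₁ ≤ s₂ → s₂ ≤ T → FPeq 1 m α s₁ s₂)
    (hα : Measurable (fun q : ℝ × Td d => α q.1 q.2)) (hL : L2on m α T) : AdmOn S 1 m₀ T m α := by
  refine ⟨h0, W1ContOn_iff.2 hm.continuousOn, hFP, hα, hL, ?_⟩
  have := runCost_weight_intervalIntegrable hm S hT hα hL 0
  simpa using this

lemma FPeq_congr {m m' : ℝ → PTd d} {α α' : ℝ → Td d → Vd d} {σ s₁ s₂ : ℝ} (h12 : s₁ ≤ s₂)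
    (hm : ∀ s ∈ Icc s₁ s₂, m s = m' s) (hα : ∀ s ∈ Ioc s₁ s₂, α s = α' s)
    (h : FPeq σ m α s₁ s₂) : FPeq σ m' α' s₁ s₂ := by
  intro φ hφ
  rw [← hm s₁ ⟨le_rfl, h12⟩, ← hm s₂ ⟨h12, le_rfl⟩, h φ hφ]
  refine intervalIntegral.integral_congr_ae (ae_of_all _ fun s hs => ?_)
  rw [uIoc_of_le h12] at hs
  rw [hm s (Ioc_subset_Icc_self hs), hα s hs]

lemma runCost_congr (S : MFGSetting d) {m m' : ℝ → PTd d} {α α' : ℝ → Td d → Vd d} {s : ℝ}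
    (hm : m s = m' s) (hα : α s = α' s) : runCost S m α s = runCost S m' α' s := by
  simp only [runCost, hm, hα]

lemma Jd_congr (S : MFGSetting d) {m m' : ℝ → PTd d} {α α' : ℝ → Td d → Vd d} {T : ℝ} (hT : 0 ≤ T)
    (hm : ∀ s ∈ Icc 0 T, m s = m' s) (hα : ∀ s ∈ Ioc 0 T, α s = α' s) (δ : ℝ) :
    Jd S δ m α T = Jd S δ m' α' T := by
  refine intervalIntegral.integral_congr_ae (ae_of_all _ fun s hs => ?_)
  rw [uIoc_of_le hT] at hs
  simp only [runCost_congr S (hm s (Ioc_subset_Icc_self hs)) (hα s hs)]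

lemma L2on_congr {m m' : ℝ → PTd d} {α α' : ℝ → Td d → Vd d} {T : ℝ}
    (hm : ∀ s ∈ Icc 0 T, m s = m' s) (hα : ∀ s ∈ Ioc 0 T, α s = α' s) (h : L2on m α T) :
    L2on m' α' T := by
  unfold L2on at h ⊢
  rw [← setLIntegral_congr_fun measurableSet_Ioc
    (f := fun s => ∫⁻ y, ENNReal.ofReal (sqnorm (α s y)) ∂(m s : Measure (Td d)))]
  · exact h
  · intro s hs
    simp only [hm s (Ioc_subset_Icc_self hs), hα s hs]

/-- extension of a curve on `[0,T]` by constants -/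
def clampT (T : ℝ) (m : ℝ → PTd d) (s : ℝ) : PTd d := m (max 0 (min s T))

lemma clamp_mem {T : ℝ} (hT : 0 ≤ T) (s : ℝ) : max 0 (min s T) ∈ Icc 0 T :=
  ⟨le_max_left _ _, max_le hT (min_le_right _ _)⟩

lemma clampT_eq {T : ℝ} {m : ℝ → PTd d} {s : ℝ} (hs : s ∈ Icc 0 T) : clampT T m s = m s := by
  rw [clampT, min_eq_left hs.2, max_eq_right hs.1]

lemma clampT_cont {T : ℝ} (hT : 0 ≤ T) {m : ℝ → PTd d} (hm : ContinuousOn m (Icc 0 T)) :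
    Continuous (clampT T m) :=
  hm.comp_continuous (by fun_prop) (fun s => clamp_mem hT s)

lemma stMeas_one {m : ℝ → PTd d} (hm : Continuous m) {T : ℝ} (hT : 0 ≤ T) :
    ∫ _q, (1:ℝ) ∂(stMeas m hm T) = T := by
  rw [stMeas_integral hm hT (integrable_const (1:ℝ))]
  simp

lemma energy_bound (S : MFGSetting d) {T : ℝ} (hT : 0 ≤ T) (δ c : ℝ) : ∃ K, ∀ (m : ℝ → PTd d)
    (hm : Continuous m) (α : ℝ → Td d → Vd d), Measurable (fun q : ℝ × Td d => α q.1 q.2) →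
    L2on m α T → Jd S δ m α T ≤ c → ∫ q, sqnorm (α q.1 q.2) ∂(stMeas m hm T) ≤ K := by
  obtain ⟨A, b, B, hA, hb, hB, hq⟩ := Hstar_quad S
  obtain ⟨F, hF⟩ := S.Fc_bounded
  set e0 := Real.exp (-(|δ| * T)) with he0
  set E := Real.exp (|δ| * T) with hE
  have he0p : 0 < e0 := Real.exp_pos _
  have hEp : 0 < E := Real.exp_pos _
  have hbd : ∀ s ∈ Icc 0 T, e0 ≤ Real.exp (-δ * s) ∧ Real.exp (-δ * s) ≤ E := by
    intro s hs
    have h1 : |δ * s| ≤ |δ| * T := by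
      rw [abs_mul, abs_of_nonneg hs.1]
      exact mul_le_mul_of_nonneg_left hs.2 (abs_nonneg _)
    have h2 := abs_le.1 h1
    constructor <;> apply Real.exp_le_exp.2 <;> linarith [h2.1, h2.2]
  have hF0 : 0 ≤ F := (abs_nonneg _).trans (hF (⟨Measure.dirac 0, inferInstance⟩ : PTd d))
  refine ⟨(c + A * E * T + E * F * T) / (b * e0), fun m hm α hα hL hJ => ?_⟩
  rw [le_div_iff₀ (by positivity)]
  rw [Jd_eq hm S hT hα hL] at hJ
  have hsq := sqnorm_integrable hm hα hL
  have h1 : (b * e0) * (∫ q, sqnorm (α q.1 q.2) ∂(stMeas m hm T)) - A * E * T ≤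
      ∫ q, Real.exp (-δ * q.1) * S.Hstar (secT q.2) (α q.1 q.2) ∂(stMeas m hm T) := by
    have e : (b * e0) * (∫ q, sqnorm (α q.1 q.2) ∂(stMeas m hm T)) - A * E * T =
        ∫ q, ((b * e0) * sqnorm (α q.1 q.2) - A * E * 1) ∂(stMeas m hm T) := by
      rw [integral_sub (hsq.const_mul _) ((integrable_const (1:ℝ)).const_mul _), integral_const_mul,
        integral_const_mul, stMeas_one hm hT]
    rw [e]
    refine integral_mono_ae ((hsq.const_mul _).sub ((integrable_const (1:ℝ)).const_mul _))
      (weight_Hstar_integrable hm S hα hL δ) ?_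
    have hae : ∀ᵐ q ∂(stMeas m hm T), e0 ≤ Real.exp (-δ * q.1) ∧ Real.exp (-δ * q.1) ≤ E := by
      refine stMeas_ae hm ?_ fun s hs y => hbd s (Ioc_subset_Icc_self hs)
      have hexpm : Measurable (fun q : ℝ × Td d => Real.exp (-δ * q.1)) := by fun_prop
      exact (measurableSet_le measurable_const hexpm).inter
        (measurableSet_le hexpm measurable_const)
    filter_upwards [hae] with q hq'
    have h2 := (hq (secT q.2) (α q.1 q.2)).1
    have h3 := sqnorm_nonneg (α q.1 q.2)
    have h4 := mul_le_mul_of_nonneg_left h2 (Real.exp_pos (-δ * q.1)).le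
    have h5 : b * e0 * sqnorm (α q.1 q.2) ≤ b * Real.exp (-δ * q.1) * sqnorm (α q.1 q.2) := by
      have := hq'.1
      gcongr
    have h6 : A * Real.exp (-δ * q.1) ≤ A * E := mul_le_mul_of_nonneg_left hq'.2 hA
    linarith
  have h2 : - (E * F * T) ≤ ∫ s in (0:ℝ)..T, Real.exp (-δ * s) * S.Fc (m s) := by
    have := intervalIntegral.norm_integral_le_of_norm_le_const (a := 0) (b := T) (C := E * F)
      (f := fun s => Real.exp (-δ * s) * S.Fc (m s)) (by
        intro s hs
        rw [uIoc_of_le hT] at hs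
        rw [norm_mul, Real.norm_eq_abs, Real.norm_eq_abs, abs_of_pos (Real.exp_pos _)]
        exact mul_le_mul (hbd s (Ioc_subset_Icc_self hs)).2 (hF _) (abs_nonneg _) hEp.le)
    rw [sub_zero, abs_of_nonneg hT] at this
    exact (abs_le.1 this).1
  linarith

theorem compactness (S : MFGSetting d) {T : ℝ} (hT : 0 ≤ T) {μk : ℕ → PTd d} {μ : PTd d}
    (hμ : Tendsto μk atTop (𝓝 μ)) (mk : ℕ → ℝ → PTd d) (αk : ℕ → ℝ → Td d → Vd d)
    (hadm : ∀ k, AdmOn S 1 (μk k) T (mk k) (αk k)) {δ₀ c₀ : ℝ}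
    (hJ : ∀ k, Jd S δ₀ (mk k) (αk k) T ≤ c₀) :
    ∃ ns : ℕ → ℕ, StrictMono ns ∧ ∃ m α, AdmOn S 1 μ T m α ∧
      (∀ s ∈ Icc 0 T, Tendsto (fun k => mk (ns k) s) atTop (𝓝 (m s))) ∧
      ∀ δ c, (∀ᶠ k in atTop, Jd S δ (mk (ns k)) (αk (ns k)) T ≤ c) → Jd S δ m α T ≤ c := by
  obtain ⟨K, hK⟩ := energy_bound S hT δ₀ c₀
  set nk : ℕ → ℝ → PTd d := fun k => clampT T (mk k) with hnk
  have hnc : ∀ k, Continuous (nk k) := fun k => clampT_cont hT (W1ContOn_iff.1 (hadm k).2.1)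
  have heq : ∀ k, ∀ s ∈ Icc 0 T, mk k s = nk k s := fun k s hs => (clampT_eq hs).symm
  have hα : ∀ k, Measurable (fun q : ℝ × Td d => αk k q.1 q.2) := fun k => (hadm k).2.2.2.1
  have hL : ∀ k, L2on (nk k) (αk k) T := fun k => L2on_congr (heq k) (fun _ _ => rfl) (hadm k).2.2.2.2.1
  have hFP : ∀ k, ∀ s₁ s₂ : ℝ, 0 ≤ s₁ → s₁ ≤ s₂ → s₂ ≤ T → FPeq 1 (nk k) (αk k) s₁ s₂ :=
    fun k s₁ s₂ h1 h12 h2 => FPeq_congr h12 (fun s hs => heq k s ⟨h1.trans hs.1, hs.2.trans h2⟩)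
      (fun _ _ => rfl) ((hadm k).2.2.1 s₁ s₂ h1 h12 h2)
  have hJ' : ∀ δ k, Jd S δ (mk k) (αk k) T = Jd S δ (nk k) (αk k) T := fun δ k =>
    Jd_congr S hT (heq k) (fun _ _ => rfl) δ
  have hen : ∀ k, ∫ q, sqnorm (αk k q.1 q.2) ∂(stMeas (nk k) (hnc k) T) ≤ K := fun k =>
    hK _ (hnc k) _ (hα k) (hL k) (by rw [← hJ']; exact hJ k)
  obtain ⟨ns, m, hns, hmc, hlim⟩ := curves_subseq nk (by
    intro f hf ε hε
    obtain ⟨η, hη, h⟩ := FP_equi hf T K 1 hε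
    refine ⟨η, hη, ?_⟩
    have key : ∀ n s r, s ≤ r → |s - r| ≤ η → |(∫ y, f y ∂(nk n s : Measure (Td d))) -
        ∫ y, f y ∂(nk n r : Measure (Td d))| ≤ ε := by
      intro n s r hsr hd
      have e : ∀ s, nk n s = nk n (max 0 (min s T)) := fun s => by
        rw [← heq n _ (clamp_mem hT s)]; rfl
      rw [e s, e r, abs_sub_comm]
      refine h (nk n) (hnc n) (αk n) (hα n) (hL n) (hen n) (hFP n) _ _ (clamp_mem hT s).1 ?_ (clamp_mem hT r).2 ?_
      · exact max_le_max le_rfl (min_le_min hsr le_rfl)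
      · have h1 : r - s ≤ η := by rw [abs_sub_comm] at hd; exact (le_abs_self _).trans hd
        rcases le_total s T with h3 | h3 <;> rcases le_total r T with h4 | h4 <;>
        rcases le_total 0 s with h5 | h5 <;> rcases le_total 0 r with h6 | h6 <;>
        simp only [min_eq_left, min_eq_right, max_eq_left, max_eq_right, *] <;> linarith
    intro n s r hd
    rcases le_total s r with h1 | h1
    · exact key n s r h1 hd
    · rw [abs_sub_comm]
      exact key n r s h1 (by rw [abs_sub_comm]; exact hd))
  have hwl := fun i : Fin d => weak_limit (fun k => hnc (ns k)) hmc hT hlim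
    (fun k q => αk (ns k) q.1 q.2 i) (fun k => comp_memLp (hnc (ns k)) (hα (ns k)) (hL (ns k)) i) (K := K)
    (fun k => (integral_mono (comp_memLp (hnc (ns k)) (hα (ns k)) (hL (ns k)) i).integrable_sq
      (sqnorm_integrable (hnc (ns k)) (hα (ns k)) (hL (ns k))) (fun q => sq_le_sqnorm _ i)).trans (hen (ns k)))
  choose b hbm hbL hbw using hwl
  set α : ℝ → Td d → Vd d := fun s y i => b i (s, y) with hαd
  have hαm : Measurable (fun q : ℝ × Td d => α q.1 q.2) := measurable_pi_lambda _ fun i => hbm i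
  have hαL : L2on m α T := by
    unfold L2on
    have hmeas : Measurable (fun q : ℝ × Td d => sqnorm (α q.1 q.2)) := measurable_sqnorm.comp hαm
    rw [← stMeas_lintegral hmc (f := fun q => ENNReal.ofReal (sqnorm (α q.1 q.2))) hmeas.ennreal_ofReal]
    have : Integrable (fun q : ℝ × Td d => sqnorm (α q.1 q.2)) (stMeas m hmc T) :=
      integrable_finsetSum _ fun i _ => (hbL i).integrable_sq
    exact (hasFiniteIntegral_iff_ofReal (ae_of_all _ fun q => sqnorm_nonneg _)).1 this.2
  refine ⟨ns, hns, m, α, AdmOn_of S hmc hT ?_ ?_ hαm hαL, ?_, ?_⟩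
  · refine tendsto_nhds_unique (hlim 0) ?_
    refine (hμ.comp hns.tendsto_atTop).congr fun k => ?_
    rw [← heq _ 0 ⟨le_rfl, hT⟩]
    exact (hadm _).1.symm
  · intro s₁ s₂ h1 h12 h2 φ hφ
    have split : ∀ (m : ℝ → PTd d) (hm : Continuous m) (α : ℝ → Td d → Vd d),
        Measurable (fun q : ℝ × Td d => α q.1 q.2) → L2on m α T →
        ∫ s in s₁..s₂, ∫ y, fpI 1 α φ (s, y) ∂(m s : Measure (Td d)) =
        (∫ q, indw s₁ s₂ q * fpa 1 φ q ∂(stMeas m hm T)) -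
        ∑ i, ∫ q, α q.1 q.2 i * (indw s₁ s₂ q * gradv (φ q.1) (secT q.2) i) ∂(stMeas m hm T) := by
      intro m hm α hα hL
      rw [stMeas_integral_sub hm (fpI_integrable hm hφ 1 hα hL) h1 h12 h2]
      have hi : ∀ i, Integrable (fun q : ℝ × Td d => α q.1 q.2 i *
          (indw s₁ s₂ q * gradv (φ q.1) (secT q.2) i)) (stMeas m hm T) := by
        intro i
        obtain ⟨k1, ⟨C, hC⟩, -⟩ := clsA_mul (T := T) (clsA_indw s₁ s₂) (clsA_cont (gradv_cont_lift hφ i))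
        exact comp_mul_integrable hm hα hL i k1 hC
      rw [← integral_finsetSum _ fun i _ => hi i, ← integral_sub
        (clsA_integrable hm (clsA_mul (clsA_indw s₁ s₂) (clsA_cont (fpa_cont hφ 1))))
        (integrable_finsetSum _ fun i _ => hi i)]
      refine integral_congr_ae (ae_of_all _ fun q => ?_)
      simp only [fpI_eq, mul_sub, Finset.mul_sum]
      congr 1
      exact Finset.sum_congr rfl fun i _ => by ring
    change _ = ∫ s in s₁..s₂, ∫ y, fpI 1 α φ (s, y) ∂(m s : Measure (Td d))
    have hcφ : ∀ s, Continuous fun y => φ s (secT y) := fun s => by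
      exact (test_cont_lift hφ).comp (Continuous.prodMk_right s)
    have hl : Tendsto (fun k => (∫ y, φ s₂ (secT y) ∂(nk (ns k) s₂ : Measure (Td d))) -
      (∫ y, φ s₁ (secT y) ∂(nk (ns k) s₁ : Measure (Td d)))) (hyperfilter ℕ)
      (𝓝 ((∫ y, φ s₂ (secT y) ∂(m s₂ : Measure (Td d))) -
      (∫ y, φ s₁ (secT y) ∂(m s₁ : Measure (Td d))))) :=
      ((weak_tendsto_cont (hlim s₂) (hcφ s₂)).sub (weak_tendsto_cont (hlim s₁) (hcφ s₁))).mono_left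
        Nat.hyperfilter_le_atTop
    refine tendsto_nhds_unique hl ?_
    have e : ∀ k, (∫ y, φ s₂ (secT y) ∂(nk (ns k) s₂ : Measure (Td d))) -
      (∫ y, φ s₁ (secT y) ∂(nk (ns k) s₁ : Measure (Td d))) =
        ∫ s in s₁..s₂, ∫ y, fpI 1 (αk (ns k)) φ (s, y) ∂(nk (ns k) s : Measure (Td d)) := fun k =>
      hFP (ns k) s₁ s₂ h1 h12 h2 φ hφ
    simp_rw [e, fun k => split (nk (ns k)) (hnc (ns k)) (αk (ns k)) (hα (ns k)) (hL (ns k))]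
    rw [split m hmc α hαm hαL]
    refine Tendsto.sub ?_ (tendsto_finsetSum _ fun i _ => hbw i _
      (clsA_mul (clsA_indw s₁ s₂) (clsA_cont (gradv_cont_lift hφ i))))
    exact (clsA_tendsto (fun k => hnc (ns k)) hmc hT hlim
      (clsA_mul (clsA_indw s₁ s₂) (clsA_cont (fpa_cont hφ 1)))).mono_left Nat.hyperfilter_le_atTop
  · intro s hs
    simp_rw [fun k => heq (ns k) s hs]
    exact hlim s
  · intro δ c hc
    simp_rw [hJ'] at hc
    exact lsc_core S (fun k => hnc (ns k)) hmc hT hlim (fun k => hα (ns k)) (fun k => hL (ns k)) hαm hαL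
      (fun i ψ hψ => hbw i ψ hψ) δ c hc

end compact2


section gauss
variable {d : ℕ}

/-- unnormalized gaussian -/
def gz (c : ℝ) (z : Vd d) : ℝ := ∏ i, Real.exp (-c * (z i)^2)

lemma gz_pos (c : ℝ) (z : Vd d) : 0 < gz c z := Finset.prod_pos fun _ _ => Real.exp_pos _

lemma gz_integrable {c : ℝ} (hc : 0 < c) : Integrable (gz (d := d) c) := by
  have := Integrable.fintype_prod (ι := Fin d) (f := fun _ (x : ℝ) => Real.exp (-c * x^2))
    (μ := fun _ => volume) (fun _ => integrable_exp_neg_mul_sq hc)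
  exact this

lemma gz_eq (c : ℝ) (z : Vd d) : gz c z = Real.exp (-c * sqnorm z) := by
  unfold gz sqnorm
  rw [← Real.exp_sum, Finset.mul_sum]

lemma gz_cont (c : ℝ) : Continuous (gz (d := d) c) := by
  unfold gz; fun_prop

lemma gz_mul_bound (z : Vd d) (i : Fin d) : |z i * gz (1/2) z| ≤ gz (1/4) z := by
  rw [gz_eq, gz_eq, abs_mul, abs_of_pos (Real.exp_pos _)]
  have h1 : Real.exp (-(1/4) * sqnorm z) = Real.exp (1/4 * sqnorm z) * Real.exp (-(1/2) * sqnorm z) := by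
    rw [← Real.exp_add]; congr 1; ring
  rw [h1]
  gcongr
  have h2 := Real.add_one_le_exp (1/4 * sqnorm z)
  have h3 := sq_le_sqnorm z i
  have h4 : |z i| ≤ 1/4 * (z i)^2 + 1 := by
    have := sq_nonneg (|z i| / 2 - 1)
    have h5 := sq_abs (z i)
    nlinarith
  linarith

lemma gz_mul_integrable (i : Fin d) : Integrable (fun z : Vd d => z i * gz (1/2) z) := by
  refine (gz_integrable (d := d) (c := 1/4) (by norm_num)).mono'
    (((continuous_apply i).mul (gz_cont _)).aestronglyMeasurable) (ae_of_all _ fun z => ?_)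
  rw [Real.norm_eq_abs]
  exact gz_mul_bound z i

lemma gz_hasFDerivAt (z : Vd d) (i : Fin d) : fderiv ℝ (gz (d := d) (1/2)) z (Pi.single i 1) =
    - (z i * gz (1/2) z) := by
  have e : (gz (d := d) (1/2)) = fun z => Real.exp (-(1/2) * ∑ j, (z j)^2) := by
    funext z; exact gz_eq _ _
  have h1 : HasFDerivAt (gz (d := d) (1/2)) (Real.exp (-(1/2) * ∑ j, (z j)^2) •
      (-(1/2:ℝ)) • ∑ j, ((2:ℕ) * (z j)^1) • (ContinuousLinearMap.proj (R := ℝ) (φ := fun _ : Fin d => ℝ) j)) z := by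
    rw [e]
    refine HasFDerivAt.exp (HasFDerivAt.const_mul (HasFDerivAt.fun_sum fun j _ => ?_) _)
    have := (ContinuousLinearMap.proj (R := ℝ) (φ := fun _ : Fin d => ℝ) j).hasFDerivAt (x := z)
    simpa using this.pow 2
  rw [h1.fderiv, gz_eq]
  simp [Pi.single_apply, sqnorm]
  ring

/-- gaussian law -/
def gam (d : ℕ) : Measure (Vd d) :=
  volume.withDensity fun z => ENNReal.ofReal ((∫ w : Vd d, gz (1/2) w)⁻¹ * gz (1/2) z)

lemma gzI_pos : 0 < ∫ w : Vd d, gz (1/2) w := by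
  rw [integral_pos_iff_support_of_nonneg (fun z => (gz_pos _ z).le) (gz_integrable (by norm_num))]
  have : Function.support (gz (d := d) (1/2)) = univ := by
    ext z
    simp only [Function.mem_support, mem_univ, iff_true, ne_eq]
    exact (gz_pos _ z).ne'
  rw [this]
  exact Measure.measure_univ_pos.2 (NeZero.ne _)

instance : IsProbabilityMeasure (gam d) := by
  constructor
  rw [gam, withDensity_apply _ MeasurableSet.univ, Measure.restrict_univ,
    ← ofReal_integral_eq_lintegral_ofReal ((gz_integrable (by norm_num)).const_mul _)
      (ae_of_all _ fun z => mul_nonneg (inv_nonneg.2 gzI_pos.le) (gz_pos _ z).le),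
    integral_const_mul, inv_mul_cancel₀ gzI_pos.ne', ENNReal.ofReal_one]

lemma gam_meas : Measurable fun z : Vd d => ENNReal.ofReal ((∫ w : Vd d, gz (1/2) w)⁻¹ * gz (1/2) z) :=
  (measurable_const.mul (gz_cont _).measurable).ennreal_ofReal

lemma gam_integral (f : Vd d → ℝ) :
    ∫ z, f z ∂(gam d) = (∫ w : Vd d, gz (1/2) w)⁻¹ * ∫ z, f z * gz (1/2) z := by
  rw [gam, integral_withDensity_eq_integral_toReal_smul gam_meas (by simp), ← integral_const_mul]
  congr 1
  funext z
  rw [ENNReal.toReal_ofReal (mul_nonneg (inv_nonneg.2 gzI_pos.le) (gz_pos _ z).le), smul_eq_mul]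
  ring

lemma gam_int (i : Fin d) : Integrable (fun z : Vd d => z i) (gam d) := by
  rw [gam, integrable_withDensity_iff gam_meas (by simp)]
  refine ((gz_mul_integrable i).const_mul (∫ w : Vd d, gz (1/2) w)⁻¹).congr (ae_of_all _ fun z => ?_)
  dsimp only
  rw [ENNReal.toReal_ofReal (mul_nonneg (inv_nonneg.2 gzI_pos.le) (gz_pos _ z).le)]
  ring

lemma stein {f : Vd d → ℝ} (hf : ContDiff ℝ 1 f) {C : ℝ} (i : Fin d) (h0 : ∀ z, |f z| ≤ C)
    (h1 : ∀ z, |fderiv ℝ f z (Pi.single i 1)| ≤ C) :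
    ∫ z, z i * f z ∂(gam d) = ∫ z, fderiv ℝ f z (Pi.single i 1) ∂(gam d) := by
  rw [gam_integral, gam_integral]
  congr 1
  have hfc := hf.continuous
  have hf' : Continuous fun z => fderiv ℝ f z (Pi.single i 1) :=
    (hf.continuous_fderiv (by norm_num)).clm_apply continuous_const
  have a1 : Integrable (fun z : Vd d => fderiv ℝ f z (Pi.single i 1) * gz (1/2) z) :=
    (gz_integrable (by norm_num)).bdd_mul hf'.aestronglyMeasurable (ae_of_all _ h1)
  have a2 : Integrable (fun z : Vd d => f z * fderiv ℝ (gz (d := d) (1/2)) z (Pi.single i 1)) := by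
    simp only [gz_hasFDerivAt]
    exact (gz_mul_integrable i).neg.bdd_mul hfc.aestronglyMeasurable (ae_of_all _ h0)
  have a3 : Integrable (fun z : Vd d => f z * gz (1/2) z) :=
    (gz_integrable (by norm_num)).bdd_mul hfc.aestronglyMeasurable (ae_of_all _ h0)
  have := integral_mul_fderiv_eq_neg_fderiv_mul_of_integrable (μ := (volume : Measure (Vd d))) a1 a2 a3
    (fun x _ => hf.differentiable (by norm_num) x)
    (fun x _ => by
      have : Differentiable ℝ (gz (d := d) (1/2)) := by unfold gz; fun_prop
      exact this x)
  simp only [gz_hasFDerivAt] at this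
  rw [← neg_eq_iff_eq_neg] at this
  rw [← this, ← integral_neg]
  congr 1; funext z; ring

end gauss


section heat
variable {d : ℕ}

def hX (s : ℝ) (q : Td d × Vd d) : Vd d := secT q.1 + √(2 * s) • q.2

lemma hX_meas (s : ℝ) : Measurable (hX (d := d) s) := by
  unfold hX
  have := measurable_secT (d := d)
  fun_prop

lemma hX_meas2 : Measurable (fun p : ℝ × (Td d × Vd d) => hX p.1 p.2) := by
  unfold hX
  have := measurable_secT (d := d)
  fun_prop

def heatM (μ : PTd d) (s : ℝ) : PTd d :=
  ⟨((μ : Measure (Td d)).prod (gam d)).map (fun q => piT (hX s q)),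
    Measure.isProbabilityMeasure_map (piT_cont.measurable.comp (hX_meas s)).aemeasurable⟩

lemma heat_integral (μ : PTd d) (s : ℝ) {f : Td d → ℝ} (hf : Continuous f) :
    ∫ y, f y ∂(heatM μ s : Measure (Td d)) = ∫ q, f (piT (hX s q)) ∂((μ : Measure (Td d)).prod (gam d)) := by
  change ∫ y, f y ∂(((μ : Measure (Td d)).prod (gam d)).map (fun q => piT (hX s q))) = _
  exact integral_map (piT_cont.measurable.comp (hX_meas s)).aemeasurable hf.aestronglyMeasurable

lemma heat_cont (μ : PTd d) : Continuous (heatM μ) := by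
  rw [continuous_iff_continuousAt]
  intro s
  refine (ProbabilityMeasure.tendsto_iff_forall_integral_tendsto).2 fun f => ?_
  simp only [heat_integral μ _ f.continuous]
  refine Continuous.tendsto (f := fun s => ∫ q, f (piT (hX s q)) ∂((μ : Measure (Td d)).prod (gam d))) ?_ s
  refine continuous_of_dominated (bound := fun _ => ‖f‖) ?_ ?_ (integrable_const _) ?_
  · intro s
    exact (f.continuous.measurable.comp (piT_cont.measurable.comp (hX_meas s))).aestronglyMeasurable
  · intro s
    exact ae_of_all _ fun q => f.norm_coe_le_norm _
  · refine ae_of_all _ fun q => f.continuous.comp (piT_cont.comp ?_)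
    unfold hX
    fun_prop

lemma heat_zero (μ : PTd d) : heatM μ 0 = μ := by
  apply Subtype.ext
  change ((μ : Measure (Td d)).prod (gam d)).map (fun q => piT (hX 0 q)) = _
  have : (fun q : Td d × Vd d => piT (hX 0 q)) = Prod.fst := by
    funext q
    simp [hX, piT_secT]
  rw [this, Measure.map_fst_prod]
  simp

lemma isqrt_int (T : ℝ) : IntegrableOn (fun s : ℝ => (√(2 * s))⁻¹) (Ioc 0 T) := by
  rcases le_total T 0 with h | h
  · rw [Ioc_eq_empty_of_le h]; exact integrableOn_empty
  have := (intervalIntegral.intervalIntegrable_rpow' (a := 0) (b := T) (r := -1/2) (by norm_num)).const_mul (√2)⁻¹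
  rw [intervalIntegrable_iff_integrableOn_Ioc_of_le h] at this
  refine this.congr_fun (fun s hs => ?_) measurableSet_Ioc
  dsimp only
  rw [Real.sqrt_mul (by norm_num), mul_inv, Real.sqrt_eq_rpow s, ← Real.rpow_neg hs.1.le]
  norm_num

lemma total_deriv {φ : ℝ → Vd d → ℝ} (h : IsTestFun φ) {X : ℝ → Vd d} {v : Vd d} {s : ℝ}
    (hX : HasDerivAt X v s) :
    HasDerivAt (fun s => φ s (X s)) (tderiv φ s (X s) + ∑ i, v i * gradv (φ s) (X s) i) s := by
  have hd : DifferentiableAt ℝ (fun q : ℝ × Vd d => φ q.1 q.2) (s, X s) :=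
    h.1.differentiable (by norm_num) _
  have h1 : HasDerivAt (fun s => φ s (X s)) (fderiv ℝ (fun q : ℝ × Vd d => φ q.1 q.2) (s, X s) (1, v)) s :=
    hd.hasFDerivAt.comp_hasDerivAt (f := fun s => (s, X s)) s ((hasDerivAt_id s).prodMk hX)
  have h2 : tderiv φ s (X s) = fderiv ℝ (fun q : ℝ × Vd d => φ q.1 q.2) (s, X s) (1, 0) := by
    have : HasDerivAt (fun r => φ r (X s)) (fderiv ℝ (fun q : ℝ × Vd d => φ q.1 q.2) (s, X s) (1, 0)) s :=
      hd.hasFDerivAt.comp_hasDerivAt (f := fun r => (r, X s)) s ((hasDerivAt_id s).prodMk (hasDerivAt_const s (X s)))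
    exact this.deriv
  have h3 : ∀ w, fderiv ℝ (φ s) (X s) w = fderiv ℝ (fun q : ℝ × Vd d => φ q.1 q.2) (s, X s) (0, w) := by
    intro w
    have : HasFDerivAt (φ s) ((fderiv ℝ (fun q : ℝ × Vd d => φ q.1 q.2) (s, X s)).comp
        (ContinuousLinearMap.inr ℝ ℝ (Vd d))) (X s) :=
      hd.hasFDerivAt.comp (f := fun x => (s, x)) (X s) (hasFDerivAt_prodMk_right s (X s))
    rw [this.fderiv]
    simp
  have h4 : ∑ i, v i * gradv (φ s) (X s) i = fderiv ℝ (φ s) (X s) v := by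
    rw [clm_apply_decomp]
    rfl
  rw [h4, h2, h3, ← map_add]
  simpa using h1


def hD (φ : ℝ → Vd d → ℝ) (s : ℝ) (q : Td d × Vd d) : ℝ :=
  tderiv φ s (hX s q) + ∑ i, ((√(2 * s))⁻¹ * q.2 i) * gradv (φ s) (hX s q) i

lemma hD_meas {φ : ℝ → Vd d → ℝ} (h : IsTestFun φ) :
    Measurable (fun p : ℝ × (Td d × Vd d) => hD φ p.1 p.2) := by
  have hm : Measurable (fun p : ℝ × (Td d × Vd d) => (p.1, hX p.1 p.2)) :=
    measurable_fst.prodMk hX_meas2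
  have a : Measurable (fun p : ℝ × (Td d × Vd d) => tderiv φ p.1 (hX p.1 p.2)) :=
    (tderiv_cont h).measurable.comp hm
  have b : ∀ i, Measurable (fun p : ℝ × (Td d × Vd d) => gradv (φ p.1) (hX p.1 p.2) i) := fun i =>
    (gradv_contDiff h (Pi.single i 1)).continuous.measurable.comp hm
  unfold hD
  refine a.add (Finset.measurable_sum _ fun i _ => Measurable.mul ?_ (b i))
  fun_prop

lemma test_bounds {φ : ℝ → Vd d → ℝ} (h : IsTestFun φ) (T : ℝ) :
    ∃ C, 0 ≤ C ∧ ∀ s ∈ Icc 0 T, ∀ x, |φ s x| ≤ C ∧ |tderiv φ s x| ≤ C ∧ (∀ i, |gradv (φ s) x i| ≤ C) ∧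
      ∀ i, |D2 (φ s) x (Pi.single i 1) (Pi.single i 1)| ≤ C := by
  have key : ∀ f : ℝ → Vd d → ℝ, Continuous (fun q : ℝ × Vd d => f q.1 q.2) →
      (∀ t x (z : Fin d → ℤ), f t (x + intVec z) = f t x) →
      ∃ C, 0 ≤ C ∧ ∀ s ∈ Icc 0 T, ∀ x, |f s x| ≤ C := by
    intro f hf hp
    obtain ⟨C, hC, h⟩ := cont_bdd_on (cont_lift hf hp) T
    refine ⟨C, hC, fun s hs x => ?_⟩
    have := h s hs (piT x)
    dsimp only at this
    rwa [lift_piT (hp s)] at this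
  obtain ⟨C0, h00, h0⟩ := key φ h.1.continuous h.2
  obtain ⟨C1, h10, h1⟩ := key (tderiv φ) (tderiv_cont h) (fun t x z => by simp only [tderiv, h.2])
  have k2 := fun i : Fin d => key (fun s x => gradv (φ s) x i) (gradv_contDiff h (Pi.single i 1)).continuous
    (fun t x z => by simp only [gradv, fderiv_per (h.2 t)])
  have k3 := fun i : Fin d => key (fun s x => D2 (φ s) x (Pi.single i 1) (Pi.single i 1))
    (D2_cont h _ _) (fun t x z => by simp only [D2_per (h.2 t)])
  choose C2 h20 h2 using k2
  choose C3 h30 h3 using k3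
  have s2 : 0 ≤ ∑ i, C2 i := Finset.sum_nonneg fun i _ => h20 i
  have s3 : 0 ≤ ∑ i, C3 i := Finset.sum_nonneg fun i _ => h30 i
  refine ⟨C0 + C1 + ∑ i, C2 i + ∑ i, C3 i, by positivity, fun s hs x => ⟨?_, ?_, fun i => ?_, fun i => ?_⟩⟩
  · linarith [h0 s hs x]
  · linarith [h1 s hs x]
  · have := Finset.single_le_sum (fun i _ => h20 i) (Finset.mem_univ i)
    linarith [h2 i s hs x]
  · have := Finset.single_le_sum (fun i _ => h30 i) (Finset.mem_univ i)
    linarith [h3 i s hs x]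

lemma hD_bound {φ : ℝ → Vd d → ℝ} {C s : ℝ}
    (h1 : ∀ x, |tderiv φ s x| ≤ C) (h2 : ∀ x i, |gradv (φ s) x i| ≤ C) (q : Td d × Vd d) :
    |hD φ s q| ≤ C + C * ((√(2 * s))⁻¹ * ∑ i, |q.2 i|) := by
  unfold hD
  refine (abs_add_le _ _).trans (add_le_add (h1 _) ?_)
  refine (Finset.abs_sum_le_sum_abs _ _).trans ?_
  rw [Finset.mul_sum, Finset.mul_sum]
  refine Finset.sum_le_sum fun i _ => ?_
  rw [abs_mul, abs_mul, abs_of_nonneg (inv_nonneg.2 (Real.sqrt_nonneg _)), mul_comm]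
  exact mul_le_mul_of_nonneg_right (h2 _ i) (by positivity)

lemma hD_integrable (μ : PTd d) {φ : ℝ → Vd d → ℝ} (h : IsTestFun φ) {a b : ℝ} (ha : 0 ≤ a) :
    Integrable (fun p : ℝ × (Td d × Vd d) => hD φ p.1 p.2)
      ((volume.restrict (Ioc a b)).prod ((μ : Measure (Td d)).prod (gam d))) := by
  obtain ⟨C, hC, hb⟩ := test_bounds h b
  have i1 : Integrable (fun q : Td d × Vd d => ∑ i, |q.2 i|) ((μ : Measure (Td d)).prod (gam d)) := by
    refine integrable_finsetSum _ fun i _ => ?_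
    exact ((gam_int i).abs).comp_snd (μ : Measure (Td d))
  have i2 : Integrable (fun s : ℝ => (√(2 * s))⁻¹) (volume.restrict (Ioc a b)) :=
    (isqrt_int b).mono_set (Ioc_subset_Ioc_left ha)
  have i3 := ((i2.mul_prod i1).const_mul C)
  have i4 : Integrable (fun p : ℝ × (Td d × Vd d) => C + C * ((√(2 * p.1))⁻¹ * ∑ i, |p.2.2 i|))
      ((volume.restrict (Ioc a b)).prod ((μ : Measure (Td d)).prod (gam d))) :=
    (integrable_const C).add i3
  refine i4.mono' (hD_meas h).aestronglyMeasurable ?_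
  have hae : ∀ᵐ p ∂((volume.restrict (Ioc a b)).prod ((μ : Measure (Td d)).prod (gam d))), p.1 ∈ Ioc a b :=
    Measure.quasiMeasurePreserving_fst.ae (ae_restrict_mem measurableSet_Ioc)
  filter_upwards [hae] with p hp
  have hp' : p.1 ∈ Icc 0 b := ⟨ha.trans hp.1.le, hp.2⟩
  exact hD_bound (fun x => (hb _ hp' x).2.1) (fun x => (hb _ hp' x).2.2.1) p.2

lemma hD_ftc {φ : ℝ → Vd d → ℝ} (h : IsTestFun φ) {a b : ℝ} (ha : 0 ≤ a) (hab : a ≤ b) (q : Td d × Vd d) :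
    φ b (hX b q) - φ a (hX a q) = ∫ s in Ioc a b, hD φ s q := by
  obtain ⟨C, hC, hb⟩ := test_bounds h b
  rw [← intervalIntegral.integral_of_le hab]
  symm
  have hXc : Continuous fun s => hX s q := by unfold hX; fun_prop
  refine intervalIntegral.integral_eq_sub_of_hasDerivAt_of_le (f := fun s => φ s (hX s q)) hab ?_ ?_ ?_
  · exact (h.1.continuous.comp (continuous_id.prodMk hXc)).continuousOn
  · intro s hs
    have hs0 : 0 < s := ha.trans_lt hs.1
    have hd : HasDerivAt (fun s => hX s q) ((√(2 * s))⁻¹ • q.2) s := by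
      unfold hX
      have h2 : HasDerivAt (fun s : ℝ => √(2 * s)) ((√(2 * s))⁻¹) s := by
        have := ((hasDerivAt_id' s).const_mul 2).sqrt (by simp; exact hs0.ne')
        refine this.congr_deriv ?_
        symm
        change (√(2 * s))⁻¹ = 2 * 1 / (2 * √(2 * s))
        field_simp
      exact (h2.smul_const q.2).const_add _
    have := total_deriv h hd
    simpa [hD] using this
  · rw [intervalIntegrable_iff_integrableOn_Ioc_of_le hab]
    have i2 : Integrable (fun s : ℝ => C + C * ((√(2 * s))⁻¹ * ∑ i, |q.2 i|)) (volume.restrict (Ioc a b)) :=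
      (integrable_const C).add
        ((((isqrt_int b).mono_set (Ioc_subset_Ioc_left ha)).mul_const _).const_mul C)
    refine i2.mono' ((hD_meas h).comp (measurable_id.prodMk measurable_const)).aestronglyMeasurable ?_
    filter_upwards [ae_restrict_mem measurableSet_Ioc] with s hs
    have hp' : s ∈ Icc 0 b := ⟨ha.trans hs.1.le, hs.2⟩
    exact hD_bound (fun x => (hb _ hp' x).2.1) (fun x => (hb _ hp' x).2.2.1) q

lemma hD_stein (μ : PTd d) {φ : ℝ → Vd d → ℝ} (h : IsTestFun φ) {s : ℝ} (hs : 0 < s) :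
    ∫ q, hD φ s q ∂((μ : Measure (Td d)).prod (gam d)) =
      ∫ q, (tderiv φ s (hX s q) + lapl (φ s) (hX s q)) ∂((μ : Measure (Td d)).prod (gam d)) := by
  obtain ⟨C, hC, hb'⟩ := test_bounds h s
  have hb := hb' s ⟨hs.le, le_rfl⟩
  have hmX := hX_meas (d := d) s
  have hsec : Continuous fun x : Vd d => (s, x) := by fun_prop
  have b0 : Integrable (fun q => tderiv φ s (hX s q)) ((μ : Measure (Td d)).prod (gam d)) :=
    (integrable_const C).mono' (((tderiv_cont h).comp hsec).measurable.comp hmX).aestronglyMeasurable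
      (ae_of_all _ fun q => (hb _).2.1)
  have b1 : ∀ i, Integrable (fun q : Td d × Vd d => ((√(2 * s))⁻¹ * q.2 i) * gradv (φ s) (hX s q) i)
      ((μ : Measure (Td d)).prod (gam d)) := fun i => by
    have := ((gam_int i).comp_snd (μ : Measure (Td d))).const_mul (√(2 * s))⁻¹
    exact this.mul_bdd
      ((((gradv_contDiff h (Pi.single i 1)).continuous.comp hsec).measurable.comp hmX).aestronglyMeasurable)
      (ae_of_all _ fun q => (hb _).2.2.1 i)
  have b2 : ∀ i, Integrable (fun q : Td d × Vd d => D2 (φ s) (hX s q) (Pi.single i 1) (Pi.single i 1))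
      ((μ : Measure (Td d)).prod (gam d)) := fun i =>
    (integrable_const C).mono' (((D2_cont h (Pi.single i 1) (Pi.single i 1)).comp hsec).measurable.comp hmX).aestronglyMeasurable
      (ae_of_all _ fun q => (hb _).2.2.2 i)
  unfold hD lapl
  rw [integral_add b0 (integrable_finsetSum _ fun i _ => b1 i),
    integral_add b0 (integrable_finsetSum _ fun i _ => b2 i),
    integral_finsetSum _ fun i _ => b1 i, integral_finsetSum _ fun i _ => b2 i]
  congr 1
  refine Finset.sum_congr rfl fun i _ => ?_
  rw [integral_prod _ (b1 i), integral_prod _ (b2 i)]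
  congr 1
  funext y
  have hc : 0 < √(2 * s) := Real.sqrt_pos.2 (by linarith)
  set c := √(2 * s) with hcd
  have hg1 : ContDiff ℝ 1 (fun x => fderiv ℝ (φ s) x (Pi.single i 1)) :=
    (gradv_contDiff h (Pi.single i 1)).comp (f := fun x : Vd d => (s, x)) (by fun_prop)
  have hf1 : ContDiff ℝ 1 (fun z : Vd d => c⁻¹ * gradv (φ s) (hX s (y, z)) i) := by
    refine contDiff_const.mul (hg1.comp (f := fun z => hX s (y, z)) ?_)
    change ContDiff ℝ 1 fun z : Vd d => secT y + √(2 * s) • z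
    fun_prop
  have hfd : ∀ z, fderiv ℝ (fun z : Vd d => c⁻¹ * gradv (φ s) (hX s (y, z)) i) z (Pi.single i 1) =
      D2 (φ s) (hX s (y, z)) (Pi.single i 1) (Pi.single i 1) := by
    intro z
    have hX' : HasFDerivAt (fun z => hX s (y, z)) (c • ContinuousLinearMap.id ℝ (Vd d)) z := by
      change HasFDerivAt (fun z : Vd d => secT y + c • z) _ z
      exact HasFDerivAt.const_add _ ((hasFDerivAt_id z).const_smul c)
    have h1 : HasFDerivAt (fun x => fderiv ℝ (φ s) x (Pi.single i 1))
        (fderiv ℝ (fun x => fderiv ℝ (φ s) x (Pi.single i 1)) (hX s (y, z))) (hX s (y, z)) :=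
      (hg1.differentiable (by norm_num) _).hasFDerivAt
    have h2 : HasFDerivAt (fun z : Vd d => c⁻¹ * gradv (φ s) (hX s (y, z)) i) _ z :=
      (h1.comp z hX').const_mul c⁻¹
    rw [h2.fderiv]
    simp only [D2, smul_apply, ContinuousLinearMap.comp_apply,
      ContinuousLinearMap.id_apply, map_smul, smul_eq_mul]
    field_simp
  have := stein hf1 (C := c⁻¹ * C + C) i (fun z => by
      rw [abs_mul, abs_of_pos (inv_pos.2 hc)]
      have := (hb (hX s (y, z))).2.2.1 i
      have := mul_le_mul_of_nonneg_left this (inv_pos.2 hc).le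
      linarith) (fun z => by
      rw [hfd]
      have := (hb (hX s (y, z))).2.2.2 i
      have : 0 ≤ c⁻¹ * C := by positivity
      linarith)
  simp only [hfd] at this
  rw [← this]
  congr 1; funext z; ring

lemma heat_FP (μ : PTd d) {a b : ℝ} (ha : 0 ≤ a) (hab : a ≤ b) :
    FPeq 1 (heatM μ) (fun _ _ => 0) a b := by
  intro φ h
  have e0 : ∀ s, ∫ y, φ s (secT y) ∂(heatM μ s : Measure (Td d)) =
      ∫ q, φ s (hX s q) ∂((μ : Measure (Td d)).prod (gam d)) := by
    intro s
    have hc : Continuous fun y => φ s (secT y) := (test_cont_lift h).comp (by fun_prop : Continuous fun y : Td d => (s, y))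
    rw [heat_integral μ s hc]
    congr 1; funext q
    exact lift_piT (h.2 s) _
  have e1 : ∀ s, ∫ y, (tderiv φ s (secT y) + 1 * lapl (φ s) (secT y)
        - dotp (0 : Vd d) (gradv (φ s) (secT y))) ∂(heatM μ s : Measure (Td d)) =
      ∫ q, (tderiv φ s (hX s q) + lapl (φ s) (hX s q)) ∂((μ : Measure (Td d)).prod (gam d)) := by
    intro s
    have hc : Continuous fun y : Td d => fpa 1 φ (s, y) := (fpa_cont h 1).comp (by fun_prop : Continuous fun y : Td d => (s, y))
    have := heat_integral μ s hc
    simp only [fpa, one_mul] at this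
    simp only [dotp, Pi.zero_apply, zero_mul, Finset.sum_const_zero, sub_zero, one_mul]
    rw [this]
    congr 1; funext q
    exact lift_piT (g := fun x => tderiv φ s x + lapl (φ s) x)
      (fun x z => by simp only [tderiv, lapl, h.2, D2_per (h.2 s)]) _
  have hi : ∀ s, 0 ≤ s → Integrable (fun q => φ s (hX s q)) ((μ : Measure (Td d)).prod (gam d)) := fun s hs => by
    obtain ⟨C, hC, hb⟩ := test_bounds h s
    exact (integrable_const C).mono' ((h.1.continuous.comp (by fun_prop : Continuous fun x : Vd d => (s, x))).measurable.comp (hX_meas s)).aestronglyMeasurable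
      (ae_of_all _ fun q => (hb s ⟨hs, le_rfl⟩ _).1)
  simp only [e0]
  rw [← integral_sub (hi b (ha.trans hab)) (hi a ha)]
  simp only [hD_ftc h ha hab]
  rw [intervalIntegral.integral_of_le hab]
  have hsw := integral_integral_swap (f := fun s q => hD φ s q) (hD_integrable μ h (b := b) ha)
  rw [← hsw]
  refine setIntegral_congr_fun measurableSet_Ioc fun s hs => ?_
  exact (hD_stein μ h (ha.trans_lt hs.1)).trans (e1 s).symm

end heat


section shift

lemma pre_add_Ioi (t : ℝ) : (fun s : ℝ => s + t) ⁻¹' Ioi t = Ioi 0 := by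
  ext s; simp

lemma shift_lint (f : ℝ → ENNReal) (t : ℝ) : ∫⁻ s in Ioi t, f s = ∫⁻ s in Ioi (0:ℝ), f (s + t) := by
  rw [← pre_add_Ioi t]
  exact ((measurePreserving_add_right volume t).setLIntegral_comp_preimage_emb
    (measurableEmbedding_addRight t) f (Ioi t)).symm

lemma shift_int (f : ℝ → ℝ) (t : ℝ) : ∫ s in Ioi t, f s = ∫ s in Ioi (0:ℝ), f (s + t) := by
  rw [← pre_add_Ioi t]
  exact ((measurePreserving_add_right volume t).setIntegral_preimage_emb
    (measurableEmbedding_addRight t) f (Ioi t)).symm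

lemma shift_integrable (f : ℝ → ℝ) (t : ℝ) : IntegrableOn f (Ioi t) ↔
    IntegrableOn (fun s => f (s + t)) (Ioi 0) := by
  rw [← pre_add_Ioi t]
  exact ((measurePreserving_add_right volume t).integrableOn_comp_preimage
    (measurableEmbedding_addRight t)).symm

lemma split_Ioi {t : ℝ} (ht : 0 ≤ t) : Ioc 0 t ∪ Ioi t = Ioi (0:ℝ) := Ioc_union_Ioi_eq_Ioi ht

lemma disc_Icc (t : ℝ) : Disjoint (Ioc 0 t) (Ioi t) := Set.disjoint_left.2 fun _ h h' => not_lt.2 h.2 h'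

end shift

section disc
variable {d : ℕ}

lemma rc_bounds (S : MFGSetting d) : ∃ K, 0 < K ∧ (∀ m α s, -K ≤ runCost S m α s) ∧
    ∀ m s, runCost S m (fun _ _ => 0) s ≤ K := by
  obtain ⟨A, b, B, hA, hb, hB, hq⟩ := Hstar_quad S
  obtain ⟨F, hF⟩ := S.Fc_bounded
  have hF0 : 0 ≤ F := (abs_nonneg _).trans (hF (⟨Measure.dirac 0, inferInstance⟩ : PTd d))
  have cst : ∀ (μ : PTd d) (c : ℝ), ∫ _, c ∂(μ : Measure (Td d)) = c := fun μ c => by simp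
  refine ⟨A + F + 1, by linarith, fun m α s => ?_, fun m s => ?_⟩
  · have h1 : -A ≤ ∫ y, S.Hstar (secT y) (α s y) ∂(m s : Measure (Td d)) := by
      by_cases hi : Integrable (fun y => S.Hstar (secT y) (α s y)) (m s : Measure (Td d))
      · rw [← cst (m s) (-A)]
        refine integral_mono (integrable_const _) hi fun y => ?_
        have := (hq (secT y) (α s y)).1
        have h3 := mul_nonneg hb.le (sqnorm_nonneg (α s y))
        dsimp only
        linarith
      · rw [integral_undef hi]; linarith
    have h2 := (abs_le.1 (hF (m s))).1
    unfold runCost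
    linarith
  · have h1 : ∫ y, S.Hstar (secT y) (0 : Vd d) ∂(m s : Measure (Td d)) ≤ A := by
      by_cases hi : Integrable (fun y => S.Hstar (secT y) (0 : Vd d)) (m s : Measure (Td d))
      · rw [← cst (m s) A]
        refine integral_mono hi (integrable_const _) fun y => ?_
        have := (hq (secT y) 0).2
        dsimp only
        simpa [sqnorm] using this
      · rw [integral_undef hi]; linarith
    have h2 := (abs_le.1 (hF (m s))).2
    unfold runCost
    linarith

lemma FPeq_shift {m : ℝ → PTd d} {α : ℝ → Td d → Vd d} {σ s₁ s₂ : ℝ} (t : ℝ)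
    (h : FPeq σ m α s₁ s₂) :
    FPeq σ (fun s => m (s + t)) (fun s => α (s + t)) (s₁ - t) (s₂ - t) := by
  intro φ hφ
  have := h (fun s => φ (s + (-t))) (test_shift hφ (-t))
  have e : ∀ s : ℝ, s + -t = s - t := fun s => by ring
  simp only [e] at this
  simp only [sub_add_cancel]
  rw [this]
  rw [← intervalIntegral.integral_comp_sub_right (a := s₁) (b := s₂) _ t]
  refine intervalIntegral.integral_congr fun s _ => ?_
  simp only [sub_add_cancel]
  congr 1
  funext y
  congr 2
  simp only [tderiv]
  exact (deriv_comp_sub_const (f := fun s => φ s (secT y)) t s)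


lemma FPeq_trans {m : ℝ → PTd d} (hm : Continuous m) {α : ℝ → Td d → Vd d} {s₁ s₂ s₃ : ℝ}
    (h0 : 0 ≤ s₁) (h12 : s₁ ≤ s₂) (h23 : s₂ ≤ s₃)
    (hα : Measurable (fun q : ℝ × Td d => α q.1 q.2)) (hL : L2on m α s₃)
    (h : FPeq 1 m α s₁ s₂) (h' : FPeq 1 m α s₂ s₃) : FPeq 1 m α s₁ s₃ := by
  intro φ hφ
  have hi := fpI_intervalIntegrable hm (h0.trans (h12.trans h23)) hφ 1 hα hL
  have i1 : IntervalIntegrable (fun s => ∫ y, fpI 1 α φ (s, y) ∂(m s : Measure (Td d))) volume s₁ s₂ := by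
    refine hi.mono_set ?_
    rw [uIcc_of_le h12, uIcc_of_le (h0.trans (h12.trans h23))]
    exact Icc_subset_Icc h0 h23
  have i2 : IntervalIntegrable (fun s => ∫ y, fpI 1 α φ (s, y) ∂(m s : Measure (Td d))) volume s₂ s₃ := by
    refine hi.mono_set ?_
    rw [uIcc_of_le h23, uIcc_of_le (h0.trans (h12.trans h23))]
    exact Icc_subset_Icc (h0.trans h12) le_rfl
  have e := intervalIntegral.integral_add_adjacent_intervals i1 i2
  have e1 := h φ hφ
  have e2 := h' φ hφ
  simp only [fpI] at e
  rw [← e, ← e1, ← e2]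
  ring

def catM (t : ℝ) (m m' : ℝ → PTd d) (s : ℝ) : PTd d :=
  if s ≤ t then clampT t m s else m' (max 0 (s - t))

def catA (t : ℝ) (α α' : ℝ → Td d → Vd d) (s : ℝ) : Td d → Vd d :=
  if s ≤ t then α s else α' (s - t)

lemma catM_le {t : ℝ} {m m' : ℝ → PTd d} {s : ℝ} (h0 : 0 ≤ s) (h : s ≤ t) : catM t m m' s = m s := by
  rw [catM, if_pos h, clampT_eq ⟨h0, h⟩]

lemma catM_ge {t : ℝ} (ht : 0 ≤ t) {m m' : ℝ → PTd d} (h0 : m' 0 = m t) {s : ℝ} (h : t ≤ s) :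
    catM t m m' s = m' (s - t) := by
  rcases h.eq_or_lt with h | h
  · subst h
    rw [catM_le ht le_rfl, sub_self, h0]
  · rw [catM, if_neg (not_le.2 h), max_eq_right (by linarith)]

lemma catA_le {t : ℝ} {α α' : ℝ → Td d → Vd d} {s : ℝ} (h : s ≤ t) : catA t α α' s = α s := if_pos h

lemma catA_gt {t : ℝ} {α α' : ℝ → Td d → Vd d} {s : ℝ} (h : t < s) : catA t α α' s = α' (s - t) :=
  if_neg (not_le.2 h)

lemma catM_cont {t : ℝ} (ht : 0 ≤ t) {m m' : ℝ → PTd d} (h0 : m' 0 = m t)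
    (hm : ContinuousOn m (Icc 0 t)) (hm' : ContinuousOn m' (Ici 0)) : Continuous (catM t m m') := by
  unfold catM
  have h1 : Continuous fun s : ℝ => m' (max 0 (s - t)) :=
    hm'.comp_continuous (by fun_prop) (fun s => mem_Ici.2 (le_max_left _ _))
  refine Continuous.if_le (clampT_cont ht hm) h1 continuous_id continuous_const ?_
  intro s hs
  have hs : s = t := hs
  subst hs
  rw [clampT_eq ⟨ht, le_rfl⟩, sub_self, max_self, h0]

lemma catA_meas {t : ℝ} {α α' : ℝ → Td d → Vd d} (hα : Measurable (fun q : ℝ × Td d => α q.1 q.2))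
    (hα' : Measurable (fun q : ℝ × Td d => α' q.1 q.2)) :
    Measurable (fun q : ℝ × Td d => catA t α α' q.1 q.2) := by
  have e : (fun q : ℝ × Td d => catA t α α' q.1 q.2) =
      fun q => if q.1 ≤ t then α q.1 q.2 else α' (q.1 - t) q.2 := by
    funext q
    unfold catA
    split_ifs <;> rfl
  rw [e]
  refine Measurable.ite (measurableSet_le measurable_fst measurable_const) hα ?_
  exact hα'.comp (f := fun q : ℝ × Td d => (q.1 - t, q.2)) (by fun_prop)

def wL2 (δ : ℝ) (m : ℝ → PTd d) (α : ℝ → Td d → Vd d) (s : ℝ) : ENNReal :=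
  ENNReal.ofReal (Real.exp (-δ * s)) * ∫⁻ y, ENNReal.ofReal (sqnorm (α s y)) ∂(m s : Measure (Td d))

lemma wL2_shift (δ t : ℝ) (m : ℝ → PTd d) (α : ℝ → Td d → Vd d) (s : ℝ) :
    wL2 δ m α (s + t) = ENNReal.ofReal (Real.exp (-δ * t)) *
      wL2 δ (fun s => m (s + t)) (fun s => α (s + t)) s := by
  unfold wL2
  rw [← mul_assoc, ← ENNReal.ofReal_mul (Real.exp_pos _).le, ← Real.exp_add]
  congr 4
  ring

lemma wL2_congr {δ s : ℝ} {m m' : ℝ → PTd d} {α α' : ℝ → Td d → Vd d} (h : m s = m' s) (h' : α s = α' s) :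
    wL2 δ m α s = wL2 δ m' α' s := by
  simp only [wL2, h, h']

lemma L2on_of_wL2 {δ T : ℝ} (hδ : 0 < δ) {m : ℝ → PTd d} {α : ℝ → Td d → Vd d}
    (h : ∫⁻ s in Ioi (0:ℝ), wL2 δ m α s < ⊤) : L2on m α T := by
  unfold L2on
  have h1 : ∀ s ∈ Ioc 0 T, ∫⁻ y, ENNReal.ofReal (sqnorm (α s y)) ∂(m s : Measure (Td d)) ≤
      ENNReal.ofReal (Real.exp (δ * T)) * wL2 δ m α s := by
    intro s hs
    unfold wL2
    rw [← mul_assoc, ← ENNReal.ofReal_mul (Real.exp_pos _).le, ← Real.exp_add]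
    refine le_mul_of_one_le_left zero_le ?_
    rw [← ENNReal.ofReal_one]
    refine ENNReal.ofReal_le_ofReal (Real.one_le_exp ?_)
    have := mul_le_mul_of_nonneg_left hs.2 hδ.le
    linarith
  refine (setLIntegral_mono' measurableSet_Ioc h1).trans_lt ?_
  rw [lintegral_const_mul' _ _ ENNReal.ofReal_ne_top]
  refine ENNReal.mul_lt_top ENNReal.ofReal_lt_top ((lintegral_mono_set Ioc_subset_Ioi_self).trans_lt h)

lemma wL2_of_L2on {δ T : ℝ} (hδ : 0 < δ) {m : ℝ → PTd d} {α : ℝ → Td d → Vd d}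
    (h : L2on m α T) : ∫⁻ s in Ioc (0:ℝ) T, wL2 δ m α s < ⊤ := by
  refine (setLIntegral_mono' measurableSet_Ioc fun s hs => ?_).trans_lt h
  unfold wL2
  refine mul_le_of_le_one_left zero_le ?_
  rw [← ENNReal.ofReal_one]
  refine ENNReal.ofReal_le_ofReal (Real.exp_le_one_iff.2 ?_)
  have := mul_nonneg hδ.le hs.1.le
  linarith

def wrc (S : MFGSetting d) (δ : ℝ) (m : ℝ → PTd d) (α : ℝ → Td d → Vd d) (s : ℝ) : ℝ :=
  Real.exp (-δ * s) * runCost S m α s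

lemma wrc_shift (S : MFGSetting d) (δ t : ℝ) (m : ℝ → PTd d) (α : ℝ → Td d → Vd d) (s : ℝ) :
    wrc S δ m α (s + t) = Real.exp (-δ * t) * wrc S δ (fun s => m (s + t)) (fun s => α (s + t)) s := by
  have e : runCost S m α (s + t) = runCost S (fun s => m (s + t)) (fun s => α (s + t)) s := rfl
  unfold wrc
  rw [← mul_assoc, ← Real.exp_add, e]
  congr 2
  ring

lemma wrc_congr (S : MFGSetting d) {δ s : ℝ} {m m' : ℝ → PTd d} {α α' : ℝ → Td d → Vd d}
    (h : m s = m' s) (h' : α s = α' s) : wrc S δ m α s = wrc S δ m' α' s := by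
  simp only [wrc, runCost, h, h']

lemma wrc_ii (S : MFGSetting d) {δ T : ℝ} {m : ℝ → PTd d} {α : ℝ → Td d → Vd d}
    (h : IntervalIntegrable (runCost S m α) volume 0 T) : IntervalIntegrable (wrc S δ m α) volume 0 T :=
  h.continuousOn_mul (by fun_prop)

lemma wrc_ii' (S : MFGSetting d) {δ T : ℝ} {m : ℝ → PTd d} {α : ℝ → Td d → Vd d}
    (h : IntervalIntegrable (wrc S δ m α) volume 0 T) : IntervalIntegrable (runCost S m α) volume 0 T := by
  have h1 : IntervalIntegrable (fun s => Real.exp (δ * s) * wrc S δ m α s) volume 0 T :=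
    h.continuousOn_mul (by fun_prop)
  refine h1.congr fun s _ => ?_
  simp only [wrc, ← mul_assoc, ← Real.exp_add]
  simp

lemma AdmDisc_restrict (S : MFGSetting d) {δ T : ℝ} (hδ : 0 < δ) (hT : 0 ≤ T) {m₀ : PTd d} {m : ℝ → PTd d}
    {α : ℝ → Td d → Vd d} (h : AdmDisc S 1 δ m₀ m α) : AdmOn S 1 m₀ T m α := by
  obtain ⟨h0, hc, hFP, hα, hL, hi⟩ := h
  refine ⟨h0, W1ContOn_iff.2 ((W1ContOn_iff.1 hc).mono Icc_subset_Ici_self),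
    fun s₁ s₂ a b _ => hFP s₁ s₂ a b, hα, L2on_of_wL2 hδ hL, ?_⟩
  refine wrc_ii' S (δ := δ) ?_
  rw [intervalIntegrable_iff_integrableOn_Ioc_of_le hT]
  exact IntegrableOn.mono_set (s := Ioc 0 T) (t := Ioi 0) hi Ioc_subset_Ioi_self

lemma costDisc_split (S : MFGSetting d) {δ t : ℝ} (ht : 0 ≤ t) {m : ℝ → PTd d}
    {α : ℝ → Td d → Vd d} (hi : IntegrableOn (wrc S δ m α) (Ioi 0)) :
    costDisc S δ m α = Jd S δ m α t + Real.exp (-δ * t) *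
      costDisc S δ (fun s => m (s + t)) (fun s => α (s + t)) := by
  have : costDisc S δ m α = ∫ s in Ioi (0:ℝ), wrc S δ m α s := rfl
  rw [this, ← split_Ioi ht, setIntegral_union (disc_Icc t) measurableSet_Ioi
    (hi.mono_set Ioc_subset_Ioi_self) (hi.mono_set (Ioi_subset_Ioi ht)), shift_int]
  simp only [wrc_shift]
  rw [integral_const_mul]
  congr 1
  exact (intervalIntegral.integral_of_le ht).symm

lemma AdmDisc_tail (S : MFGSetting d) {δ t : ℝ} (ht : 0 ≤ t) {m₀ : PTd d} {m : ℝ → PTd d}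
    {α : ℝ → Td d → Vd d} (h : AdmDisc S 1 δ m₀ m α) :
    AdmDisc S 1 δ (m t) (fun s => m (s + t)) (fun s => α (s + t)) := by
  obtain ⟨h0, hc, hFP, hα, hL, hi⟩ := h
  refine ⟨by simp, W1ContOn_iff.2 ?_, ?_, ?_, ?_, ?_⟩
  · refine (W1ContOn_iff.1 hc).comp (f := fun s => s + t) (by fun_prop) fun s hs => ?_
    have hs : 0 ≤ s := hs
    exact add_nonneg hs ht
  · intro s₁ s₂ a b
    have := FPeq_shift t (hFP (s₁ + t) (s₂ + t) (by linarith) (by linarith))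
    simpa using this
  · exact hα.comp (f := fun q : ℝ × Td d => (q.1 + t, q.2)) (by fun_prop)
  · change ∫⁻ s in Ioi (0:ℝ), wL2 δ (fun s => m (s + t)) (fun s => α (s + t)) s < ⊤
    have h1 : ∫⁻ s in Ioi t, wL2 δ m α s < ⊤ := (lintegral_mono_set (Ioi_subset_Ioi ht)).trans_lt hL
    rw [shift_lint] at h1
    simp only [wL2_shift] at h1
    rw [lintegral_const_mul' _ _ ENNReal.ofReal_ne_top] at h1
    by_contra hcon
    rw [not_lt, top_le_iff] at hcon
    rw [hcon, ENNReal.mul_top (by simp [Real.exp_pos])] at h1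
    exact lt_irrefl _ h1
  · change IntegrableOn (wrc S δ (fun s => m (s + t)) (fun s => α (s + t))) (Ioi 0)
    have h1 : IntegrableOn (wrc S δ m α) (Ioi t) :=
      IntegrableOn.mono_set (s := Ioi t) (t := Ioi 0) hi (Ioi_subset_Ioi ht)
    rw [shift_integrable] at h1
    simp only [wrc_shift] at h1
    exact (integrable_const_mul_iff (Real.exp_pos _).ne'.isUnit _).1 h1

lemma AdmDisc_cat (S : MFGSetting d) {δ t : ℝ} (hδ : 0 < δ) (ht : 0 ≤ t) {m₀ : PTd d} {m m' : ℝ → PTd d}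
    {α α' : ℝ → Td d → Vd d} (h : AdmOn S 1 m₀ t m α) (h' : AdmDisc S 1 δ (m t) m' α') :
    AdmDisc S 1 δ m₀ (catM t m m') (catA t α α') ∧
      costDisc S δ (catM t m m') (catA t α α') = Jd S δ m α t + Real.exp (-δ * t) * costDisc S δ m' α' := by
  obtain ⟨h0, hc, hFP, hα, hL, hi⟩ := h
  obtain ⟨h0', hc', hFP', hα', hL', hi'⟩ := h'
  have hcont := catM_cont ht h0' (W1ContOn_iff.1 hc) (W1ContOn_iff.1 hc')
  have hmeas := catA_meas (t := t) hα hα'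
  have eM : ∀ s ∈ Icc 0 t, m s = catM t m m' s := fun s hs => (catM_le hs.1 hs.2).symm
  have eA : ∀ s ∈ Ioc 0 t, α s = catA t α α' s := fun s hs => (catA_le hs.2).symm
  have gM : ∀ s ∈ Ioi (0:ℝ), catM t m m' (s + t) = m' s := fun s hs => by
    have hs : 0 < s := hs
    rw [catM_ge ht h0' (by linarith)]; simp
  have gA : ∀ s ∈ Ioi (0:ℝ), catA t α α' (s + t) = α' s := fun s hs => by
    have hs : 0 < s := hs
    rw [catA_gt (by linarith)]; simp
  have hW : ∫⁻ s in Ioi (0:ℝ), wL2 δ (catM t m m') (catA t α α') s < ⊤ := by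
    rw [← split_Ioi ht, lintegral_union measurableSet_Ioi (disc_Icc t), ENNReal.add_lt_top]
    constructor
    · exact wL2_of_L2on hδ (L2on_congr eM eA hL)
    · rw [shift_lint]
      simp only [wL2_shift]
      rw [lintegral_const_mul' _ _ ENNReal.ofReal_ne_top]
      refine ENNReal.mul_lt_top ENNReal.ofReal_lt_top ?_
      rw [setLIntegral_congr_fun measurableSet_Ioi (g := wL2 δ m' α')
        (fun s hs => wL2_congr (gM s hs) (gA s hs))]
      exact hL'
  have hI : IntegrableOn (wrc S δ (catM t m m') (catA t α α')) (Ioi 0) := by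
    rw [← split_Ioi ht, integrableOn_union]
    constructor
    · have h1 := (intervalIntegrable_iff_integrableOn_Ioc_of_le ht).1 (wrc_ii S (δ := δ) hi)
      refine h1.congr_fun (fun s hs => ?_) measurableSet_Ioc
      exact wrc_congr S (eM s (Ioc_subset_Icc_self hs)) (eA s hs)
    · rw [shift_integrable]
      simp only [wrc_shift]
      refine Integrable.const_mul ?_ _
      refine IntegrableOn.congr_fun (f := wrc S δ m' α') (s := Ioi 0) hi' (fun s hs => ?_) measurableSet_Ioi
      exact wrc_congr S (gM s hs).symm (gA s hs).symm
  have cat1 : ∀ s₁ s₂, 0 ≤ s₁ → s₁ ≤ s₂ → s₂ ≤ t → FPeq 1 (catM t m m') (catA t α α') s₁ s₂ := by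
    intro s₁ s₂ a b c
    refine FPeq_congr b (fun s hs => eM s ⟨a.trans hs.1, hs.2.trans c⟩)
      (fun s hs => eA s ⟨a.trans_lt hs.1, hs.2.trans c⟩) (hFP s₁ s₂ a b c)
  have cat2 : ∀ s₁ s₂, t ≤ s₁ → s₁ ≤ s₂ → FPeq 1 (catM t m m') (catA t α α') s₁ s₂ := by
    intro s₁ s₂ a b
    have := FPeq_shift (-t) (hFP' (s₁ - t) (s₂ - t) (by linarith) (by linarith))
    simp only [sub_neg_eq_add, sub_add_cancel] at this
    refine FPeq_congr b (fun s hs => ?_) (fun s hs => ?_) this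
    · rw [catM_ge ht h0' (a.trans hs.1)]; rfl
    · rw [catA_gt (a.trans_lt hs.1)]; rfl
  refine ⟨⟨?_, W1ContOn_iff.2 hcont.continuousOn, ?_, hmeas, hW, hI⟩, ?_⟩
  · rw [catM_le le_rfl ht, h0]
  · intro s₁ s₂ a b
    rcases le_total s₂ t with c | c
    · exact cat1 s₁ s₂ a b c
    rcases le_total t s₁ with e | e
    · exact cat2 s₁ s₂ e b
    · exact FPeq_trans hcont a e c hmeas (L2on_of_wL2 hδ hW) (cat1 s₁ t a e le_rfl) (cat2 t s₂ le_rfl c)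
  · rw [costDisc_split S ht hI, ← Jd_congr S ht eM eA]
    congr 2
    refine setIntegral_congr_fun measurableSet_Ioi fun s hs => ?_
    exact wrc_congr S (δ := δ) (m := fun s => catM t m m' (s + t)) (α := fun s => catA t α α' (s + t)) (gM s hs) (gA s hs)

end disc


section val
variable {d : ℕ}

lemma exp_Ioi_int {δ : ℝ} (hδ : 0 < δ) (K : ℝ) :
    IntegrableOn (fun s => Real.exp (-δ * s) * K) (Ioi 0) ∧
      ∫ s in Ioi (0:ℝ), Real.exp (-δ * s) * K = K / δ := by
  have h1 := (integrableOn_exp_mul_Ioi (a := -δ) (by linarith) 0)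
  refine ⟨h1.mul_const K, ?_⟩
  rw [integral_mul_const, integral_exp_mul_Ioi (a := -δ) (by linarith) 0]
  simp
  field_simp

lemma heat_adm (S : MFGSetting d) {δ K : ℝ} (hδ : 0 < δ) (hK1 : ∀ m α s, -K ≤ runCost S m α s)
    (hK2 : ∀ m s, runCost S m (fun _ _ => 0) s ≤ K) (μ : PTd d) :
    AdmDisc S 1 δ μ (heatM μ) (fun _ _ => 0) ∧ costDisc S δ (heatM μ) (fun _ _ => 0) ≤ K / δ := by
  have hbd : ∀ s, ‖wrc S δ (heatM μ) (fun _ _ => 0) s‖ ≤ Real.exp (-δ * s) * K := by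
    intro s
    rw [wrc, norm_mul, Real.norm_eq_abs, abs_of_pos (Real.exp_pos _)]
    refine mul_le_mul_of_nonneg_left (abs_le.2 ⟨hK1 _ _ _, hK2 _ _⟩) (Real.exp_pos _).le
  have hI : IntegrableOn (wrc S δ (heatM μ) (fun _ _ => 0)) (Ioi 0) := by
    refine Integrable.mono' (exp_Ioi_int hδ K).1 ?_ (ae_of_all _ hbd)
    have e : Ioi (0:ℝ) = ⋃ n : ℕ, Ioc 0 (n:ℝ) := by
      ext s
      simp only [mem_Ioi, mem_iUnion, mem_Ioc]
      exact ⟨fun h => (exists_nat_ge s).imp fun n hn => ⟨h, hn⟩, fun ⟨n, h⟩ => h.1⟩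
    rw [e, aestronglyMeasurable_iUnion_iff]
    intro n
    have hn : (0:ℝ) ≤ n := Nat.cast_nonneg n
    have := AdmOn_of S (heat_cont μ) hn (heat_zero μ) (α := fun _ _ => 0)
      (fun s₁ s₂ a b _ => heat_FP μ a b) measurable_const (by simp [L2on, sqnorm])
    have := wrc_ii S (δ := δ) this.2.2.2.2.2
    exact ((intervalIntegrable_iff_integrableOn_Ioc_of_le hn).1 this).aestronglyMeasurable
  refine ⟨⟨heat_zero μ, W1ContOn_iff.2 (heat_cont μ).continuousOn, fun s₁ s₂ a b => heat_FP μ a b,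
    measurable_const, by simp [sqnorm], hI⟩, ?_⟩
  rw [← (exp_Ioi_int hδ K).2]
  exact integral_mono hI (exp_Ioi_int hδ K).1 fun s => (le_abs_self _).trans (hbd s)

lemma cost_lower (S : MFGSetting d) {δ K : ℝ} (hδ : 0 < δ) (hK1 : ∀ m α s, -K ≤ runCost S m α s)
    {μ : PTd d} {m : ℝ → PTd d} {α : ℝ → Td d → Vd d} (h : AdmDisc S 1 δ μ m α) :
    -(K / δ) ≤ costDisc S δ m α := by
  rw [← neg_div, ← (exp_Ioi_int hδ (-K)).2]
  exact integral_mono (exp_Ioi_int hδ (-K)).1 h.2.2.2.2.2 fun s =>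
    mul_le_mul_of_nonneg_left (hK1 _ _ _) (Real.exp_pos _).le

lemma V_facts (S : MFGSetting d) : ∃ K, 0 < K ∧ (∀ m α s, -K ≤ runCost S m α s) ∧ ∀ δ, 0 < δ →
    (∀ μ : PTd d, |Vfun S 1 δ μ| ≤ K / δ) ∧
    (∀ (μ : PTd d) m α t, 0 ≤ t → AdmOn S 1 μ t m α →
      Vfun S 1 δ μ ≤ Jd S δ m α t + Real.exp (-δ * t) * Vfun S 1 δ (m t)) ∧
    (∀ (μ : PTd d) t, 0 ≤ t → ∀ ε > 0, ∃ m α, AdmOn S 1 μ t m α ∧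
      Jd S δ m α t + Real.exp (-δ * t) * Vfun S 1 δ (m t) ≤ Vfun S 1 δ μ + ε) := by
  obtain ⟨K, hK, hK1, hK2⟩ := rc_bounds S
  refine ⟨K, hK, hK1, fun δ hδ => ?_⟩
  have hne : ∀ μ : PTd d, ({ r | ∃ m α, AdmDisc S 1 δ μ m α ∧ r = costDisc S δ m α }).Nonempty :=
    fun μ => ⟨_, _, _, (heat_adm S hδ hK1 hK2 μ).1, rfl⟩
  have hlow : ∀ μ : PTd d, ∀ r ∈ { r | ∃ m α, AdmDisc S 1 δ μ m α ∧ r = costDisc S δ m α }, -(K/δ) ≤ r := by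
    rintro μ r ⟨m, α, h, rfl⟩
    exact cost_lower S hδ hK1 h
  have hbb : ∀ μ : PTd d, BddBelow { r | ∃ m α, AdmDisc S 1 δ μ m α ∧ r = costDisc S δ m α } :=
    fun μ => ⟨_, hlow μ⟩
  have hle : ∀ (μ : PTd d) m α, AdmDisc S 1 δ μ m α → Vfun S 1 δ μ ≤ costDisc S δ m α := fun μ m α h =>
    csInf_le (hbb μ) ⟨m, α, h, rfl⟩
  have happ : ∀ (μ : PTd d), ∀ ε > 0, ∃ m α, AdmDisc S 1 δ μ m α ∧ costDisc S δ m α < Vfun S 1 δ μ + ε := by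
    intro μ ε hε
    obtain ⟨r, ⟨m, α, h, rfl⟩, hr⟩ := exists_lt_of_csInf_lt (hne μ) (lt_add_of_pos_right (Vfun S 1 δ μ) hε)
    exact ⟨m, α, h, hr⟩
  refine ⟨fun μ => abs_le.2 ⟨le_csInf (hne μ) (hlow μ), ?_⟩, ?_, ?_⟩
  · exact (hle μ _ _ (heat_adm S hδ hK1 hK2 μ).1).trans (heat_adm S hδ hK1 hK2 μ).2
  · intro μ m α t ht h
    refine le_of_forall_pos_le_add fun ε hε => ?_
    obtain ⟨m', α', h', hc⟩ := happ (m t) ε hε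
    obtain ⟨c1, c2⟩ := AdmDisc_cat S hδ ht h h'
    have h3 := hle μ _ _ c1
    rw [c2] at h3
    have h4 : Real.exp (-δ * t) ≤ 1 := Real.exp_le_one_iff.2 (by nlinarith)
    have h5 := Real.exp_pos (-δ * t)
    nlinarith
  · intro μ t ht ε hε
    obtain ⟨m, α, h, hc⟩ := happ μ ε hε
    refine ⟨m, α, AdmDisc_restrict S hδ ht h, ?_⟩
    have h1 := hle (m t) _ _ (AdmDisc_tail S ht h)
    rw [costDisc_split S ht h.2.2.2.2.2] at hc
    have h5 := mul_le_mul_of_nonneg_left h1 (Real.exp_pos (-δ * t)).le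
    linarith

lemma V_lsc (S : MFGSetting d) {δ : ℝ} (hδ : 0 < δ) {μk : ℕ → PTd d} {μ : PTd d}
    (hμ : Tendsto μk atTop (𝓝 μ)) {c : ℝ} (hc : ∀ k, Vfun S 1 δ (μk k) ≤ c) : Vfun S 1 δ μ ≤ c := by
  obtain ⟨K, hK, -, hV⟩ := V_facts S
  obtain ⟨hb, hle, hge⟩ := hV δ hδ
  refine le_of_forall_pos_le_add fun ε hε => ?_
  obtain ⟨T, hT, hTe⟩ : ∃ T : ℝ, 0 ≤ T ∧ Real.exp (-δ * T) * (K / δ) ≤ ε / 3 := by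
    have h1 : Tendsto (fun T : ℝ => Real.exp (-δ * T) * (K / δ)) atTop (𝓝 (0 * (K / δ))) := by
      refine Tendsto.mul_const _ (Real.tendsto_exp_atBot.comp ?_)
      exact (tendsto_const_mul_atBot_of_neg (by linarith)).2 tendsto_id
    rw [zero_mul] at h1
    obtain ⟨T, h2, h3⟩ := ((h1.eventually (gt_mem_nhds (by linarith : (0:ℝ) < ε / 3))).and (eventually_ge_atTop 0)).exists
    exact ⟨T, h3, h2.le⟩
  choose mk αk hadm hJ using fun k => hge (μk k) T hT (ε / 3) (by linarith)
  have hJ' : ∀ k, Jd S δ (mk k) (αk k) T ≤ c + 2 * (ε / 3) := fun k => by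
    have h1 := (abs_le.1 (hb (mk k T))).1
    have h2 := mul_le_mul_of_nonneg_left h1 (Real.exp_pos (-δ * T)).le
    have := hJ k
    have := hc k
    linarith
  obtain ⟨ns, -, m, α, hA, -, hlim⟩ := compactness S hT hμ mk αk hadm hJ'
  have h1 := hlim δ _ (Eventually.of_forall fun k => hJ' (ns k))
  have h2 := hle μ m α T hT hA
  have h3 := mul_le_mul_of_nonneg_left (abs_le.1 (hb (m T))).2 (Real.exp_pos (-δ * T)).le
  linarith

lemma J_compare (S : MFGSetting d) {K δ t : ℝ} (hK : 0 < K) (hK1 : ∀ m α s, -K ≤ runCost S m α s)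
    (hδ : 0 < δ) (ht : 0 ≤ t) {m : ℝ → PTd d} {α : ℝ → Td d → Vd d}
    (h : IntervalIntegrable (runCost S m α) volume 0 t) :
    Jd S δ m α t ≤ (∫ s in (0:ℝ)..t, runCost S m α s) + K * t * (1 - Real.exp (-δ * t)) ∧
    Real.exp (-δ * t) * ((∫ s in (0:ℝ)..t, runCost S m α s) + K * t) ≤ Jd S δ m α t + K * t := by
  have hw : IntervalIntegrable (fun s => Real.exp (-δ * s) * runCost S m α s) volume 0 t := wrc_ii S h
  have hex : ∀ s ∈ Icc 0 t, Real.exp (-δ * t) ≤ Real.exp (-δ * s) ∧ Real.exp (-δ * s) ≤ 1 := fun s hs => by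
    have h1 := mul_le_mul_of_nonneg_left hs.2 hδ.le
    have h2 := mul_nonneg hδ.le hs.1
    exact ⟨Real.exp_le_exp.2 (by linarith), Real.exp_le_one_iff.2 (by linarith)⟩
  constructor
  · have := intervalIntegral.integral_mono_on ht hw (h.add (intervalIntegrable_const (c := K * (1 - Real.exp (-δ * t)))))
      (fun s hs => by
        obtain ⟨a, b⟩ := hex s hs
        have := hK1 m α s
        have c1 : 0 ≤ (1 - Real.exp (-δ * s)) * (runCost S m α s + K) := mul_nonneg (by linarith) (by linarith)
        have c2 : 0 ≤ K * (Real.exp (-δ * s) - Real.exp (-δ * t)) := mul_nonneg hK.le (by linarith)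
        linarith)
    rw [intervalIntegral.integral_add h intervalIntegrable_const, intervalIntegral.integral_const] at this
    simp only [sub_zero, smul_eq_mul] at this
    unfold Jd
    linarith
  · have := intervalIntegral.integral_mono_on ht
      ((h.add (intervalIntegrable_const (c := K))).const_mul (Real.exp (-δ * t)))
      (hw.add (intervalIntegrable_const (c := K)))
      (fun s hs => by
        obtain ⟨a, b⟩ := hex s hs
        have := hK1 m α s
        have c1 : 0 ≤ (Real.exp (-δ * s) - Real.exp (-δ * t)) * (runCost S m α s + K) := mul_nonneg (by linarith) (by linarith)
        have c2 : 0 ≤ K * (1 - Real.exp (-δ * s)) := mul_nonneg hK.le (by linarith)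
        linarith)
    rw [intervalIntegral.integral_const_mul, intervalIntegral.integral_add h intervalIntegrable_const,
      intervalIntegral.integral_add hw intervalIntegrable_const, intervalIntegral.integral_const] at this
    simp only [sub_zero, smul_eq_mul] at this
    unfold Jd
    linarith

end val


section final
variable {d : ℕ}

lemma a_bound {x : ℝ} (hx : 0 ≤ x) (hx1 : x ≤ 1) : |(1 - Real.exp (-x)) - x| ≤ x^2 := by
  have := Real.abs_exp_sub_one_sub_id_le (x := -x) (by rw [abs_neg, abs_of_nonneg hx]; exact hx1)
  rw [abs_sub_comm]
  calc _ = |Real.exp (-x) - 1 - -x| := by congr 1; ring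
    _ ≤ _ := by simpa using this

lemma unif_lim {V : ℕ → PTd d → ℝ} {δseq : ℕ → ℝ} {χ : PTd d → ℝ} {lam : ℝ} {η : PTd d}
    (hpos : ∀ n : ℕ, 0 < δseq n) (hto : Tendsto δseq atTop (𝓝 0))
    (hχ : ∀ ε > 0, ∃ N : ℕ, ∀ n ≥ N, ∀ μ : PTd d, |(V n μ - V n η) - χ μ| < ε)
    (hlam : ∀ ε > 0, ∃ N : ℕ, ∀ n ≥ N, ∀ μ : PTd d, |δseq n * V n μ - (-lam)| < ε)
    {t : ℝ} (ht : 0 < t) : ∀ ε > 0, ∀ᶠ n in atTop, ∀ μ ν : PTd d,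
      |(Real.exp (-δseq n * t) * V n ν - V n μ) - (χ ν + lam * t - χ μ)| ≤ ε := by
  intro ε hε
  obtain ⟨N1, h1⟩ := hχ (ε / 4) (by linarith)
  obtain ⟨N2, h2⟩ := hlam (ε / (4 * t)) (by positivity)
  have h3 : ∀ᶠ n in atTop, δseq n * t ≤ 1 := by
    have : Tendsto (fun n => δseq n * t) atTop (𝓝 (0 * t)) := hto.mul_const t
    rw [zero_mul] at this
    exact (this.eventually (gt_mem_nhds one_pos)).mono fun n h => h.le
  have h4 : ∀ᶠ n in atTop, |lam| * (δseq n * t^2) ≤ ε / 4 := by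
    have : Tendsto (fun n => |lam| * (δseq n * t^2)) atTop (𝓝 (|lam| * (0 * t^2))) :=
      (hto.mul_const _).const_mul _
    rw [zero_mul, mul_zero] at this
    exact (this.eventually (gt_mem_nhds (by linarith : (0:ℝ) < ε/4))).mono fun n h => h.le
  filter_upwards [eventually_ge_atTop N1, eventually_ge_atTop N2, h3, h4] with n n1 n2 n3 n4 μ ν
  have hδ := hpos n
  set δ := δseq n with hδd
  have e1 := (abs_lt.1 (h1 n n1 μ))
  have e2 := (abs_lt.1 (h1 n n1 ν))
  have e3 := h2 n n2 ν
  have hx : 0 ≤ δ * t := by positivity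
  obtain ⟨a, ha⟩ : ∃ a, a = (1 - Real.exp (-(δ * t))) / δ := ⟨_, rfl⟩
  have ha' : a * δ = 1 - Real.exp (-(δ * t)) := by rw [ha]; field_simp
  have ha0 : 0 ≤ a := by
    rw [ha]
    refine div_nonneg ?_ hδ.le
    have : Real.exp (-(δ * t)) ≤ 1 := Real.exp_le_one_iff.2 (by linarith)
    linarith
  have hat : a ≤ t := by
    rw [ha, div_le_iff₀ hδ]
    have := Real.add_one_le_exp (-(δ * t))
    linarith
  have hab : |a - t| ≤ δ * t^2 := by
    have := a_bound hx n3
    rw [← ha', show a * δ - δ * t = (a - t) * δ by ring, abs_mul, abs_of_pos hδ] at this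
    refine le_of_mul_le_mul_right (this.trans (le_of_eq ?_)) hδ
    ring
  have f1 : Real.exp (-δ * t) * V n ν - V n ν - lam * t = -(a * (δ * V n ν - (-lam))) + lam * (a - t) := by
    have : Real.exp (-δ * t) = 1 - a * δ := by rw [ha', neg_mul]; ring
    rw [this]; ring
  have f2 : |a * (δ * V n ν - (-lam))| ≤ ε / 4 := by
    rw [abs_mul, abs_of_nonneg ha0]
    calc _ ≤ t * (ε / (4 * t)) := mul_le_mul hat e3.le (abs_nonneg _) ht.le
      _ = ε / 4 := by field_simp
  have f3 : |lam * (a - t)| ≤ ε / 4 := by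
    rw [abs_mul]
    exact (mul_le_mul_of_nonneg_left hab (abs_nonneg _)).trans n4
  have g2 := abs_le.1 f2
  have g3 := abs_le.1 f3
  rw [abs_le]
  constructor <;> linarith [e1.1, e1.2, e2.1, e2.2, g2.1, g2.2, g3.1, g3.2]

lemma chi_lsc (S : MFGSetting d) {δseq : ℕ → ℝ} {χ : PTd d → ℝ} {η : PTd d}
    (hpos : ∀ n : ℕ, 0 < δseq n)
    (hχ : ∀ ε > 0, ∃ N : ℕ, ∀ n ≥ N, ∀ μ : PTd d,
      |(Vfun S 1 (δseq n) μ - Vfun S 1 (δseq n) η) - χ μ| < ε)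
    {μk : ℕ → PTd d} {μ : PTd d}
    (hμ : Tendsto μk atTop (𝓝 μ)) {c : ℝ} (hc : ∀ᶠ k in atTop, χ (μk k) ≤ c) : χ μ ≤ c := by
  refine le_of_forall_pos_le_add fun ε hε => ?_
  obtain ⟨N, hN⟩ := hχ (ε / 2) (by linarith)
  have hN := hN N le_rfl
  obtain ⟨k0, hk0⟩ := eventually_atTop.1 hc
  have h1 : Vfun S 1 (δseq N) μ ≤ c + ε / 2 + Vfun S 1 (δseq N) η := by
    refine V_lsc S (hpos N) (μk := fun k => μk (k + k0)) ((tendsto_add_atTop_iff_nat k0).2 hμ) fun k => ?_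
    have := hk0 (k + k0) (by omega)
    have := (abs_lt.1 (hN (μk (k + k0)))).2
    linarith
  have := (abs_lt.1 (hN μ)).1
  linarith

end final

/-- Lemma 1.7 of the paper.  The subsequential limit `χ` satisfies the
dynamic programming principle with the constant `λ`, and the corresponding infimum is
attained. -/
theorem chi_dynamic_programming (d : ℕ) (S : MFGSetting d) (η : PTd d)
    (δseq : ℕ → ℝ) (χ : PTd d → ℝ) (lam : ℝ)
    (hpos : ∀ n : ℕ, 0 < δseq n)
    (hto : Filter.Tendsto δseq Filter.atTop (nhds 0))
    (hχ : ∀ ε > 0, ∃ N : ℕ, ∀ n ≥ N, ∀ μ : PTd d,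
      |(Vfun S 1 (δseq n) μ - Vfun S 1 (δseq n) η) - χ μ| < ε)
    (hlam : ∀ ε > 0, ∃ N : ℕ, ∀ n ≥ N, ∀ μ : PTd d,
      |δseq n * Vfun S 1 (δseq n) μ - (-lam)| < ε) :
    ∀ (m₀ : PTd d) (t : ℝ), 0 < t →
      χ m₀ = sInf (DPPval S 1 χ lam t m₀) ∧
      ∃ m α, AdmOn S 1 m₀ t m α ∧
        χ m₀ = (∫ s in (0:ℝ)..t, runCost S m α s) + χ (m t) + lam * t := by
  intro m₀ t ht
  obtain ⟨K, hK, hK1, hV⟩ := V_facts S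
  have hE := unif_lim (V := fun n => Vfun S 1 (δseq n)) hpos hto hχ hlam ht
  -- bound on chi
  obtain ⟨B, hB⟩ : ∃ B, ∀ μ, |χ μ| ≤ B := by
    obtain ⟨N, hN⟩ := hχ 1 one_pos
    refine ⟨2 * (K / δseq N) + 1, fun μ => ?_⟩
    have h1 := abs_lt.1 (hN N le_rfl μ)
    have h2 := abs_le.1 ((hV _ (hpos N)).1 μ)
    have h3 := abs_le.1 ((hV _ (hpos N)).1 η)
    rw [abs_le]
    constructor <;> linarith [h1.1, h1.2, h2.1, h2.2, h3.1, h3.2]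
  have hexp : Tendsto (fun n => Real.exp (-δseq n * t)) atTop (𝓝 1) := by
    have : Tendsto (fun n => Real.exp (-δseq n * t)) atTop (𝓝 (Real.exp (-0 * t))) :=
      (Real.continuous_exp.tendsto _).comp (hto.neg.mul_const t)
    simpa using this
  -- upper inequality
  have hup : ∀ m α, AdmOn S 1 m₀ t m α →
      χ m₀ ≤ (∫ s in (0:ℝ)..t, runCost S m α s) + χ (m t) + lam * t := by
    intro m α h
    refine le_of_forall_pos_le_add fun ε hε => ?_
    have h1 : ∀ᶠ n in atTop, K * t * (1 - Real.exp (-δseq n * t)) ≤ ε / 2 := by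
      have : Tendsto (fun n => K * t * (1 - Real.exp (-δseq n * t))) atTop (𝓝 (K * t * (1 - 1))) :=
        (tendsto_const_nhds.sub hexp).const_mul _
      rw [sub_self, mul_zero] at this
      exact (this.eventually (gt_mem_nhds (by linarith : (0:ℝ) < ε/2))).mono fun n h => h.le
    obtain ⟨n, h2, h3⟩ := ((hE (ε / 2) (by linarith)).and h1).exists
    have h4 := (abs_le.1 (h2 m₀ (m t))).2
    have h5 := (hV _ (hpos n)).2.1 m₀ m α t ht.le h
    have h6 := (J_compare S hK hK1 (hpos n) ht.le h.2.2.2.2.2).1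
    linarith
  -- approximate minimizers
  have happ : ∀ ε > 0, ∃ m α, AdmOn S 1 m₀ t m α ∧
      (∫ s in (0:ℝ)..t, runCost S m α s) + χ (m t) + lam * t ≤ χ m₀ + ε := by
    intro ε hε
    obtain ⟨Q, hQ⟩ : ∃ Q, Q = 2 * B + |lam| * t + ε + K * t := ⟨_, rfl⟩
    have h1 : ∀ᶠ n in atTop, ((Real.exp (-δseq n * t))⁻¹ - 1) * Q ≤ ε / 2 := by
      have : Tendsto (fun n => ((Real.exp (-δseq n * t))⁻¹ - 1) * Q) atTop (𝓝 ((1⁻¹ - 1) * Q)) :=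
        ((hexp.inv₀ one_ne_zero).sub_const 1).mul_const Q
      rw [inv_one, sub_self, zero_mul] at this
      exact (this.eventually (gt_mem_nhds (by linarith : (0:ℝ) < ε/2))).mono fun n h => h.le
    obtain ⟨n, h2, h3⟩ := ((hE (ε / 4) (by linarith)).and h1).exists
    obtain ⟨m, α, hA, hJ⟩ := (hV _ (hpos n)).2.2 m₀ t ht.le (ε / 4) (by linarith)
    refine ⟨m, α, hA, ?_⟩
    have h4 := (abs_le.1 (h2 m₀ (m t))).1
    have h6 := (J_compare S hK hK1 (hpos n) ht.le hA.2.2.2.2.2).2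
    obtain ⟨J, hJd⟩ : ∃ J, J = ∫ s in (0:ℝ)..t, runCost S m α s := ⟨_, rfl⟩
    rw [← hJd] at h6 ⊢
    obtain ⟨P, hP⟩ : ∃ P, P = χ m₀ - χ (m t) - lam * t + ε / 2 + K * t := ⟨_, rfl⟩
    have h7 : Real.exp (-δseq n * t) * (J + K * t) ≤ P := by linarith
    have hep := Real.exp_pos (-δseq n * t)
    have h8 : J + K * t ≤ (Real.exp (-δseq n * t))⁻¹ * P := by
      rw [inv_mul_eq_div, le_div_iff₀ hep, mul_comm]; exact h7
    have hPQ : P ≤ Q := by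
      have a1 := abs_le.1 (hB m₀)
      have a2 := abs_le.1 (hB (m t))
      have a3 := mul_le_mul_of_nonneg_right (neg_abs_le lam) ht.le
      rw [hP, hQ]
      linarith [a1.1, a1.2, a2.1, a2.2]
    have h9 : 1 ≤ (Real.exp (-δseq n * t))⁻¹ := by
      refine (one_le_inv₀ hep).2 (Real.exp_le_one_iff.2 ?_)
      have := mul_pos (hpos n) ht
      linarith
    have h10 : ((Real.exp (-δseq n * t))⁻¹ - 1) * P ≤ ((Real.exp (-δseq n * t))⁻¹ - 1) * Q :=
      mul_le_mul_of_nonneg_left hPQ (by linarith)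
    linarith
  -- existence of a minimizer
  have hmin : ∃ m α, AdmOn S 1 m₀ t m α ∧
      (∫ s in (0:ℝ)..t, runCost S m α s) + χ (m t) + lam * t ≤ χ m₀ := by
    have hseq : ∀ k : ℕ, ∃ m α, AdmOn S 1 m₀ t m α ∧
        (∫ s in (0:ℝ)..t, runCost S m α s) + χ (m t) + lam * t ≤ χ m₀ + 1 / ((k:ℝ) + 1) :=
      fun k => happ _ (by positivity)
    choose mk αk hadm hle using hseq
    obtain ⟨x, -, φ, hφ, hx⟩ := (isCompact_Icc (a := -B) (b := B)).tendsto_subseq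
      (x := fun k => χ (mk k t)) (fun k => abs_le.1 (hB _))
    have hJ0 : ∀ m α, Jd S 0 m α t = ∫ s in (0:ℝ)..t, runCost S m α s := fun m α => by simp [Jd]
    have hbd : ∀ k, Jd S 0 (mk (φ k)) (αk (φ k)) t ≤ χ m₀ + 1 + B - lam * t := by
      intro k
      have h1 := hle (φ k)
      have h2 := abs_le.1 (hB (mk (φ k) t))
      have h3 : 1 / (((φ k : ℕ) : ℝ) + 1) ≤ 1 := by
        rw [div_le_one (by positivity)]
        have : (0:ℝ) ≤ (φ k : ℕ) := Nat.cast_nonneg _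
        linarith
      rw [hJ0]
      linarith [h2.1]
    obtain ⟨ns, hns, m, α, hA, hlim, hJl⟩ := compactness S ht.le (tendsto_const_nhds (x := m₀))
      (fun k => mk (φ k)) (fun k => αk (φ k)) (fun k => hadm (φ k)) hbd
    have hx' : Tendsto (fun k => χ (mk (φ (ns k)) t)) atTop (𝓝 x) := hx.comp hns.tendsto_atTop
    have hone : Tendsto (fun k => 1 / (((φ (ns k) : ℕ) : ℝ) + 1)) atTop (𝓝 0) :=
      tendsto_one_div_add_atTop_nhds_zero_nat.comp (hφ.tendsto_atTop.comp hns.tendsto_atTop)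
    refine ⟨m, α, hA, le_of_forall_pos_le_add fun ε hε => ?_⟩
    have c1 : χ (m t) ≤ x + ε / 4 := by
      refine chi_lsc S hpos hχ (hlim t ⟨ht.le, le_rfl⟩) ?_
      exact (hx'.eventually (gt_mem_nhds (by linarith : x < x + ε / 4))).mono fun k h => h.le
    have c2 : Jd S 0 m α t ≤ χ m₀ - x - lam * t + ε / 2 := by
      refine hJl 0 _ ?_
      filter_upwards [hx'.eventually (lt_mem_nhds (by linarith : x - ε / 4 < x)),
        hone.eventually (gt_mem_nhds (by linarith : (0:ℝ) < ε / 4))] with k k1 k2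
      have := hle (φ (ns k))
      rw [hJ0]
      linarith
    rw [hJ0] at c2
    linarith
  obtain ⟨m, α, hA, hle⟩ := hmin
  have heq := le_antisymm (hup m α hA) hle
  refine ⟨?_, m, α, hA, heq⟩
  have hleast : IsLeast (DPPval S 1 χ lam t m₀) (χ m₀) := by
    refine ⟨⟨m, α, hA, heq⟩, ?_⟩
    rintro r ⟨m', α', hA', rfl⟩
    exact hup m' α' hA'
  exact hleast.csInf_eq.symm
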